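/- arXiv:1902.11215 — 6 statements merged into one kernel-verified Lean document; each statement's English description precedes it below -/
import Mathlib

section
/- Let w : [0,∞)ⁿ → (0,∞) be a weight, i.e. a measurable, locally bounded function satisfying w(x+y) ≤ w(x)·w(y) for all x, y ∈ [0,∞)ⁿ. Let f : [0,∞)ⁿ → ℂ be measurable with f·w essentially bounded, and let k : [0,∞)ⁿ → ℂ satisfy ∫_{[0,∞)ⁿ} |k(x)| w(x) dx < ∞. Assume that ∫_{[0,∞)ⁿ} k(x) e^{−x·z} dx ≠ −1 for every z ∈ ℂⁿ such that x·Re z ≥ −log w(x) for all x ∈ [0,∞)ⁿ. If (f(x) + ∫_{[0,x]} f(x−y) k(y) dy)·w(x) → 0 at infinity (i.e., for every ε > 0 there is R > 0 such that the expression has absolute value < ε for almost every x ∈ [0,∞)ⁿ with |x| > R), then f(x)·w(x) → 0 at infinity in the same sense. -/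
open MeasureTheory

lemma exp_of_semigroup {a : ℝ → ℂ} (hc : ContinuousOn a (Set.Ici 0)) (h0 : a 0 = 1)
    (hadd : ∀ s t, 0 ≤ s → 0 ≤ t → a (s + t) = a s * a t) :
    ∃ c : ℂ, ∀ t, 0 ≤ t → a t = Complex.exp (-(t * c)) := by
  set b : ℝ → ℂ := fun t => a (max t 0) with hb
  have hbc : Continuous b := hc.comp_continuous (by fun_prop) (fun t => le_max_right t 0)
  have hba : ∀ t, 0 ≤ t → b t = a t := fun t ht => by simp [hb, ht]
  set I : ℝ → ℂ := fun t => ∫ s in (0 : ℝ)..t, b s with hI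
  have hId : ∀ t, HasDerivAt I (b t) t := fun t => (hbc.integral_hasStrictDerivAt 0 t).hasDerivAt
  obtain ⟨δ, hδ, hIδ⟩ : ∃ δ : ℝ, 0 < δ ∧ I δ ≠ 0 := by
    by_contra! H
    have h1 : HasDerivWithinAt I (b 0) (Set.Ici 0) 0 := (hId 0).hasDerivWithinAt
    have h2 : HasDerivWithinAt I 0 (Set.Ici 0) 0 := by
      refine (hasDerivWithinAt_const (0 : ℝ) (Set.Ici 0) (0 : ℂ)).congr (fun x hx => ?_)
        (by simp [hI])
      rcases (Set.mem_Ici.1 hx).eq_or_lt with rfl | hx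
      · simp [hI]
      · exact H x hx
    have h3 := (uniqueDiffWithinAt_Ici (0 : ℝ)).eq_deriv _ h1 h2
    rw [hba 0 le_rfl, h0] at h3
    exact one_ne_zero h3
  have hshift : ∀ t, 0 ≤ t → a t = (I (t + δ) - I t) / I δ := by
    intro t ht
    rw [eq_div_iff hIδ]
    have e1 : I (t + δ) - I t = ∫ s in t..(t + δ), b s :=
      intervalIntegral.integral_interval_sub_left (hbc.intervalIntegrable _ _)
        (hbc.intervalIntegrable _ _)
    have e2 : ∫ s in t..(t + δ), b s = ∫ s in (0 : ℝ)..δ, b (t + s) := by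
      rw [intervalIntegral.integral_comp_add_left]; simp
    rw [e1, e2, hI, ← intervalIntegral.integral_const_mul]
    refine intervalIntegral.integral_congr (fun s hs => ?_)
    rw [Set.uIcc_of_le hδ.le] at hs
    show a t * b s = b (t + s)
    rw [hba s hs.1, hba (t + s) (add_nonneg ht hs.1), hadd t s ht hs.1]
  set c : ℂ := (a δ - 1) / I δ with hcdef
  have hda : ∀ t, 0 ≤ t → HasDerivWithinAt a (c * a t) (Set.Ici t) t := by
    intro t ht
    have h1 : HasDerivAt (fun u => (I (u + δ) - I u) / I δ) ((b (t + δ) - b t) / I δ) t :=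
      (((hId (t + δ)).comp_add_const t δ).sub (hId t)).div_const _
    have h2 := (h1.hasDerivWithinAt (s := Set.Ici t)).congr
      (fun u hu => hshift u (ht.trans hu)) (hshift t ht)
    refine h2.congr_deriv ?_
    rw [hba t ht, hba _ (add_nonneg ht hδ.le), hadd t δ ht hδ.le, hcdef]
    ring
  refine ⟨-c, fun t ht => ?_⟩
  have hconst := constant_of_has_deriv_right_zero (f := fun u : ℝ => a u * Complex.exp (-(u * c)))
    (a := 0) (b := t) ?_ ?_ t ⟨ht, le_rfl⟩
  · simp only [h0, Complex.ofReal_zero, zero_mul, neg_zero, Complex.exp_zero, mul_one] at hconst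
    calc a t = (a t * Complex.exp (-(t * c))) * Complex.exp (-(t * -c)) := by
          rw [mul_assoc, ← Complex.exp_add]; simp
      _ = _ := by rw [hconst, one_mul]
  · exact (hc.mono Set.Icc_subset_Ici_self).mul (by fun_prop)
  · intro u hu
    have h1 : HasDerivAt (fun u : ℝ => Complex.exp (-(u * c)))
        (Complex.exp (-(u * c)) * -(1 * c)) u :=
      (((hasDerivAt_id u).ofReal_comp.mul_const c).neg).cexp
    refine ((hda u hu.1).mul h1.hasDerivWithinAt).congr_deriv ?_
    ring

lemma exp_of_orthant_semigroup {n : ℕ} {χ : (Fin n → ℝ) → ℂ}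
    (hc : ContinuousOn χ {x | 0 ≤ x}) (h0 : χ 0 = 1)
    (hadd : ∀ x y, 0 ≤ x → 0 ≤ y → χ (x + y) = χ x * χ y) :
    ∃ z : Fin n → ℂ, ∀ x, 0 ≤ x → χ x = Complex.exp (-∑ i, (x i : ℂ) * z i) := by
  have key : ∀ i : Fin n, ∃ c : ℂ, ∀ t : ℝ, 0 ≤ t →
      χ (Pi.single i t) = Complex.exp (-(t * c)) := by
    intro i
    refine exp_of_semigroup (a := fun t => χ (Pi.single i t)) ?_ (by simpa using h0) ?_
    · exact hc.comp (continuous_single (A := fun _ : Fin n => ℝ) i).continuousOn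
        (fun t ht => Pi.single_nonneg.2 ht)
    · intro s t hs ht
      rw [Pi.single_add]
      exact hadd _ _ (Pi.single_nonneg.2 hs) (Pi.single_nonneg.2 ht)
  choose z hz using key
  refine ⟨z, fun x hx => ?_⟩
  have hsum : ∀ s : Finset (Fin n), χ (∑ i ∈ s, Pi.single i (x i)) =
      ∏ i ∈ s, χ (Pi.single i (x i)) := by
    intro s
    induction s using Finset.induction_on with
    | empty => simpa using h0
    | insert i s hi ih =>
      rw [Finset.sum_insert hi, Finset.prod_insert hi, ← ih]
      exact hadd _ _ (Pi.single_nonneg.2 (hx i))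
        (Finset.sum_nonneg fun j _ => Pi.single_nonneg.2 (hx j))
  calc χ x = χ (∑ i, Pi.single i (x i)) := by rw [Finset.univ_sum_single]
    _ = ∏ i, Complex.exp (-((x i : ℂ) * z i)) := by
      rw [hsum]; exact Finset.prod_congr rfl fun i _ => hz i _ (hx i)
    _ = _ := by rw [← Complex.exp_sum, Finset.sum_neg_distrib]

/-- Gelfand theory for a commuting family: if `1 + a` is not invertible, some character of the
closed algebra generated by the family takes the value `-1` at `a`. -/
lemma exists_multiplicative_functional {B : Type*} [NormedRing B] [NormedAlgebra ℂ B]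
    [CompleteSpace B] [NormOneClass B] {s : Set B} (hs : ∀ x ∈ s, ∀ y ∈ s, x * y = y * x)
    {a : B} (ha : a ∈ s) (hu : ¬ IsUnit (1 + a)) :
    ∃ φ : B →L[ℂ] ℂ, φ 1 = 1 ∧ φ a = -1 ∧ (∀ b, ‖φ b‖ ≤ ‖b‖) ∧
      ∀ x ∈ s, ∀ y ∈ s, φ (x * y) = φ x * φ y := by
  let A := (Algebra.adjoin ℂ s).topologicalClosure
  have hsA : ∀ x ∈ s, x ∈ A := fun x hx =>
    Subalgebra.le_topologicalClosure _ (Algebra.subset_adjoin hx)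
  have hcomm := Algebra.isMulCommutative_adjoin ℂ hs
  let _ : NormedCommRing A :=
    { (inferInstance : NormedRing A) with
      mul_comm := ((Algebra.adjoin ℂ s).commRingTopologicalClosure
        (fun x y => hcomm.is_comm.comm x y)).mul_comm }
  let _ : NormedAlgebra ℂ A := { (inferInstance : Algebra ℂ A) with
    norm_smul_le := fun r x => norm_smul_le r (x : B) }
  have : CompleteSpace A :=
    (Subalgebra.isClosed_topologicalClosure (Algebra.adjoin ℂ s)).completeSpace_coe
  have hu' : ¬ IsUnit ((1 : A) + ⟨a, hsA a ha⟩) := fun h => hu (h.map A.subtype)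
  obtain ⟨φ, hφ⟩ := WeakDual.CharacterSpace.exists_apply_eq_zero hu'
  have : NormOneClass A := ⟨norm_one (α := B)⟩
  obtain ⟨ψ, hψ, hψn⟩ := exists_extension_norm_eq (𝕜 := ℂ) (Subalgebra.toSubmodule A)
    (WeakDual.toStrongDual (φ : WeakDual ℂ A))
  have hψA : ∀ (x : B) (hx : x ∈ A), ψ x = φ ⟨x, hx⟩ := fun x hx => hψ ⟨x, hx⟩
  refine ⟨ψ, ?_, ?_, fun b => ?_, fun x hx y hy => ?_⟩
  · rw [hψA 1 A.one_mem]; exact map_one φ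
  · rw [hψA a (hsA a ha)]
    rw [map_add, map_one] at hφ
    exact eq_neg_of_add_eq_zero_right hφ
  · refine (ψ.le_of_opNorm_le ?_ b).trans_eq (one_mul _)
    rw [hψn]
    refine ContinuousLinearMap.opNorm_le_bound _ zero_le_one (fun x => ?_)
    rw [one_mul]
    exact AlgHom.norm_apply_le_self φ x
  · rw [hψA _ (A.mul_mem (hsA x hx) (hsA y hy)), hψA x (hsA x hx), hψA y (hsA y hy), ← map_mul]
    rfl

lemma measurableSet_orthant (n : ℕ) : MeasurableSet {x : Fin n → ℝ | 0 ≤ x} :=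
  measurableSet_Ici

section SemigroupAction

variable {n : ℕ} {w : (Fin n → ℝ) → ℝ} {X : Type*} [NormedAddCommGroup X] [NormedSpace ℂ X]
  {S : (Fin n → ℝ) → X →L[ℂ] X} {k : (Fin n → ℝ) → ℂ}

lemma integrableOn_smul_action
    (hk_meas : AEStronglyMeasurable k (volume.restrict {x : Fin n → ℝ | 0 ≤ x}))
    (hk : IntegrableOn (fun x => ‖k x‖ * w x) {x : Fin n → ℝ | 0 ≤ x})
    (hSw : ∀ x, 0 ≤ x → ‖S x‖ ≤ w x)
    (hSc : ∀ h, ContinuousOn (fun x => S x h) {x | 0 ≤ x}) (h : X) :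
    IntegrableOn (fun x => k x • S x h) {x : Fin n → ℝ | 0 ≤ x} := by
  refine (hk.mul_const ‖h‖).mono'
    (hk_meas.smul ((hSc h).aestronglyMeasurable (measurableSet_orthant n))) ?_
  filter_upwards [ae_restrict_mem (measurableSet_orthant n)] with x hx
  rw [norm_smul, mul_assoc]
  gcongr
  exact (S x).le_of_opNorm_le (hSw x hx) h

/-- If the Laplace transform of `k` avoids `-1` on the characters dominated by `w`, then `1 + T`
is invertible, where `T = ∫ k(x) S(x) dx` for a semigroup `S` of operators dominated by `w`. -/
lemma isUnit_one_add_of_laplace_ne [CompleteSpace X]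
    (hk_meas : AEStronglyMeasurable k (volume.restrict {x : Fin n → ℝ | 0 ≤ x}))
    (hk : IntegrableOn (fun x => ‖k x‖ * w x) {x : Fin n → ℝ | 0 ≤ x})
    (hw_pos : ∀ x : Fin n → ℝ, 0 ≤ x → 0 < w x)
    (hlap : ∀ z : Fin n → ℂ,
      (∀ x : Fin n → ℝ, 0 ≤ x → -Real.log (w x) ≤ ∑ i, x i * (z i).re) →
      (∫ x in {x : Fin n → ℝ | 0 ≤ x},
        k x * Complex.exp (-∑ i, (x i : ℂ) * z i)) ≠ -1)
    (hS0 : S 0 = 1) (hSadd : ∀ x y, 0 ≤ x → 0 ≤ y → S (x + y) = S x * S y)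
    (hSw : ∀ x, 0 ≤ x → ‖S x‖ ≤ w x)
    (hSc : ∀ h, ContinuousOn (fun x => S x h) {x | 0 ≤ x})
    {T : X →L[ℂ] X} (hT : ∀ h, T h = ∫ x in {x : Fin n → ℝ | 0 ≤ x}, k x • S x h)
    (hTc : ContinuousOn (fun x => S x * T) {x | 0 ≤ x}) :
    IsUnit (1 + T) := by
  by_contra hu
  have hX : Nontrivial X := by
    by_contra hX
    rw [not_nontrivial_iff_subsingleton] at hX
    exact hu (isUnit_of_subsingleton _)
  have hintegr := integrableOn_smul_action hk_meas hk hSw hSc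
  have hSS : ∀ x y, 0 ≤ x → 0 ≤ y → S x * S y = S y * S x := fun x y hx hy => by
    rw [← hSadd x y hx hy, ← hSadd y x hy hx, add_comm]
  have hST : ∀ y, 0 ≤ y → S y * T = T * S y := fun y hy => by
    ext h
    rw [mul_apply_eq_comp, mul_apply_eq_comp, hT, hT,
      ← ContinuousLinearMap.integral_comp_comm _ (hintegr h)]
    refine setIntegral_congr_fun (measurableSet_orthant n) fun x hx => ?_
    simp only [map_smul]
    rw [← mul_apply_eq_comp, ← mul_apply_eq_comp, hSS y x hy hx]
  obtain ⟨φ, hφ1, hφT, hφn, hφm⟩ := exists_multiplicative_functional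
    (s := insert T (S '' {x | 0 ≤ x})) (a := T) (by
      rintro _ (rfl | ⟨x, hx, rfl⟩) _ (rfl | ⟨y, hy, rfl⟩)
      · rfl
      · exact (hST y hy).symm
      · exact hST x hx
      · exact hSS x y hx hy) (Set.mem_insert _ _) hu
  have hmem : ∀ x, 0 ≤ x → S x ∈ insert T (S '' {x | 0 ≤ x}) := fun x hx =>
    Set.mem_insert_of_mem _ ⟨x, hx, rfl⟩
  have hφST : ∀ x, 0 ≤ x → φ (S x) = -φ (S x * T) := fun x hx => by
    rw [hφm _ (hmem x hx) _ (Set.mem_insert _ _), hφT]; ring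
  obtain ⟨z, hz⟩ := exp_of_orthant_semigroup (χ := fun x => φ (S x))
    ((φ.continuous.comp_continuousOn hTc).neg.congr hφST) (by rw [hS0, hφ1])
    (fun x y hx hy => by
      rw [hSadd x y hx hy, hφm _ (hmem x hx) _ (hmem y hy)])
  refine hlap z (fun x hx => ?_) ?_
  · have h1 : ‖φ (S x)‖ ≤ w x := (hφn _).trans (hSw x hx)
    rw [hz x hx, Complex.norm_exp, ← Real.le_log_iff_exp_le (hw_pos x hx)] at h1
    simp only [Complex.neg_re, Complex.re_sum, Complex.re_ofReal_mul] at h1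
    linarith
  · have hintegr' : IntegrableOn (fun x => k x • (S x * T)) {x : Fin n → ℝ | 0 ≤ x} := by
      refine (hk.mul_const ‖T‖).mono'
        (hk_meas.smul (hTc.aestronglyMeasurable (measurableSet_orthant n))) ?_
      filter_upwards [ae_restrict_mem (measurableSet_orthant n)] with x hx
      rw [norm_smul, mul_assoc]
      gcongr
      exact (norm_mul_le _ _).trans (by gcongr; exact hSw x hx)
    have hTT : T * T = ∫ x in {x : Fin n → ℝ | 0 ≤ x}, k x • (S x * T) := by
      ext h
      rw [ContinuousLinearMap.integral_apply hintegr', mul_apply_eq_comp, hT]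
      rfl
    calc (∫ x in {x : Fin n → ℝ | 0 ≤ x}, k x * Complex.exp (-∑ i, (x i : ℂ) * z i))
        = ∫ x in {x : Fin n → ℝ | 0 ≤ x}, -φ (k x • (S x * T)) := by
          refine setIntegral_congr_fun (measurableSet_orthant n) fun x hx => ?_
          simp only [map_smul, smul_eq_mul]
          rw [← hz x hx, hφST x hx, mul_neg]
      _ = -φ (T * T) := by
          rw [integral_neg, ContinuousLinearMap.integral_comp_comm _ hintegr', hTT]
      _ = -1 := by
          rw [hφm _ (Set.mem_insert _ _) _ (Set.mem_insert _ _), hφT]; ring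

end SemigroupAction

/-- A weight on the semigroup `[0,∞)ⁿ`. -/
structure IsOrthantWeight {n : ℕ} (w : (Fin n → ℝ) → ℝ) : Prop where
  meas : Measurable w
  pos : ∀ x : Fin n → ℝ, 0 ≤ x → 0 < w x
  loc : ∀ x : Fin n → ℝ, 0 ≤ x → ∃ U ∈ nhds x, ∃ C : ℝ, ∀ y ∈ U, 0 ≤ y → w y ≤ C
  sub : ∀ x y : Fin n → ℝ, 0 ≤ x → 0 ≤ y → w (x + y) ≤ w x * w y

/-- The measure with density `w` with respect to Lebesgue measure on `[0,∞)ⁿ`. -/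
noncomputable def orthantMeasure {n : ℕ} (w : (Fin n → ℝ) → ℝ) : Measure (Fin n → ℝ) :=
  (volume.restrict {x | 0 ≤ x}).withDensity fun x => ENNReal.ofReal (w x)

/-- The translate by `x` of a function on `[0,∞)ⁿ`, extended by zero. -/
noncomputable def orthantShift {n : ℕ} {M : Type*} [Zero M] (x : Fin n → ℝ) (h : (Fin n → ℝ) → M) :
    (Fin n → ℝ) → M :=
  fun t => Set.indicator {s | 0 ≤ s} h (t - x)

section Shift

variable {n : ℕ} {w : (Fin n → ℝ) → ℝ}

lemma orthantShift_of_nonneg {M : Type*} [Zero M] {x t : Fin n → ℝ} (ht : 0 ≤ t - x)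
    (h : (Fin n → ℝ) → M) : orthantShift x h t = h (t - x) :=
  Set.indicator_of_mem (s := {s | 0 ≤ s}) ht h

lemma orthantShift_of_not_nonneg {M : Type*} [Zero M] {x t : Fin n → ℝ} (ht : ¬ 0 ≤ t - x)
    (h : (Fin n → ℝ) → M) : orthantShift x h t = 0 :=
  Set.indicator_of_notMem (s := {s | 0 ≤ s}) ht h

lemma orthantMeasure_absolutelyContinuous :
    orthantMeasure w ≪ volume.restrict {x | 0 ≤ x} :=
  withDensity_absolutelyContinuous _ _

lemma IsOrthantWeight.restrict_absolutelyContinuous (hw : IsOrthantWeight w) :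
    volume.restrict {x | 0 ≤ x} ≪ orthantMeasure w := by
  refine withDensity_absolutelyContinuous' hw.meas.ennreal_ofReal.aemeasurable ?_
  filter_upwards [ae_restrict_mem (measurableSet_orthant n)] with x hx
  simpa using hw.pos x hx

lemma IsOrthantWeight.integrable_iff (hw : IsOrthantWeight w) {h : (Fin n → ℝ) → ℂ}
    (hm : AEStronglyMeasurable h (volume.restrict {x | 0 ≤ x})) :
    Integrable h (orthantMeasure w) ↔ IntegrableOn (fun x => ‖h x‖ * w x) {x | 0 ≤ x} := by
  rw [orthantMeasure, integrable_withDensity_iff_integrable_smul' hw.meas.ennreal_ofReal (by simp),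
    ← integrable_norm_iff (f := fun x => (ENNReal.ofReal (w x)).toReal • h x)
      (hw.meas.ennreal_ofReal.ennreal_toReal.aestronglyMeasurable.smul hm)]
  refine integrable_congr ?_
  filter_upwards [ae_restrict_mem (measurableSet_orthant n)] with x hx
  rw [ENNReal.toReal_ofReal (hw.pos x hx).le, norm_smul, Real.norm_of_nonneg (hw.pos x hx).le,
    mul_comm]

lemma IsOrthantWeight.integral_norm_eq (hw : IsOrthantWeight w) (h : (Fin n → ℝ) → ℂ) :
    ∫ x, ‖h x‖ ∂(orthantMeasure w) = ∫ x in {x | 0 ≤ x}, ‖h x‖ * w x := by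
  rw [orthantMeasure, integral_withDensity_eq_integral_toReal_smul hw.meas.ennreal_ofReal (by simp)]
  refine setIntegral_congr_fun (measurableSet_orthant n) fun x hx => ?_
  rw [ENNReal.toReal_ofReal (hw.pos x hx).le, smul_eq_mul, mul_comm]

lemma measurable_orthantShift {M : Type*} [Zero M] [MeasurableSpace M] {h : (Fin n → ℝ) → M}
    (hm : Measurable h) (x : Fin n → ℝ) : Measurable (orthantShift x h) :=
  (hm.indicator (measurableSet_orthant n)).comp (measurable_sub_const x)

lemma IsOrthantWeight.lintegral_shift_le (hw : IsOrthantWeight w) {u : (Fin n → ℝ) → ENNReal}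
    (hu : Measurable u) {x : Fin n → ℝ} (hx : 0 ≤ x) :
    ∫⁻ t, orthantShift x u t ∂(orthantMeasure w) ≤
      ENNReal.ofReal (w x) * ∫⁻ t, u t ∂(orthantMeasure w) := by
  have hP := measurableSet_orthant n
  rw [orthantMeasure, lintegral_withDensity_eq_lintegral_mul _ hw.meas.ennreal_ofReal hu,
    lintegral_withDensity_eq_lintegral_mul _ hw.meas.ennreal_ofReal (measurable_orthantShift hu x),
    ← lintegral_indicator hP, ← lintegral_indicator hP,
    ← lintegral_const_mul _ ((hw.meas.ennreal_ofReal.mul hu).indicator hP)]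
  rw [← lintegral_sub_right_eq_self (fun t => ENNReal.ofReal (w x) * _) x]
  refine lintegral_mono fun t => ?_
  by_cases ht : 0 ≤ t - x
  · have ht' : t ∈ {s : Fin n → ℝ | 0 ≤ s} := by
      simpa using add_nonneg ht hx
    rw [Set.indicator_of_mem (show t - x ∈ {s : Fin n → ℝ | 0 ≤ s} from ht),
      Set.indicator_of_mem ht']
    simp only [Pi.mul_apply]
    rw [orthantShift_of_nonneg ht, ← mul_assoc, ← ENNReal.ofReal_mul (hw.pos x hx).le]
    gcongr
    have := hw.sub x (t - x) hx ht
    rwa [add_sub_cancel] at this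
  · simp only [Set.indicator_apply_eq_zero.2 fun _ => show ((fun x => ENNReal.ofReal (w x)) *
      orthantShift x u) t = 0 by simp [orthantShift_of_not_nonneg ht], zero_le]

lemma enorm_orthantShift (x : Fin n → ℝ) (h : (Fin n → ℝ) → ℂ) (t : Fin n → ℝ) :
    ‖orthantShift x h t‖ₑ = orthantShift x (fun s => ‖h s‖ₑ) t :=
  enorm_indicator_eq_indicator_enorm _ _

lemma IsOrthantWeight.integrable_shift (hw : IsOrthantWeight w) {h : (Fin n → ℝ) → ℂ}
    (hm : Measurable h) (hh : Integrable h (orthantMeasure w)) {x : Fin n → ℝ} (hx : 0 ≤ x) :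
    Integrable (orthantShift x h) (orthantMeasure w) := by
  refine ⟨(measurable_orthantShift hm x).aestronglyMeasurable, ?_⟩
  rw [hasFiniteIntegral_iff_enorm]
  simp only [enorm_orthantShift]
  exact (hw.lintegral_shift_le hm.enorm hx).trans_lt
    (ENNReal.mul_lt_top ENNReal.ofReal_lt_top hh.hasFiniteIntegral)

lemma IsOrthantWeight.shift_congr (hw : IsOrthantWeight w) {h h' : (Fin n → ℝ) → ℂ}
    (hh : h =ᵐ[orthantMeasure w] h') (x : Fin n → ℝ) :
    orthantShift x h =ᵐ[orthantMeasure w] orthantShift x h' := by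
  have h1 := hw.restrict_absolutelyContinuous.ae_le hh
  have h2 := (ae_restrict_iff' (measurableSet_orthant n)).1 h1
  have h3 := (measurePreserving_sub_right volume x).quasiMeasurePreserving.ae h2
  refine orthantMeasure_absolutelyContinuous.ae_le (ae_restrict_of_ae ?_)
  filter_upwards [h3] with t ht
  by_cases hs : 0 ≤ t - x
  · rw [orthantShift_of_nonneg hs, orthantShift_of_nonneg hs]
    exact ht hs
  · rw [orthantShift_of_not_nonneg hs, orthantShift_of_not_nonneg hs]

/-- Translation by elements of `[0,∞)ⁿ` as operators on `L¹(w)`. -/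
lemma IsOrthantWeight.exists_shiftOperator (hw : IsOrthantWeight w) :
    ∃ S : (Fin n → ℝ) → Lp ℂ 1 (orthantMeasure w) →L[ℂ] Lp ℂ 1 (orthantMeasure w),
      (∀ x, 0 ≤ x → ∀ h, S x h =ᵐ[orthantMeasure w] orthantShift x h) ∧
      ∀ x, 0 ≤ x → ‖S x‖ ≤ w x := by
  suffices H : ∀ x, ∃ S : Lp ℂ 1 (orthantMeasure w) →L[ℂ] Lp ℂ 1 (orthantMeasure w),
      0 ≤ x → (∀ h, S h =ᵐ[orthantMeasure w] orthantShift x h) ∧ ‖S‖ ≤ w x by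
    choose S hS using H
    exact ⟨S, fun x hx => (hS x hx).1, fun x hx => (hS x hx).2⟩
  intro x
  by_cases hx : 0 ≤ x
  swap
  · exact ⟨0, fun h => absurd h hx⟩
  have hi : ∀ h : Lp ℂ 1 (orthantMeasure w),
      Integrable (orthantShift x h) (orthantMeasure w) := fun h =>
    hw.integrable_shift (Lp.stronglyMeasurable h).measurable (L1.integrable_coeFn h) hx
  have hco : ∀ h, (hi h).toL1 _ =ᵐ[orthantMeasure w] orthantShift x h := fun h =>
    (hi h).coeFn_toL1
  let L : Lp ℂ 1 (orthantMeasure w) →ₗ[ℂ] Lp ℂ 1 (orthantMeasure w) :=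
    { toFun := fun h => (hi h).toL1 _
      map_add' := fun h g => by
        apply Lp.ext
        filter_upwards [hco (h + g), hco h, hco g, Lp.coeFn_add ((hi h).toL1 _) ((hi g).toL1 _),
          hw.shift_congr (Lp.coeFn_add h g) x] with t h1 h2 h3 h4 h5
        rw [h1, h4, h5, Pi.add_apply, h2, h3]
        simp only [orthantShift, Set.indicator_add', Pi.add_apply]
      map_smul' := fun c h => by
        apply Lp.ext
        filter_upwards [hco (c • h), hco h, Lp.coeFn_smul c ((hi h).toL1 _),
          hw.shift_congr (Lp.coeFn_smul c h) x] with t h1 h2 h3 h4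
        rw [RingHom.id_apply, h1, h3, h4, Pi.smul_apply, h2]
        exact congrFun (Set.indicator_const_smul _ c _) (t - x) }
  have hb : ∀ h, ‖L h‖ ≤ w x * ‖h‖ := fun h => by
    change ‖(hi h).toL1 _‖ ≤ _
    rw [Integrable.norm_toL1_eq_lintegral_norm, L1.norm_def]
    have h1 := hw.lintegral_shift_le (Lp.stronglyMeasurable h).measurable.enorm hx
    have h2 : ∫⁻ a, ‖h a‖ₑ ∂orthantMeasure w ≠ ⊤ := (L1.integrable_coeFn h).hasFiniteIntegral.ne
    have h3 := ENNReal.toReal_mono (ENNReal.mul_ne_top ENNReal.ofReal_ne_top h2) h1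
    rw [ENNReal.toReal_mul, ENNReal.toReal_ofReal (hw.pos x hx).le] at h3
    refine le_trans (le_of_eq ?_) h3
    simp only [ofReal_norm, enorm_orthantShift]
  exact ⟨L.mkContinuous (w x) hb, fun _ => ⟨hco, L.mkContinuous_norm_le (hw.pos x hx).le hb⟩⟩

end Shift

section Translation

variable {n : ℕ} {w : (Fin n → ℝ) → ℝ}
  {S : (Fin n → ℝ) → Lp ℂ 1 (orthantMeasure w) →L[ℂ] Lp ℂ 1 (orthantMeasure w)}

lemma IsOrthantWeight.isLocallyFiniteMeasure (hw : IsOrthantWeight w) :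
    IsLocallyFiniteMeasure (orthantMeasure w) := by
  refine ⟨fun x => ?_⟩
  by_cases hx : 0 ≤ x
  · obtain ⟨U, hU, C, hC⟩ := hw.loc x hx
    obtain ⟨V, hVU, hVo, hxV⟩ := mem_nhds_iff.1
      (Filter.inter_mem hU (Metric.ball_mem_nhds x one_pos))
    refine ⟨V, hVo.mem_nhds hxV, ?_⟩
    rw [orthantMeasure, withDensity_apply _ hVo.measurableSet,
      Measure.restrict_restrict hVo.measurableSet]
    calc ∫⁻ y in V ∩ {x | 0 ≤ x}, ENNReal.ofReal (w y)
        ≤ ∫⁻ _ in V ∩ {x : Fin n → ℝ | 0 ≤ x}, ENNReal.ofReal C :=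
          setLIntegral_mono' (hVo.measurableSet.inter (measurableSet_orthant n)) fun y hy =>
            ENNReal.ofReal_le_ofReal (hC y (hVU hy.1).1 hy.2)
      _ < ⊤ := by
          rw [setLIntegral_const]
          refine ENNReal.mul_lt_top ENNReal.ofReal_lt_top ?_
          exact (measure_mono fun y hy => (hVU hy.1).2).trans_lt
            (measure_ball_lt_top (x := x) (r := 1))
  · refine ⟨{x | 0 ≤ x}ᶜ, (isClosed_Ici (a := (0 : Fin n → ℝ))).isOpen_compl.mem_nhds hx, ?_⟩
    rw [orthantMeasure_absolutelyContinuous (by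
      rw [Measure.restrict_apply (measurableSet_orthant n).compl]; simp)]
    exact ENNReal.zero_lt_top

lemma shift_zero_eq (hS : ∀ x, 0 ≤ x → ∀ h, S x h =ᵐ[orthantMeasure w] orthantShift x h) :
    S 0 = 1 := by
  ext1 h
  apply Lp.ext
  filter_upwards [hS 0 le_rfl h, orthantMeasure_absolutelyContinuous.ae_le
    (ae_restrict_mem (measurableSet_orthant n))] with t ht hP
  rw [ht, orthantShift_of_nonneg (by simpa using hP), sub_zero]
  rfl

lemma IsOrthantWeight.shift_add_eq (hw : IsOrthantWeight w)
    (hS : ∀ x, 0 ≤ x → ∀ h, S x h =ᵐ[orthantMeasure w] orthantShift x h)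
    {x y : Fin n → ℝ} (hx : 0 ≤ x) (hy : 0 ≤ y) : S (x + y) = S x * S y := by
  ext1 h
  apply Lp.ext
  rw [mul_apply_eq_comp]
  filter_upwards [hS (x + y) (add_nonneg hx hy) h, hS x hx (S y h),
    hw.shift_congr (hS y hy h) x] with t h1 h2 h3
  rw [h1, h2, h3]
  by_cases ht : 0 ≤ t - x
  · rw [orthantShift_of_nonneg ht]
    simp only [orthantShift, sub_add_eq_sub_sub]
  · rw [orthantShift_of_not_nonneg ht, orthantShift_of_not_nonneg]
    contrapose! ht
    rw [sub_add_eq_sub_sub] at ht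
    exact hy.trans (sub_nonneg.1 ht)

lemma continuousWithinAt_shift_toL1 (hw : IsOrthantWeight w)
    (hS : ∀ x, 0 ≤ x → ∀ h, S x h =ᵐ[orthantMeasure w] orthantShift x h)
    {g : (Fin n → ℝ) → ℂ} (hgc : Continuous g) (hgs : HasCompactSupport g)
    (hg : Integrable g (orthantMeasure w)) {x₀ : Fin n → ℝ} (hx₀ : 0 ≤ x₀) :
    ContinuousWithinAt (fun x => S x (hg.toL1 g)) {x | 0 ≤ x} x₀ := by
  have := hw.isLocallyFiniteMeasure
  have hSg : ∀ x, 0 ≤ x → S x (hg.toL1 g) =ᵐ[orthantMeasure w] orthantShift x g := fun x hx =>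
    (hS x hx _).trans (hw.shift_congr hg.coeFn_toL1 x)
  obtain ⟨M, hM⟩ := hgs.exists_bound_of_continuous hgc
  obtain ⟨R, hR⟩ := hgs.isCompact.isBounded.subset_closedBall (0 : Fin n → ℝ)
  have hM' : ∀ x t, ‖orthantShift x g t‖ ≤ M := fun x t => by
    by_cases ht : 0 ≤ t - x
    · rw [orthantShift_of_nonneg ht]; exact hM _
    · rw [orthantShift_of_not_nonneg ht, norm_zero]; exact (norm_nonneg _).trans (hM 0)
  have hsupp : ∀ x t, ‖x‖ ≤ ‖x₀‖ + 1 → t ∉ Metric.closedBall (0 : Fin n → ℝ) (R + (‖x₀‖ + 1)) →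
      orthantShift x g t = 0 := fun x t hx ht => by
    have h1 : t - x ∉ tsupport g := fun h => ht (by
      have h2 := hR h
      rw [mem_closedBall_zero_iff] at h2 ⊢
      calc ‖t‖ = ‖(t - x) + x‖ := by rw [sub_add_cancel]
        _ ≤ ‖t - x‖ + ‖x‖ := norm_add_le _ _
        _ ≤ _ := by linarith)
    by_cases hp : 0 ≤ t - x
    · rw [orthantShift_of_nonneg hp, image_eq_zero_of_notMem_tsupport h1]
    · exact orthantShift_of_not_nonneg hp g
  rw [ContinuousWithinAt, tendsto_iff_norm_sub_tendsto_zero]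
  have key : Filter.Tendsto
      (fun x => ∫ t, ‖orthantShift x g t - orthantShift x₀ g t‖ ∂(orthantMeasure w))
      (nhdsWithin x₀ {x | 0 ≤ x}) (nhds (∫ _, (0 : ℝ) ∂(orthantMeasure w))) := by
    refine tendsto_integral_filter_of_dominated_convergence
      ((Metric.closedBall (0 : Fin n → ℝ) (R + (‖x₀‖ + 1))).indicator fun _ => 2 * M) ?_ ?_ ?_ ?_
    · exact Filter.Eventually.of_forall fun x =>
        ((measurable_orthantShift hgc.measurable x).sub
          (measurable_orthantShift hgc.measurable x₀)).norm.aestronglyMeasurable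
    · filter_upwards [mem_nhdsWithin_of_mem_nhds (Metric.ball_mem_nhds x₀ one_pos)] with x hx
      have hx' : ‖x‖ ≤ ‖x₀‖ + 1 := by
        have := norm_sub_norm_le x x₀
        rw [mem_ball_iff_norm] at hx
        linarith
      refine Filter.Eventually.of_forall fun t => ?_
      rw [norm_norm]
      by_cases ht : t ∈ Metric.closedBall (0 : Fin n → ℝ) (R + (‖x₀‖ + 1))
      · rw [Set.indicator_of_mem ht]
        refine (norm_sub_le _ _).trans ?_
        linarith [hM' x t, hM' x₀ t]
      · rw [Set.indicator_of_notMem ht, hsupp x t hx' ht, hsupp x₀ t (by linarith) ht]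
        simp
    · rw [integrable_indicator_iff Metric.isClosed_closedBall.measurableSet]
      exact integrableOn_const (isCompact_closedBall _ _).measure_lt_top.ne
    · have hfr : ∀ᵐ t : Fin n → ℝ, t - x₀ ∉ frontier {s : Fin n → ℝ | 0 ≤ s} :=
        (measurePreserving_sub_right volume x₀).quasiMeasurePreserving.ae
          (measure_eq_zero_iff_ae_notMem.1
            ((convex_Ici (𝕜 := ℝ) (0 : Fin n → ℝ)).addHaar_frontier volume))
      filter_upwards [orthantMeasure_absolutelyContinuous.ae_le (ae_restrict_of_ae hfr)] with t ht
      rw [← tendsto_iff_norm_sub_tendsto_zero]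
      have h1 : ContinuousAt ({s : Fin n → ℝ | 0 ≤ s}.indicator g) (t - x₀) :=
        hgc.continuousOn.continuousAt_indicator ht
      exact (h1.comp (f := fun x => t - x) (by fun_prop)).tendsto.mono_left nhdsWithin_le_nhds
  rw [integral_zero] at key
  refine key.congr' ?_
  filter_upwards [self_mem_nhdsWithin] with x hx
  rw [L1.norm_eq_integral_norm]
  refine integral_congr_ae ?_
  filter_upwards [hSg x hx, hSg x₀ hx₀, Lp.coeFn_sub (S x (hg.toL1 g)) (S x₀ (hg.toL1 g))]
    with t h1 h2 h3
  rw [h3, Pi.sub_apply, h1, h2]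

lemma IsOrthantWeight.continuousOn_shift (hw : IsOrthantWeight w)
    (hS : ∀ x, 0 ≤ x → ∀ h, S x h =ᵐ[orthantMeasure w] orthantShift x h)
    (hSn : ∀ x, 0 ≤ x → ‖S x‖ ≤ w x) (h : Lp ℂ 1 (orthantMeasure w)) :
    ContinuousOn (fun x => S x h) {x | 0 ≤ x} := by
  have := hw.isLocallyFiniteMeasure
  intro x₀ hx₀
  obtain ⟨U, hU, C, hC⟩ := hw.loc x₀ hx₀
  have hCpos : 0 < C := (hw.pos x₀ hx₀).trans_le (hC x₀ (mem_of_mem_nhds hU) hx₀)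
  refine continuousWithinAt_of_locally_uniform_approx_of_continuousWithinAt hx₀ fun u hu => ?_
  obtain ⟨ε, hε, hεu⟩ := Metric.mem_uniformity_dist.1 hu
  obtain ⟨g, hgs, hhg, hgc, hg⟩ :=
    (L1.integrable_coeFn h).exists_hasCompactSupport_integral_sub_le
      (show 0 < ε / (2 * C) by positivity)
  refine ⟨U ∩ {x | 0 ≤ x}, Filter.inter_mem (mem_nhdsWithin_of_mem_nhds hU) self_mem_nhdsWithin,
    fun x => S x (hg.toL1 g), continuousWithinAt_shift_toL1 hw hS hgc hgs hg hx₀,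
    fun y hy => hεu ?_⟩
  rw [dist_eq_norm, ← map_sub]
  have h1 : ‖h - hg.toL1 g‖ ≤ ε / (2 * C) := by
    rw [L1.norm_eq_integral_norm]
    refine le_trans (le_of_eq (integral_congr_ae ?_)) hhg
    filter_upwards [Lp.coeFn_sub h (hg.toL1 g), hg.coeFn_toL1] with t h1 h2
    rw [h1, Pi.sub_apply, h2]
  calc ‖S y (h - hg.toL1 g)‖ ≤ C * (ε / (2 * C)) :=
        (S y).le_of_opNorm_le_of_le ((hSn y hy.2).trans (hC y hy.1 hy.2)) h1
    _ = ε / 2 := by field_simp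
    _ < ε := by linarith

end Translation

section IntegratedAction

variable {n : ℕ} {w : (Fin n → ℝ) → ℝ}
  {S : (Fin n → ℝ) → Lp ℂ 1 (orthantMeasure w) →L[ℂ] Lp ℂ 1 (orthantMeasure w)}

lemma IsOrthantWeight.integrableOn_coeFn (hw : IsOrthantWeight w)
    (h : Lp ℂ 1 (orthantMeasure w)) :
    IntegrableOn (fun x => ‖h x‖ * w x) {x | 0 ≤ x} :=
  (hw.integrable_iff (Lp.stronglyMeasurable h).aestronglyMeasurable).1 (L1.integrable_coeFn h)

lemma IsOrthantWeight.integrableOn_smul_shift (hw : IsOrthantWeight w)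
    (hS : ∀ x, 0 ≤ x → ∀ h, S x h =ᵐ[orthantMeasure w] orthantShift x h)
    (hSn : ∀ x, 0 ≤ x → ‖S x‖ ≤ w x) (h u : Lp ℂ 1 (orthantMeasure w)) :
    IntegrableOn (fun x => h x • S x u) {x | 0 ≤ x} :=
  integrableOn_smul_action (Lp.stronglyMeasurable h).aestronglyMeasurable (hw.integrableOn_coeFn h)
    hSn (hw.continuousOn_shift hS hSn) u

/-- Convolution on `L¹(w)` as a bounded bilinear map. -/
lemma IsOrthantWeight.exists_integratedAction (hw : IsOrthantWeight w)
    (hS : ∀ x, 0 ≤ x → ∀ h, S x h =ᵐ[orthantMeasure w] orthantShift x h)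
    (hSn : ∀ x, 0 ≤ x → ‖S x‖ ≤ w x) :
    ∃ T : Lp ℂ 1 (orthantMeasure w) →L[ℂ] Lp ℂ 1 (orthantMeasure w) →L[ℂ]
        Lp ℂ 1 (orthantMeasure w),
      ∀ h u, T h u = ∫ x in {x | 0 ≤ x}, h x • S x u := by
  have hintegr := hw.integrableOn_smul_shift hS hSn
  refine ⟨LinearMap.mkContinuous₂ (LinearMap.mk₂ ℂ
    (fun h u => ∫ x in {x | 0 ≤ x}, h x • S x u) ?_ ?_ ?_ ?_) 1 ?_, fun h u => rfl⟩
  · intro h g u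
    rw [← integral_add (hintegr h u) (hintegr g u)]
    refine integral_congr_ae ?_
    filter_upwards [hw.restrict_absolutelyContinuous.ae_le (Lp.coeFn_add h g)] with x hx
    rw [hx, Pi.add_apply, add_smul]
  · intro c h u
    rw [← integral_smul]
    refine integral_congr_ae ?_
    filter_upwards [hw.restrict_absolutelyContinuous.ae_le (Lp.coeFn_smul c h)] with x hx
    rw [hx, Pi.smul_apply, smul_assoc]
  · intro h u v
    rw [← integral_add (hintegr h u) (hintegr h v)]
    simp only [map_add, smul_add]
  · intro c h u
    rw [← integral_smul]
    simp only [map_smul, smul_comm c]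
  · intro h u
    rw [one_mul, LinearMap.mk₂_apply, L1.norm_eq_integral_norm h, hw.integral_norm_eq,
      ← integral_mul_const]
    refine norm_integral_le_of_norm_le ((hw.integrableOn_coeFn h).mul_const _) ?_
    filter_upwards [ae_restrict_mem (measurableSet_orthant n)] with x hx
    rw [norm_smul, mul_assoc]
    gcongr
    exact (S x).le_of_opNorm_le (hSn x hx) u

lemma IsOrthantWeight.integratedAction_shift (hw : IsOrthantWeight w)
    (hS : ∀ x, 0 ≤ x → ∀ h, S x h =ᵐ[orthantMeasure w] orthantShift x h)
    (hSn : ∀ x, 0 ≤ x → ‖S x‖ ≤ w x)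
    {T : Lp ℂ 1 (orthantMeasure w) →L[ℂ] Lp ℂ 1 (orthantMeasure w) →L[ℂ]
        Lp ℂ 1 (orthantMeasure w)}
    (hT : ∀ h u, T h u = ∫ x in {x | 0 ≤ x}, h x • S x u)
    {y : Fin n → ℝ} (hy : 0 ≤ y) (h : Lp ℂ 1 (orthantMeasure w)) :
    T (S y h) = S y * T h := by
  have hP := measurableSet_orthant n
  ext1 u
  rw [mul_apply_eq_comp, hT, hT,
    ← ContinuousLinearMap.integral_comp_comm _ (hw.integrableOn_smul_shift hS hSn h u)]
  calc ∫ x in {x | 0 ≤ x}, S y h x • S x u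
      = ∫ x in {x | 0 ≤ x}, orthantShift y h x • S x u := by
        refine integral_congr_ae ?_
        filter_upwards [hw.restrict_absolutelyContinuous.ae_le (hS y hy h)] with x hx
        rw [hx]
    _ = ∫ x, {s | 0 ≤ s}.indicator (fun s => h s • S (s + y) u) (x - y) := by
        rw [← integral_indicator hP]
        refine integral_congr_ae (Filter.Eventually.of_forall fun x => ?_)
        by_cases hx : 0 ≤ x - y
        · have hx' : 0 ≤ x := hy.trans (sub_nonneg.1 hx)
          simp only
          rw [Set.indicator_of_mem (show x ∈ {x : Fin n → ℝ | 0 ≤ x} from hx'),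
            Set.indicator_of_mem (show x - y ∈ {x : Fin n → ℝ | 0 ≤ x} from hx),
            orthantShift_of_nonneg hx, sub_add_cancel]
        · simp only
          rw [Set.indicator_of_notMem (show x - y ∉ {x : Fin n → ℝ | 0 ≤ x} from hx)]
          refine Set.indicator_apply_eq_zero.2 fun _ => ?_
          rw [orthantShift_of_not_nonneg hx, zero_smul]
    _ = ∫ x in {x | 0 ≤ x}, h x • S (x + y) u := by
        rw [integral_sub_right_eq_self
          ({s | 0 ≤ s}.indicator fun s => h s • S (s + y) u) y, integral_indicator hP]
    _ = _ := by
        refine setIntegral_congr_fun hP fun x hx => ?_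
        rw [add_comm, hw.shift_add_eq hS hy hx, mul_apply_eq_comp, map_smul]

/-- Under the Laplace transform condition, `δ + k` has an inverse `δ + l` with `l ∈ L¹(w)`. -/
lemma IsOrthantWeight.exists_resolvent (hw : IsOrthantWeight w)
    (hS : ∀ x, 0 ≤ x → ∀ h, S x h =ᵐ[orthantMeasure w] orthantShift x h)
    (hSn : ∀ x, 0 ≤ x → ‖S x‖ ≤ w x)
    {k : (Fin n → ℝ) → ℂ} (hk : Integrable k (orthantMeasure w))
    (hlap : ∀ z : Fin n → ℂ,
      (∀ x : Fin n → ℝ, 0 ≤ x → -Real.log (w x) ≤ ∑ i, x i * (z i).re) →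
      (∫ x in {x : Fin n → ℝ | 0 ≤ x},
        k x * Complex.exp (-∑ i, (x i : ℂ) * z i)) ≠ -1) :
    ∃ l : Lp ℂ 1 (orthantMeasure w),
      l + ∫ x in {x | 0 ≤ x}, hk.toL1 k x • S x l = -hk.toL1 k := by
  obtain ⟨T, hT⟩ := hw.exists_integratedAction hS hSn
  set K := hk.toL1 k with hK
  have hKk : K =ᵐ[volume.restrict {x | 0 ≤ x}] k :=
    hw.restrict_absolutelyContinuous.ae_le hk.coeFn_toL1
  have hSc := hw.continuousOn_shift hS hSn
  have hu : IsUnit (1 + T K) := by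
    refine isUnit_one_add_of_laplace_ne (Lp.stronglyMeasurable K).aestronglyMeasurable
      (hw.integrableOn_coeFn K) hw.pos (fun z hz => ?_) (shift_zero_eq hS)
      (fun x y hx hy => hw.shift_add_eq hS hx hy) hSn hSc (hT K) ?_
    · convert hlap z hz using 1
      refine integral_congr_ae ?_
      filter_upwards [hKk] with x hx
      rw [hx]
    · exact (T.continuous.comp_continuousOn (hSc K)).congr fun x hx =>
        (hw.integratedAction_shift hS hSn hT hx K).symm
  obtain ⟨R, hR⟩ := hu.exists_right_inv
  refine ⟨R (-K), ?_⟩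
  rw [← hT, ← mul_apply_eq_comp (T K)]
  have := congrArg (fun A => A (-K)) hR
  simpa [add_mul] using this

end IntegratedAction

section Tauberian

variable {n : ℕ} {w : (Fin n → ℝ) → ℝ} {F : (Fin n → ℝ) → ℂ} {C : ℝ}

/-- The convolution on `[0,∞)ⁿ` of a function `F` vanishing outside of `[0,∞)ⁿ` with `h`. -/
noncomputable def orthantConv (F h : (Fin n → ℝ) → ℂ) (t : Fin n → ℝ) : ℂ :=
  ∫ y in {y | 0 ≤ y}, F (t - y) * h y

lemma orthantConv_congr {h h' : (Fin n → ℝ) → ℂ} (hh : h =ᵐ[volume.restrict {x | 0 ≤ x}] h') :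
    orthantConv F h = orthantConv F h' := by
  ext t
  refine integral_congr_ae ?_
  filter_upwards [hh] with y hy
  rw [hy]

lemma IsOrthantWeight.norm_translate_le (hw : IsOrthantWeight w)
    (hF0 : ∀ t, ¬ 0 ≤ t → F t = 0) (hFC : ∀ t, 0 ≤ t → ‖F t‖ * w t ≤ C) (t : Fin n → ℝ) :
    ∃ D : ℝ, 0 ≤ D ∧ (0 ≤ t → D = C / w t) ∧ ∀ y, 0 ≤ y → ‖F (t - y)‖ ≤ D * w y := by
  by_cases ht : 0 ≤ t
  · have hC : 0 ≤ C := le_trans (by have := hw.pos t ht; positivity) (hFC t ht)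
    have hwt := hw.pos t ht
    refine ⟨C / w t, by positivity, fun _ => rfl, fun y hy => ?_⟩
    have hwy := hw.pos y hy
    by_cases hty : 0 ≤ t - y
    · have h1 := hw.sub y (t - y) hy hty
      rw [add_sub_cancel] at h1
      rw [div_mul_eq_mul_div, le_div_iff₀ hwt]
      calc ‖F (t - y)‖ * w t ≤ ‖F (t - y)‖ * (w y * w (t - y)) := by gcongr
        _ = (‖F (t - y)‖ * w (t - y)) * w y := by ring
        _ ≤ C * w y := by gcongr; exact hFC _ hty
    · rw [hF0 _ hty, norm_zero]; positivity
  · refine ⟨0, le_rfl, fun h => absurd h ht, fun y hy => ?_⟩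
    rw [hF0 (t - y) fun h => ht (hy.trans (sub_nonneg.1 h))]
    simp

lemma IsOrthantWeight.integrableOn_conv (hw : IsOrthantWeight w) (hFm : Measurable F)
    (hF0 : ∀ t, ¬ 0 ≤ t → F t = 0) (hFC : ∀ t, 0 ≤ t → ‖F t‖ * w t ≤ C)
    {h : (Fin n → ℝ) → ℂ} (hm : AEStronglyMeasurable h (volume.restrict {x | 0 ≤ x}))
    (hh : IntegrableOn (fun x => ‖h x‖ * w x) {x | 0 ≤ x}) (t : Fin n → ℝ) :
    IntegrableOn (fun y => F (t - y) * h y) {y | 0 ≤ y} := by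
  obtain ⟨D, hD, -, hDF⟩ := hw.norm_translate_le hF0 hFC t
  refine (hh.const_mul D).mono'
    ((hFm.comp (measurable_const_sub t)).aestronglyMeasurable.mul hm) ?_
  filter_upwards [ae_restrict_mem (measurableSet_orthant n)] with y hy
  rw [norm_mul, mul_comm ‖h y‖, ← mul_assoc]
  gcongr
  exact hDF y hy

lemma norm_orthantConv_le {h : (Fin n → ℝ) → ℂ}
    (hh : IntegrableOn (fun x => ‖h x‖ * w x) {x | 0 ≤ x})
    {t : Fin n → ℝ} {D : ℝ} (hDF : ∀ y, 0 ≤ y → ‖F (t - y)‖ ≤ D * w y) :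
    ‖orthantConv F h t‖ ≤ D * ∫ x in {x | 0 ≤ x}, ‖h x‖ * w x := by
  rw [orthantConv, ← integral_const_mul]
  refine norm_integral_le_of_norm_le (hh.const_mul D) ?_
  filter_upwards [ae_restrict_mem (measurableSet_orthant n)] with y hy
  rw [norm_mul, mul_comm ‖h y‖, ← mul_assoc]
  gcongr
  exact hDF y hy

lemma orthantConv_of_not_nonneg (hF0 : ∀ t, ¬ 0 ≤ t → F t = 0) (h : (Fin n → ℝ) → ℂ)
    {t : Fin n → ℝ} (ht : ¬ 0 ≤ t) : orthantConv F h t = 0 := by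
  refine setIntegral_eq_zero_of_forall_eq_zero fun y hy => ?_
  rw [hF0 (t - y) fun h => ht ((Set.mem_ofPred.1 hy).trans (sub_nonneg.1 h)), zero_mul]

lemma orthantConv_shift (F h : (Fin n → ℝ) → ℂ) {x : Fin n → ℝ} (hx : 0 ≤ x) (t : Fin n → ℝ) :
    orthantConv F (orthantShift x h) t = orthantConv F h (t - x) := by
  have hP := measurableSet_orthant n
  rw [orthantConv, orthantConv, ← integral_indicator hP, ← integral_indicator hP,
    ← integral_sub_right_eq_self ({s | 0 ≤ s}.indicator fun y => F (t - x - y) * h y) x]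
  refine integral_congr_ae (Filter.Eventually.of_forall fun y => ?_)
  simp only
  by_cases hy : 0 ≤ y - x
  · rw [Set.indicator_of_mem (show y ∈ {x : Fin n → ℝ | 0 ≤ x} from hx.trans (sub_nonneg.1 hy)),
      Set.indicator_of_mem (show y - x ∈ {x : Fin n → ℝ | 0 ≤ x} from hy),
      orthantShift_of_nonneg hy, sub_sub_sub_cancel_right]
  · rw [Set.indicator_of_notMem (show y - x ∉ {x : Fin n → ℝ | 0 ≤ x} from hy)]
    refine Set.indicator_apply_eq_zero.2 fun _ => ?_
    rw [orthantShift_of_not_nonneg hy, mul_zero]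

/-- Convolution with `F`, evaluated at `t`, as a bounded functional on `L¹(w)`. -/
lemma IsOrthantWeight.exists_convFunctional (hw : IsOrthantWeight w) (hFm : Measurable F)
    (hF0 : ∀ t, ¬ 0 ≤ t → F t = 0) (hFC : ∀ t, 0 ≤ t → ‖F t‖ * w t ≤ C) (t : Fin n → ℝ) :
    ∃ Λ : Lp ℂ 1 (orthantMeasure w) →L[ℂ] ℂ, ∀ h, Λ h = orthantConv F h t := by
  obtain ⟨D, hD, -, hDF⟩ := hw.norm_translate_le hF0 hFC t
  have hintegr : ∀ h : Lp ℂ 1 (orthantMeasure w),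
      IntegrableOn (fun y => F (t - y) * h y) {y | 0 ≤ y} := fun h =>
    hw.integrableOn_conv hFm hF0 hFC (Lp.stronglyMeasurable h).aestronglyMeasurable
      (hw.integrableOn_coeFn h) t
  refine ⟨LinearMap.mkContinuous
    { toFun := fun h => orthantConv F h t, map_add' := ?_, map_smul' := ?_ } D ?_, fun h => rfl⟩
  · intro h g
    rw [orthantConv_congr (hw.restrict_absolutelyContinuous.ae_le (Lp.coeFn_add h g))]
    simp only [orthantConv, Pi.add_apply, mul_add]
    exact integral_add (hintegr h) (hintegr g)
  · intro c h
    rw [orthantConv_congr (hw.restrict_absolutelyContinuous.ae_le (Lp.coeFn_smul c h))]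
    simp only [orthantConv, Pi.smul_apply, mul_smul_comm]
    exact integral_smul _ _
  · intro h
    rw [L1.norm_eq_integral_norm h, hw.integral_norm_eq]
    exact norm_orthantConv_le (hw.integrableOn_coeFn h) hDF

lemma IsOrthantWeight.integrable_triple (hw : IsOrthantWeight w) (hFm : Measurable F)
    (hF0 : ∀ t, ¬ 0 ≤ t → F t = 0) (hFC : ∀ t, 0 ≤ t → ‖F t‖ * w t ≤ C)
    {k l : (Fin n → ℝ) → ℂ} (hkm : Measurable k) (hlm : Measurable l)
    (hk : IntegrableOn (fun x => ‖k x‖ * w x) {x | 0 ≤ x})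
    (hl : IntegrableOn (fun x => ‖l x‖ * w x) {x | 0 ≤ x}) (t : Fin n → ℝ) :
    Integrable (fun p : (Fin n → ℝ) × (Fin n → ℝ) => k p.1 * (F (t - p.1 - p.2) * l p.2))
      ((volume.restrict {x | 0 ≤ x}).prod (volume.restrict {x | 0 ≤ x})) := by
  obtain ⟨D, hD, -, hDF⟩ := hw.norm_translate_le hF0 hFC t
  refine ((hk.mul_prod hl).const_mul D).mono' (Measurable.aestronglyMeasurable (by fun_prop)) ?_
  have hP := measurableSet_orthant n
  rw [Measure.prod_restrict]
  filter_upwards [ae_restrict_mem (hP.prod hP)] with p hp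
  have h1 := hDF (p.1 + p.2) (add_nonneg hp.1 hp.2)
  have h2 := hw.sub p.1 p.2 hp.1 hp.2
  rw [norm_mul, norm_mul, sub_sub]
  calc ‖k p.1‖ * (‖F (t - (p.1 + p.2))‖ * ‖l p.2‖)
      ≤ ‖k p.1‖ * ((D * (w p.1 * w p.2)) * ‖l p.2‖) := by
        gcongr
        exact h1.trans (by gcongr)
    _ = _ := by ring

/-- Inversion of `F ↦ F + F * k` by convolution with some `l ∈ L¹(w)`. -/
lemma IsOrthantWeight.exists_inversion (hw : IsOrthantWeight w) (hFm : Measurable F)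
    (hF0 : ∀ t, ¬ 0 ≤ t → F t = 0) (hFC : ∀ t, 0 ≤ t → ‖F t‖ * w t ≤ C)
    {k : (Fin n → ℝ) → ℂ} (hkm : Measurable k)
    (hk : IntegrableOn (fun x => ‖k x‖ * w x) {x | 0 ≤ x})
    (hlap : ∀ z : Fin n → ℂ,
      (∀ x : Fin n → ℝ, 0 ≤ x → -Real.log (w x) ≤ ∑ i, x i * (z i).re) →
      (∫ x in {x : Fin n → ℝ | 0 ≤ x},
        k x * Complex.exp (-∑ i, (x i : ℂ) * z i)) ≠ -1) :
    ∃ l : (Fin n → ℝ) → ℂ, IntegrableOn (fun x => ‖l x‖ * w x) {x | 0 ≤ x} ∧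
      ∀ t, orthantConv F k t =
        -∫ y in {y | 0 ≤ y}, l y * (F (t - y) + orthantConv F k (t - y)) := by
  obtain ⟨S, hS, hSn⟩ := hw.exists_shiftOperator
  have hki : Integrable k (orthantMeasure w) := (hw.integrable_iff hkm.aestronglyMeasurable).2 hk
  obtain ⟨l, hl⟩ := hw.exists_resolvent hS hSn hki hlap
  have hlm : Measurable l := (Lp.stronglyMeasurable l).measurable
  have hlw := hw.integrableOn_coeFn l
  have hKk := hw.restrict_absolutelyContinuous.ae_le hki.coeFn_toL1
  refine ⟨l, hlw, fun t => ?_⟩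
  obtain ⟨Λ, hΛ⟩ := hw.exists_convFunctional hFm hF0 hFC t
  have h1 := congrArg Λ hl
  rw [map_add, map_neg, ← ContinuousLinearMap.integral_comp_comm _
    (hw.integrableOn_smul_shift hS hSn (hki.toL1 k) l), hΛ, hΛ, orthantConv_congr hKk] at h1
  have htriple := hw.integrable_triple hFm hF0 hFC hkm hlm hk hlw t
  have h2 : ∫ x in {x | 0 ≤ x}, Λ (hki.toL1 k x • S x l) =
      ∫ y in {y | 0 ≤ y}, l y * orthantConv F k (t - y) := by
    calc ∫ x in {x | 0 ≤ x}, Λ (hki.toL1 k x • S x l)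
        = ∫ x in {x | 0 ≤ x}, ∫ y in {y | 0 ≤ y}, k x * (F (t - x - y) * l y) := by
          refine integral_congr_ae ?_
          filter_upwards [hKk, ae_restrict_mem (measurableSet_orthant n)] with x hx hxP
          rw [map_smul, hΛ, hx, integral_const_mul, smul_eq_mul, orthantConv_congr
            (hw.restrict_absolutelyContinuous.ae_le (hS x hxP l)), orthantConv_shift F l hxP]
          rfl
      _ = ∫ y in {y | 0 ≤ y}, ∫ x in {x | 0 ≤ x}, k x * (F (t - x - y) * l y) :=
          integral_integral_swap htriple
      _ = _ := by
          refine integral_congr_ae (Filter.Eventually.of_forall fun y => ?_)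
          simp only [orthantConv]
          rw [← integral_const_mul]
          refine integral_congr_ae (Filter.Eventually.of_forall fun x => ?_)
          simp only
          rw [sub_right_comm]
          ring
  have h3 : IntegrableOn (fun y => l y * orthantConv F k (t - y)) {y | 0 ≤ y} := by
    refine htriple.integral_prod_right.congr (Filter.Eventually.of_forall fun y => ?_)
    simp only [orthantConv]
    rw [← integral_const_mul]
    refine integral_congr_ae (Filter.Eventually.of_forall fun x => ?_)
    simp only
    rw [sub_right_comm]
    ring
  have h4 : IntegrableOn (fun y => l y * F (t - y)) {y | 0 ≤ y} := by
    simpa only [mul_comm] using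
      hw.integrableOn_conv hFm hF0 hFC hlm.aestronglyMeasurable hlw t
  simp only [mul_add]
  rw [integral_add h4 h3, ← h2, eq_neg_iff_add_eq_zero, add_comm, ← eq_neg_iff_add_eq_zero, ← h1]
  simp only [orthantConv, mul_comm (l _)]

lemma exists_tail_integral_lt {u : (Fin n → ℝ) → ℝ} (hu : IntegrableOn u {x | 0 ≤ x})
    {ε : ℝ} (hε : 0 < ε) :
    ∃ R : ℝ, 0 < R ∧ ∫ x in {x | 0 ≤ x}, {x | R < ‖x‖}.indicator u x < ε := by
  have hm : ∀ R : ℝ, MeasurableSet {x : Fin n → ℝ | R < ‖x‖} := fun R =>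
    measurableSet_lt measurable_const measurable_norm
  have key : Filter.Tendsto
      (fun N : ℕ => ∫ x in {x | 0 ≤ x}, {x : Fin n → ℝ | (N : ℝ) < ‖x‖}.indicator u x)
      Filter.atTop (nhds (∫ _ in {x : Fin n → ℝ | 0 ≤ x}, (0 : ℝ))) := by
    refine tendsto_integral_of_dominated_convergence (fun x => ‖u x‖)
      (fun N => hu.aestronglyMeasurable.indicator (hm N)) hu.norm
      (fun N => Filter.Eventually.of_forall fun x => norm_indicator_le_norm_self _ _)
      (Filter.Eventually.of_forall fun x => ?_)
    obtain ⟨N₀, hN₀⟩ := exists_nat_ge ‖x‖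
    refine tendsto_const_nhds.congr' ?_
    filter_upwards [Filter.eventually_ge_atTop N₀] with N hN
    rw [Set.indicator_of_notMem]
    exact not_lt.2 (hN₀.trans (by exact_mod_cast hN))
  rw [integral_zero] at key
  obtain ⟨N, hN, hN'⟩ := ((key.eventually_lt_const hε).and
    (Filter.eventually_gt_atTop 0)).exists
  exact ⟨N, by exact_mod_cast hN', hN⟩

/-- Convolution with a function in `L¹(w)` preserves decay at infinity relative to `w`. -/
lemma IsOrthantWeight.exists_conv_decay (hw : IsOrthantWeight w)
    {G l : (Fin n → ℝ) → ℂ} {M : ℝ} (hM : 0 ≤ M)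
    (hG0 : ∀ t, ¬ 0 ≤ t → G t = 0) (hGM : ∀ t, 0 ≤ t → ‖G t‖ * w t ≤ M)
    (hG : ∀ ε : ℝ, 0 < ε → ∃ R : ℝ, 0 < R ∧ ∀ᵐ x : Fin n → ℝ, 0 ≤ x ∧ R < ‖x‖ →
      ‖G x‖ * w x < ε)
    (hl : IntegrableOn (fun x => ‖l x‖ * w x) {x | 0 ≤ x}) {ε : ℝ} (hε : 0 < ε) :
    ∃ R : ℝ, 0 < R ∧ ∀ t, 0 ≤ t → R < ‖t‖ →
      ‖∫ y in {y | 0 ≤ y}, l y * G (t - y)‖ * w t < ε := by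
  set L := ∫ x in {x | 0 ≤ x}, ‖l x‖ * w x with hL
  have hL0 : 0 ≤ L := setIntegral_nonneg (measurableSet_orthant n) fun x hx =>
    mul_nonneg (norm_nonneg _) (hw.pos x hx).le
  obtain ⟨R₁, hR₁, hGR⟩ := hG (ε / (2 * (L + 1))) (by positivity)
  obtain ⟨R₂, hR₂, htail⟩ := exists_tail_integral_lt hl (ε := ε / (2 * (M + 1))) (by positivity)
  refine ⟨R₁ + R₂, by positivity, fun t ht htR => ?_⟩
  have hwt := hw.pos t ht
  have hind : IntegrableOn ({x | R₂ < ‖x‖}.indicator fun x => ‖l x‖ * w x) {x | 0 ≤ x} :=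
    hl.indicator (measurableSet_lt measurable_const measurable_norm)
  have hGt : ∀ᵐ y : Fin n → ℝ, 0 ≤ t - y ∧ R₁ < ‖t - y‖ →
      ‖G (t - y)‖ * w (t - y) < ε / (2 * (L + 1)) :=
    (quasiMeasurePreserving_sub_left volume t).ae hGR
  have hbound : ‖∫ y in {y | 0 ≤ y}, l y * G (t - y) * (w t : ℂ)‖ ≤
      ∫ y in {y | 0 ≤ y}, (ε / (2 * (L + 1)) * (‖l y‖ * w y) +
        M * {x | R₂ < ‖x‖}.indicator (fun x => ‖l x‖ * w x) y) := by
    refine norm_integral_le_of_norm_le ((hl.const_mul _).add (hind.const_mul _)) ?_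
    filter_upwards [ae_restrict_mem (measurableSet_orthant n), ae_restrict_of_ae hGt] with y hy hyG
    have hwy := hw.pos y hy
    have hi0 : 0 ≤ M * {x | R₂ < ‖x‖}.indicator (fun x => ‖l x‖ * w x) y :=
      mul_nonneg hM (by rw [Set.indicator_apply]; split_ifs <;> positivity)
    have he0 : 0 ≤ ε / (2 * (L + 1)) * (‖l y‖ * w y) := by positivity
    by_cases hty : 0 ≤ t - y
    · have h1 := hw.sub y (t - y) hy hty
      rw [add_sub_cancel] at h1
      have h2 : ‖l y * G (t - y) * (w t : ℂ)‖ ≤ (‖G (t - y)‖ * w (t - y)) * (‖l y‖ * w y) := by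
        rw [norm_mul, norm_mul, Complex.norm_real, Real.norm_of_nonneg hwt.le]
        calc ‖l y‖ * ‖G (t - y)‖ * w t ≤ ‖l y‖ * ‖G (t - y)‖ * (w y * w (t - y)) := by gcongr
          _ = _ := by ring
      by_cases hyR : R₂ < ‖y‖
      · rw [Set.indicator_of_mem (show y ∈ {x : Fin n → ℝ | R₂ < ‖x‖} from hyR)]
        have h3 : (‖G (t - y)‖ * w (t - y)) * (‖l y‖ * w y) ≤ M * (‖l y‖ * w y) := by
          gcongr
          exact hGM _ hty
        linarith
      · have h3 : R₁ < ‖t - y‖ := by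
          have := norm_sub_norm_le t y
          linarith
        have h4 : (‖G (t - y)‖ * w (t - y)) * (‖l y‖ * w y) ≤
            ε / (2 * (L + 1)) * (‖l y‖ * w y) := by
          gcongr
          exact (hyG ⟨hty, h3⟩).le
        linarith
    · rw [hG0 _ hty, mul_zero, zero_mul, norm_zero]
      linarith
  rw [integral_mul_const, norm_mul, Complex.norm_real, Real.norm_of_nonneg hwt.le,
    integral_add (hl.const_mul _) (hind.const_mul _), integral_const_mul, integral_const_mul,
    ← hL] at hbound
  refine hbound.trans_lt ?_
  have h1 : ε / (2 * (L + 1)) * L < ε / 2 := by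
    rw [div_mul_eq_mul_div, div_lt_div_iff₀ (by positivity) two_pos]
    nlinarith
  have h2 : M * ∫ y in {y | 0 ≤ y}, {x | R₂ < ‖x‖}.indicator (fun x => ‖l x‖ * w x) y ≤ ε / 2 := by
    calc _ ≤ M * (ε / (2 * (M + 1))) := by gcongr
      _ ≤ ε / 2 := by
        rw [mul_div_assoc', div_le_div_iff₀ (by positivity) two_pos]
        nlinarith
  linarith

end Tauberian

/-- Tauberian theorem for the `n`-dimensional truncated convolution on `[0,∞)ⁿ`:
if `w` is a weight, `f·w ∈ L^∞`, `k ∈ L¹(w)`, the Laplace transform of `k` avoids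
`−1` on the set of `z ∈ ℂⁿ` with `x·Re z ≥ −log w(x)` for all `x ≥ 0`, and
`(f(x) + ∫_{[0,x]} f(x−y)k(y)dy)·w(x) → 0` at infinity (in the a.e. sense),
then `f(x)·w(x) → 0` at infinity. -/
theorem tauberian_Rn (n : ℕ) (w : (Fin n → ℝ) → ℝ) (f k : (Fin n → ℝ) → ℂ)
    (hw_meas : Measurable w)
    (hw_pos : ∀ x : Fin n → ℝ, 0 ≤ x → 0 < w x)
    (hw_loc : ∀ x : Fin n → ℝ, 0 ≤ x → ∃ U ∈ nhds x, ∃ C : ℝ, ∀ y ∈ U, 0 ≤ y → w y ≤ C)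
    (hw_sub : ∀ x y : Fin n → ℝ, 0 ≤ x → 0 ≤ y → w (x + y) ≤ w x * w y)
    (hf_meas : Measurable f)
    (hfw : ∃ C : ℝ, ∀ᵐ x : Fin n → ℝ, 0 ≤ x → ‖f x‖ * w x ≤ C)
    (hk_meas : Measurable k)
    (hk : IntegrableOn (fun x => ‖k x‖ * w x) {x : Fin n → ℝ | 0 ≤ x})
    (hlap : ∀ z : Fin n → ℂ,
      (∀ x : Fin n → ℝ, 0 ≤ x → -Real.log (w x) ≤ ∑ i, x i * (z i).re) →
      (∫ x in {x : Fin n → ℝ | 0 ≤ x},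
        k x * Complex.exp (-∑ i, (x i : ℂ) * z i)) ≠ -1)
    (h0 : ∀ ε : ℝ, 0 < ε → ∃ R : ℝ, 0 < R ∧ ∀ᵐ x : Fin n → ℝ,
      0 ≤ x ∧ R < ‖x‖ →
      ‖(f x + ∫ y in Set.Icc 0 x, f (x - y) * k y) * (w x : ℂ)‖ < ε) :
    ∀ ε : ℝ, 0 < ε → ∃ R : ℝ, 0 < R ∧ ∀ᵐ x : Fin n → ℝ,
      0 ≤ x ∧ R < ‖x‖ → ‖f x * (w x : ℂ)‖ < ε := by
  have hw : IsOrthantWeight w := ⟨hw_meas, hw_pos, hw_loc, hw_sub⟩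
  obtain ⟨C₀, hC₀⟩ := hfw
  set C := max C₀ 0 with hC
  have hCnn : 0 ≤ C := le_max_right _ _
  set A : Set (Fin n → ℝ) := {t | 0 ≤ t} ∩ {t | ‖f t‖ * w t ≤ C} with hA
  have hAm : MeasurableSet A := (measurableSet_orthant n).inter
    (measurableSet_le (hf_meas.norm.mul hw_meas) measurable_const)
  set F := A.indicator f with hF
  have hFm : Measurable F := hf_meas.indicator hAm
  have hF0 : ∀ t, ¬ 0 ≤ t → F t = 0 := fun t ht => Set.indicator_of_notMem (fun h => ht h.1) f
  have hFC : ∀ t, 0 ≤ t → ‖F t‖ * w t ≤ C := fun t ht => by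
    by_cases htA : t ∈ A
    · rw [hF, Set.indicator_of_mem htA]; exact htA.2
    · rw [hF, Set.indicator_of_notMem htA, norm_zero, zero_mul]; exact hCnn
  have hFf : ∀ᵐ t : Fin n → ℝ, 0 ≤ t → F t = f t := by
    filter_upwards [hC₀] with t ht htn
    exact Set.indicator_of_mem (show t ∈ A from ⟨htn, (ht htn).trans (le_max_left _ _)⟩) f
  have hconv : ∀ t, orthantConv F k t = ∫ y in Set.Icc 0 t, f (t - y) * k y := fun t => by
    have h1 : Set.Icc 0 t = {y | 0 ≤ y} ∩ Set.Iic t := rfl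
    rw [orthantConv, h1, ← setIntegral_indicator measurableSet_Iic]
    refine integral_congr_ae (ae_restrict_of_ae ?_)
    filter_upwards [(quasiMeasurePreserving_sub_left volume t).ae hFf] with y hy
    by_cases hyt : y ≤ t
    · rw [Set.indicator_of_mem (Set.mem_Iic.2 hyt), hy (sub_nonneg.2 hyt)]
    · rw [Set.indicator_of_notMem (fun h => hyt (Set.mem_Iic.1 h)),
        hF0 _ fun h => hyt (sub_nonneg.1 h), zero_mul]
  obtain ⟨l, hl, hinv⟩ := hw.exists_inversion hFm hF0 hFC hk_meas hk hlap
  set G := fun t => F t + orthantConv F k t with hG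
  set K := ∫ x in {x | 0 ≤ x}, ‖k x‖ * w x with hK
  have hKnn : 0 ≤ K := setIntegral_nonneg (measurableSet_orthant n) fun x hx =>
    mul_nonneg (norm_nonneg _) (hw_pos x hx).le
  have hG0 : ∀ t, ¬ 0 ≤ t → G t = 0 := fun t ht => by
    simp only [hG]
    rw [hF0 t ht, orthantConv_of_not_nonneg hF0 k ht, add_zero]
  have hGM : ∀ t, 0 ≤ t → ‖G t‖ * w t ≤ C + C * K := fun t ht => by
    obtain ⟨D, -, hD, hDF⟩ := hw.norm_translate_le hF0 hFC t
    have hwt := hw_pos t ht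
    calc ‖G t‖ * w t ≤ (‖F t‖ + D * K) * w t := by
          gcongr
          exact (norm_add_le _ _).trans (by gcongr; exact norm_orthantConv_le hk hDF)
      _ = ‖F t‖ * w t + C * K := by rw [hD ht]; field_simp
      _ ≤ _ := by gcongr; exact hFC t ht
  have hGd : ∀ ε : ℝ, 0 < ε → ∃ R : ℝ, 0 < R ∧ ∀ᵐ x : Fin n → ℝ, 0 ≤ x ∧ R < ‖x‖ →
      ‖G x‖ * w x < ε := fun ε hε => by
    obtain ⟨R, hR, h⟩ := h0 ε hε
    refine ⟨R, hR, ?_⟩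
    filter_upwards [h, hFf] with x hx hxF hxR
    have h1 := hx hxR
    rwa [← hconv, ← hxF hxR.1, norm_mul, Complex.norm_real,
      Real.norm_of_nonneg (hw_pos x hxR.1).le] at h1
  intro ε hε
  obtain ⟨R₁, hR₁, hd₁⟩ := hGd (ε / 2) (half_pos hε)
  obtain ⟨R₂, hR₂, hd₂⟩ := hw.exists_conv_decay (by positivity) hG0 hGM hGd hl (half_pos hε)
  refine ⟨max R₁ R₂, lt_max_of_lt_left hR₁, ?_⟩
  filter_upwards [hd₁, hFf] with x hx₁ hxF hxR
  have hwx := hw_pos x hxR.1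
  have h1 := hx₁ ⟨hxR.1, (le_max_left _ _).trans_lt hxR.2⟩
  have h2 := hd₂ x hxR.1 ((le_max_right _ _).trans_lt hxR.2)
  have h3 : F x = G x + ∫ y in {y | 0 ≤ y}, l y * G (x - y) := by
    have h4 := hinv x
    simp only [hG] at h4 ⊢
    rw [h4]
    ring
  rw [← hxF hxR.1, norm_mul, Complex.norm_real, Real.norm_of_nonneg hwx.le, h3]
  calc _ ≤ (‖G x‖ + ‖∫ y in {y | 0 ≤ y}, l y * G (x - y)‖) * w x := by
        gcongr
        exact norm_add_le _ _
    _ < ε := by rw [add_mul]; linarith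
end

section
/- Let w : [0,∞)ⁿ → (0,∞) be a weight, i.e. a measurable, locally bounded function satisfying w(x+y) ≤ w(x)·w(y) for all x, y ∈ [0,∞)ⁿ. Let F : [0,∞)ⁿ → ℂ be measurable with F·w essentially bounded, and let k : [0,∞)ⁿ → ℂ satisfy ∫_{[0,∞)ⁿ} |k(x)| w(x) dx < ∞. If F(x)·w(x) → 0 at infinity (i.e., for every ε > 0 there is R > 0 such that |F(x) w(x)| < ε for almost every x ∈ [0,∞)ⁿ with |x| > R), then the truncated convolution (F∗k)(x) = ∫_{[0,x]} F(x−y) k(y) dy exists for almost every x and (F∗k)(x)·w(x) → 0 at infinity in the same sense. -/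
open MeasureTheory

/-- The integral of an integrable function over the complement of a large ball is small. -/
theorem exists_setIntegral_norm_gt_lt {E : Type*} [NormedAddCommGroup E] [MeasurableSpace E]
    [OpensMeasurableSpace E] {μ : Measure E} {g : E → ℝ} (hg : Integrable g μ) {ε : ℝ}
    (hε : 0 < ε) : ∃ R : ℝ, 0 < R ∧ ∫ y in {y | R < ‖y‖}, g y ∂μ < ε := by
  have hanti : Antitone fun N : ℕ => {y : E | (N : ℝ) < ‖y‖} := by
    intro a b hab y (hy : (b : ℝ) < ‖y‖)
    exact lt_of_le_of_lt (by exact_mod_cast hab) hy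
  have hlim := tendsto_setIntegral_of_antitone (μ := μ) (f := g)
    (fun N => measurableSet_lt measurable_const measurable_norm) hanti ⟨0, hg.integrableOn⟩
  have hinter : ⋂ N : ℕ, {y : E | (N : ℝ) < ‖y‖} = ∅ := by
    refine Set.eq_empty_iff_forall_notMem.2 fun y hy => ?_
    obtain ⟨N, hN⟩ := exists_nat_ge ‖y‖
    exact absurd (Set.mem_iInter.1 hy N) (not_lt.2 hN)
  rw [hinter, Measure.restrict_empty, integral_zero_measure] at hlim
  obtain ⟨N, hN, hN'⟩ :=
    ((hlim.eventually_lt_const hε).and (Filter.eventually_gt_atTop 0)).exists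
  exact ⟨N, by exact_mod_cast hN', hN⟩

/-- Submultiplicativity of `w` bounds the convolution integrand pointwise. -/
theorem norm_convolution_integrand_mul_le {n : ℕ} {w : (Fin n → ℝ) → ℝ}
    {F k : (Fin n → ℝ) → ℂ}
    (hw_sub : ∀ x y : Fin n → ℝ, 0 ≤ x → 0 ≤ y → w (x + y) ≤ w x * w y)
    {x y : Fin n → ℝ} (hy : y ∈ Set.Icc 0 x) :
    ‖F (x - y) * k y‖ * w x ≤ (‖F (x - y)‖ * w (x - y)) * (‖k y‖ * w y) := by
  have h := hw_sub (x - y) y (sub_nonneg.2 hy.2) hy.1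
  rw [sub_add_cancel] at h
  calc ‖F (x - y) * k y‖ * w x ≤ ‖F (x - y) * k y‖ * (w (x - y) * w y) := by gcongr
    _ = _ := by rw [norm_mul]; ring

/-- Abelian theorem on `[0,∞)ⁿ`: if `w` is a weight, `F·w ∈ L^∞`, `k ∈ L¹(w)` and
`F(x)w(x) → 0` at infinity (in the a.e. sense), then the truncated convolution
`(F∗k)(x) = ∫_{[0,x]} F(x−y)k(y)dy` exists a.e. and `(F∗k)(x)·w(x) → 0` at infinity. -/
theorem abelian_Rn (n : ℕ) (w : (Fin n → ℝ) → ℝ) (F k : (Fin n → ℝ) → ℂ)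
    (hw_meas : Measurable w)
    (hw_pos : ∀ x : Fin n → ℝ, 0 ≤ x → 0 < w x)
    (hw_loc : ∀ x : Fin n → ℝ, 0 ≤ x → ∃ U ∈ nhds x, ∃ C : ℝ, ∀ y ∈ U, 0 ≤ y → w y ≤ C)
    (hw_sub : ∀ x y : Fin n → ℝ, 0 ≤ x → 0 ≤ y → w (x + y) ≤ w x * w y)
    (hF_meas : Measurable F)
    (hFw : ∃ C : ℝ, ∀ᵐ x : Fin n → ℝ, 0 ≤ x → ‖F x‖ * w x ≤ C)
    (hk_meas : Measurable k)
    (hk : IntegrableOn (fun x => ‖k x‖ * w x) {x : Fin n → ℝ | 0 ≤ x})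
    (h0 : ∀ ε : ℝ, 0 < ε → ∃ R : ℝ, 0 < R ∧ ∀ᵐ x : Fin n → ℝ,
      0 ≤ x ∧ R < ‖x‖ → ‖F x * (w x : ℂ)‖ < ε) :
    (∀ᵐ x : Fin n → ℝ, 0 ≤ x →
      IntegrableOn (fun y => F (x - y) * k y) (Set.Icc 0 x)) ∧
    ∀ ε : ℝ, 0 < ε → ∃ R : ℝ, 0 < R ∧ ∀ᵐ x : Fin n → ℝ,
      0 ≤ x ∧ R < ‖x‖ →
      ‖(∫ y in Set.Icc 0 x, F (x - y) * k y) * (w x : ℂ)‖ < ε := by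
  obtain ⟨C₀, hC₀⟩ := hFw
  obtain ⟨C, hCpos, hC⟩ : ∃ C : ℝ, 0 < C ∧
      ∀ᵐ x : Fin n → ℝ, 0 ≤ x → ‖F x‖ * w x ≤ C :=
    ⟨max C₀ 1, by positivity, hC₀.mono fun x hx h => (hx h).trans (le_max_left _ _)⟩
  have hS : MeasurableSet {x : Fin n → ℝ | 0 ≤ x} := measurableSet_Ici
  have hsub : ∀ x : Fin n → ℝ, Set.Icc 0 x ⊆ {x : Fin n → ℝ | 0 ≤ x} := fun x y hy => hy.1
  have hg0 : ∀ y : Fin n → ℝ, 0 ≤ y → 0 ≤ ‖k y‖ * w y := fun y hy =>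
    mul_nonneg (norm_nonneg _) (hw_pos y hy).le
  have hrefl : ∀ (x : Fin n → ℝ) {p : (Fin n → ℝ) → Prop}, (∀ᵐ y, p y) → ∀ᵐ y, p (x - y) :=
    fun x p hp => (Measure.measurePreserving_sub_left volume x).quasiMeasurePreserving.ae hp
  have hint : ∀ x : Fin n → ℝ, 0 ≤ x →
      IntegrableOn (fun y => F (x - y) * k y) (Set.Icc 0 x) := by
    intro x hx
    refine Integrable.mono' (((hk.mono_set (hsub x)).const_mul C).div_const (w x))
      ((hF_meas.comp (measurable_const.sub measurable_id)).mul hk_meas).aestronglyMeasurable ?_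
    filter_upwards [ae_restrict_of_ae (hrefl x hC), ae_restrict_mem measurableSet_Icc] with y h hy
    rw [le_div_iff₀ (hw_pos x hx)]
    exact (norm_convolution_integrand_mul_le hw_sub hy).trans
      (mul_le_mul_of_nonneg_right (h (sub_nonneg.2 hy.2)) (hg0 y hy.1))
  refine ⟨.of_forall hint, fun ε hε => ?_⟩
  set I : ℝ := ∫ y in {x : Fin n → ℝ | 0 ≤ x}, ‖k y‖ * w y with hI
  have hI0 : 0 ≤ I := setIntegral_nonneg hS hg0
  obtain ⟨R₀, hR₀, hF⟩ := h0 (ε / (2 * (I + 1))) (by positivity)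
  obtain ⟨R₁, hR₁, htail⟩ := exists_setIntegral_norm_gt_lt hk (ε := ε / (2 * C)) (by positivity)
  set δ : ℝ := ε / (2 * (I + 1)) with hδ
  have hδ0 : 0 < δ := by positivity
  have hT : MeasurableSet {y : Fin n → ℝ | R₁ < ‖y‖} :=
    measurableSet_lt measurable_const measurable_norm
  set G : (Fin n → ℝ) → ℝ := fun y =>
    δ * (‖k y‖ * w y) + C * {y | R₁ < ‖y‖}.indicator (fun y => ‖k y‖ * w y) y with hG
  have hGint : IntegrableOn G {x : Fin n → ℝ | 0 ≤ x} :=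
    (hk.const_mul δ).add ((hk.indicator hT).const_mul C)
  have hGnonneg : ∀ y : Fin n → ℝ, 0 ≤ y → 0 ≤ G y := fun y hy =>
    add_nonneg (mul_nonneg hδ0.le (hg0 y hy))
      (mul_nonneg hCpos.le (Set.indicator_apply_nonneg fun _ => hg0 y hy))
  have hGlt : ∫ y in {x : Fin n → ℝ | 0 ≤ x}, G y < ε := by
    have h1 : δ * I ≤ ε / 2 := by
      rw [hδ, div_mul_eq_mul_div, div_le_div_iff₀ (by positivity) two_pos]
      nlinarith
    have h2 : C * ∫ y in {y | R₁ < ‖y‖}, ‖k y‖ * w y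
        ∂volume.restrict {x : Fin n → ℝ | 0 ≤ x} < ε / 2 := by
      calc _ < C * (ε / (2 * C)) := by gcongr
        _ = ε / 2 := by field_simp
    rw [hG, integral_add (hk.const_mul δ) ((hk.indicator hT).const_mul C), integral_const_mul,
      integral_const_mul, integral_indicator hT]
    linarith
  refine ⟨R₀ + R₁, by positivity, .of_forall fun x ⟨hx, hxR⟩ => ?_⟩
  have hwx := hw_pos x hx
  calc ‖(∫ y in Set.Icc 0 x, F (x - y) * k y) * (w x : ℂ)‖
      = ‖∫ y in Set.Icc 0 x, F (x - y) * k y‖ * w x := by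
        rw [norm_mul, Complex.norm_of_nonneg hwx.le]
    _ ≤ (∫ y in Set.Icc 0 x, ‖F (x - y) * k y‖) * w x := by
        gcongr
        exact norm_integral_le_integral_norm _
    _ = ∫ y in Set.Icc 0 x, ‖F (x - y) * k y‖ * w x := (integral_mul_const _ _).symm
    _ ≤ ∫ y in Set.Icc 0 x, G y := by
        refine integral_mono_ae ((hint x hx).norm.mul_const _) (hGint.mono_set (hsub x)) ?_
        filter_upwards [ae_restrict_of_ae (hrefl x hC), ae_restrict_of_ae (hrefl x hF),
          ae_restrict_mem measurableSet_Icc] with y hCy hFy hy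
        have hxy : 0 ≤ x - y := sub_nonneg.2 hy.2
        refine (norm_convolution_integrand_mul_le hw_sub hy).trans ?_
        by_cases hyR : R₁ < ‖y‖
        · rw [hG]
          simp only [Set.indicator_of_mem (show y ∈ {y | R₁ < ‖y‖} from hyR)]
          exact (mul_le_mul_of_nonneg_right (hCy hxy) (hg0 y hy.1)).trans
            (le_add_of_nonneg_left (mul_nonneg hδ0.le (hg0 y hy.1)))
        · rw [hG]
          simp only [Set.indicator_of_notMem (show y ∉ {y | R₁ < ‖y‖} from hyR), mul_zero,
            add_zero]
          have hfar : R₀ < ‖x - y‖ := by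
            have := norm_sub_norm_le x y
            linarith
          have hsmall := hFy ⟨hxy, hfar⟩
          rw [norm_mul, Complex.norm_of_nonneg (hw_pos _ hxy).le] at hsmall
          exact mul_le_mul_of_nonneg_right hsmall.le (hg0 y hy.1)
    _ ≤ ∫ y in {x : Fin n → ℝ | 0 ≤ x}, G y :=
        setIntegral_mono_set hGint ((ae_restrict_mem hS).mono hGnonneg) (hsub x).eventuallyLE
    _ < ε := hGlt
end

section
/- Let S be a cancellative commutative monoid (written multiplicatively, with identity e), viewed as a discrete semigroup with counting measure. Let w : S → (0,∞) satisfy w(st) ≤ w(s)·w(t) for all s, t ∈ S. Let f : S → ℂ with f·w bounded, and let k : S → ℂ with Σ_{s∈S} |k(s)| w(s) < ∞. Define the convolution (f∗k)(t) = Σ_{(r,s) : r·s = t} f(r) k(s) (the sum is over all pairs (r,s) ∈ S×S with r·s = t; by cancellativity, for each s there is at most one such r, and the sum converges absolutely). Assume that for every monoid homomorphism ψ : S → ℂ (into the multiplicative monoid of ℂ, with ψ(e) = 1) satisfying |ψ(s)| ≤ w(s) for all s, one has Σ_{s∈S} k(s)·conj(ψ(s)) ≠ 0. If (f∗k)(t)·w(t)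 → 0 along the cofinite filter on S (i.e., for every ε > 0 the set {t : |(f∗k)(t) w(t)| ≥ ε} is finite), then f(t)·w(t) → 0 along the cofinite filter on S. -/
open Filter Topology
open scoped ENNReal

section BanachAlgebra

theorem norm_algHom_apply_le_of_pow_le {A : Type*} [NormedRing A] [NormedAlgebra ℂ A]
    [CompleteSpace A] (φ : A →ₐ[ℂ] ℂ) {a : A} {c : ℝ} (hc : 0 < c)
    (ha : ∀ n : ℕ, ‖a ^ n‖ ≤ c ^ n * ‖(1 : A)‖) : ‖φ a‖ ≤ c := by
  by_contra! h
  obtain ⟨n, hn⟩ := (tendsto_pow_atTop_atTop_of_one_lt ((one_lt_div hc).2 h)).eventually_gt_atTop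
    (‖(1 : A)‖ * ‖(1 : A)‖) |>.exists
  have h1 : ‖φ a‖ ^ n ≤ c ^ n * ‖(1 : A)‖ * ‖(1 : A)‖ := by
    rw [← norm_pow, ← map_pow]
    exact (AlgHom.norm_apply_le_self_mul_norm_one φ _).trans
      (mul_le_mul_of_nonneg_right (ha n) (norm_nonneg _))
  rw [div_pow, lt_div_iff₀ (by positivity)] at hn
  linarith

/-- If no character of `S` dominated by `w` annihilates `k`, then `∑ s, k s • T s` is invertible
in the closed algebra generated by the representation `T`. -/
theorem exists_mul_tsum_smul_eq_one {S A : Type*} [CommMonoid S] [NormedRing A]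
    [NormedAlgebra ℂ A] [CompleteSpace A] (T : S →* A) {w : S → ℝ} (hw_pos : ∀ s, 0 < w s)
    (hT : ∀ s, ‖T s‖ ≤ w s) {k : S → ℂ} (hk : Summable fun s => ‖k s‖ * w s)
    (hψ : ∀ ψ : S →* ℂ, (∀ s, ‖ψ s‖ ≤ w s) → ∑' s, k s * ψ s ≠ 0) :
    ∃ b ∈ (Algebra.adjoin ℂ (Set.range T)).topologicalClosure, b * ∑' s, k s • T s = 1 := by
  set B := (Algebra.adjoin ℂ (Set.range T)).topologicalClosure with hB
  have hcomm : ∀ x ∈ Set.range T, ∀ y ∈ Set.range T, x * y = y * x := by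
    rintro _ ⟨s, rfl⟩ _ ⟨t, rfl⟩
    rw [← map_mul, mul_comm, map_mul]
  have := Algebra.isMulCommutative_adjoin ℂ hcomm
  let : NormedCommRing B :=
    { (inferInstance : NormedRing B) with
      mul_comm := (Subalgebra.commRingTopologicalClosure (Algebra.adjoin ℂ (Set.range T))
        fun x y => mul_comm' x y).mul_comm }
  have : CompleteSpace B :=
    (Subalgebra.isClosed_topologicalClosure _).completeSpace_coe
  let U : S →* B := T.codRestrict B fun s =>
    Subalgebra.le_topologicalClosure _ (Algebra.subset_adjoin ⟨s, rfl⟩)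
  have hU : ∀ s, ‖U s‖ ≤ w s := hT
  have hsum : Summable fun s => k s • U s := by
    refine Summable.of_norm_bounded hk fun s => ?_
    rw [norm_smul]
    exact mul_le_mul_of_nonneg_left (hU s) (norm_nonneg _)
  have hunit : IsUnit (∑' s, k s • U s) := by
    by_contra hnu
    obtain ⟨φ, hφ⟩ := WeakDual.CharacterSpace.exists_apply_eq_zero hnu
    let χ : B →ₐ[ℂ] ℂ := WeakDual.CharacterSpace.toAlgHom φ
    refine hψ ((χ : B →* ℂ).comp U) (fun s => ?_) ?_
    · refine norm_algHom_apply_le_of_pow_le χ (hw_pos s) fun n => ?_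
      induction n with
      | zero => simp
      | succ n ih =>
        rw [pow_succ, pow_succ, mul_right_comm]
        exact (norm_mul_le _ _).trans
          (mul_le_mul ih (hU s) (norm_nonneg _) ((norm_nonneg _).trans ih))
    · have := (hsum.hasSum.mapL (WeakDual.CharacterSpace.toCLM φ)).tsum_eq
      simp only [map_smul, WeakDual.CharacterSpace.coe_toCLM, smul_eq_mul, hφ] at this
      exact this
  obtain ⟨b, hb⟩ := hunit.exists_left_inv
  refine ⟨b, b.2, ?_⟩
  have h1 := congrArg (Subtype.val) hb
  have h2 := (hsum.hasSum.mapL B.toSubmodule.subtypeL).tsum_eq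
  have h3 : ((∑' s, k s • U s : B) : A) = ∑' s, k s • T s := h2.symm
  rw [← h3]
  exact h1

theorem apply_mem_of_mem_topologicalClosure_adjoin {E : Type*} [NormedAddCommGroup E]
    [NormedSpace ℂ E] {X : Set (E →L[ℂ] E)} {F : Submodule ℂ E} (hF : IsClosed (F : Set E))
    (hX : ∀ T ∈ X, ∀ x ∈ F, T x ∈ F) {b : E →L[ℂ] E}
    (hb : b ∈ (Algebra.adjoin ℂ X).topologicalClosure) {x : E} (hx : x ∈ F) : b x ∈ F := by
  have hadj : ∀ a ∈ Algebra.adjoin ℂ X, ∀ x ∈ F, a x ∈ F := fun a ha => by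
    induction ha using Algebra.adjoin_induction with
    | mem T hT => exact hX T hT
    | algebraMap c => exact fun x hx => F.smul_mem c hx
    | add a b _ _ ha hb => exact fun x hx => F.add_mem (ha x hx) (hb x hx)
    | mul a b _ _ ha hb => exact fun x hx => ha _ (hb x hx)
  have hcl : IsClosed {a : E →L[ℂ] E | a x ∈ F} :=
    hF.preimage (ContinuousLinearMap.apply ℂ E x).continuous
  exact closure_minimal (fun a ha => hadj a ha x hx) hcl hb

end BanachAlgebra

section WeightedShift

variable {S : Type*} [CancelCommMonoid S]

/-- The translate of `g` by `s`, conjugated by multiplication with the weight `w`. -/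
noncomputable def weightedTranslate (w : S → ℝ) (s : S) (g : S → ℂ) : S → ℂ :=
  Function.extend (· * s) (fun r => ((w (r * s) / w r : ℝ) : ℂ) * g r) 0

theorem weightedTranslate_mul_right (w : S → ℝ) (s : S) (g : S → ℂ) (r : S) :
    weightedTranslate w s g (r * s) = ((w (r * s) / w r : ℝ) : ℂ) * g r :=
  (mul_left_injective s).extend_apply _ _ r

theorem weightedTranslate_of_notMem_range (w : S → ℝ) {s : S} (g : S → ℂ) {t : S}
    (ht : t ∉ Set.range (· * s)) : weightedTranslate w s g t = 0 :=
  Function.extend_apply' _ _ _ ht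

theorem weightedTranslate_add (w : S → ℝ) (s : S) (g h : S → ℂ) :
    weightedTranslate w s (g + h) = weightedTranslate w s g + weightedTranslate w s h := by
  ext t
  by_cases ht : t ∈ Set.range (· * s)
  · obtain ⟨r, rfl⟩ := ht
    simp [weightedTranslate_mul_right, mul_add]
  · simp [weightedTranslate_of_notMem_range w _ ht]

theorem weightedTranslate_smul (w : S → ℝ) (s : S) (c : ℂ) (g : S → ℂ) :
    weightedTranslate w s (c • g) = c • weightedTranslate w s g := by
  ext t
  by_cases ht : t ∈ Set.range (· * s)
  · obtain ⟨r, rfl⟩ := ht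
    simp [weightedTranslate_mul_right, mul_left_comm]
  · simp [weightedTranslate_of_notMem_range w _ ht]

theorem weightedTranslate_one {w : S → ℝ} (hw_pos : ∀ s, 0 < w s) (g : S → ℂ) :
    weightedTranslate w 1 g = g := by
  ext t
  have h := weightedTranslate_mul_right w 1 g t
  rwa [mul_one, div_self (hw_pos t).ne', Complex.ofReal_one, one_mul] at h

theorem weightedTranslate_mul {w : S → ℝ} (hw_pos : ∀ s, 0 < w s) (s u : S) (g : S → ℂ) :
    weightedTranslate w (s * u) g = weightedTranslate w s (weightedTranslate w u g) := by
  ext t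
  by_cases ht : t ∈ Set.range (· * s)
  · obtain ⟨r, rfl⟩ := ht
    simp only [weightedTranslate_mul_right]
    by_cases hr : r ∈ Set.range (· * u)
    · obtain ⟨q, rfl⟩ := hr
      have h1 : q * u * s = q * (s * u) := by rw [mul_assoc, mul_comm u]
      simp only [h1, weightedTranslate_mul_right]
      rw [← mul_assoc ((_ : ℝ) : ℂ), ← Complex.ofReal_mul, div_mul_div_cancel₀ (hw_pos _).ne']
    · rw [weightedTranslate_of_notMem_range w _ hr, mul_zero]
      refine weightedTranslate_of_notMem_range w _ fun ⟨q, hq⟩ => hr ⟨q, ?_⟩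
      exact mul_right_cancel (b := s) (by simpa [mul_assoc, mul_comm u] using hq)
  · rw [weightedTranslate_of_notMem_range w _ ht]
    refine weightedTranslate_of_notMem_range w _ fun ⟨q, hq⟩ => ht ⟨q * u, ?_⟩
    simpa [mul_assoc, mul_comm u] using hq

theorem norm_weight_ratio_mul_le {w : S → ℝ} (hw_pos : ∀ s, 0 < w s)
    (hw_sub : ∀ s t, w (s * t) ≤ w s * w t) (r s : S) (z : ℂ) :
    ‖((w (r * s) / w r : ℝ) : ℂ) * z‖ ≤ w s * ‖z‖ := by
  rw [norm_mul, Complex.norm_of_nonneg (div_pos (hw_pos _) (hw_pos _)).le]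
  gcongr
  rw [div_le_iff₀ (hw_pos r), mul_comm (w s)]
  exact hw_sub r s

theorem norm_weightedTranslate_le {w : S → ℝ} (hw_pos : ∀ s, 0 < w s)
    (hw_sub : ∀ s t, w (s * t) ≤ w s * w t) (s : S) {g : S → ℂ} {C : ℝ} (hC : 0 ≤ C)
    (hg : ∀ r, ‖g r‖ ≤ C) (t : S) : ‖weightedTranslate w s g t‖ ≤ w s * C := by
  by_cases ht : t ∈ Set.range (· * s)
  · obtain ⟨r, rfl⟩ := ht
    simp only [weightedTranslate_mul_right]
    exact (norm_weight_ratio_mul_le hw_pos hw_sub r s _).trans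
      (mul_le_mul_of_nonneg_left (hg r) (hw_pos s).le)
  · rw [weightedTranslate_of_notMem_range w _ ht, norm_zero]
    exact mul_nonneg (hw_pos s).le hC

theorem tendsto_weightedTranslate {w : S → ℝ} (hw_pos : ∀ s, 0 < w s)
    (hw_sub : ∀ s t, w (s * t) ≤ w s * w t) (s : S) {g : S → ℂ}
    (hg : Tendsto g cofinite (𝓝 0)) : Tendsto (weightedTranslate w s g) cofinite (𝓝 0) := by
  rw [NormedAddGroup.tendsto_nhds_zero] at hg ⊢
  intro ε hε
  have h := hg (ε / w s) (div_pos hε (hw_pos s))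
  rw [eventually_cofinite] at h ⊢
  refine (h.image (· * s)).subset fun t ht => ?_
  by_cases hts : t ∈ Set.range (· * s)
  · obtain ⟨r, rfl⟩ := hts
    refine ⟨r, fun hr => ht ?_, rfl⟩
    simp only [weightedTranslate_mul_right]
    rw [lt_div_iff₀' (hw_pos s)] at hr
    exact (norm_weight_ratio_mul_le hw_pos hw_sub r s _).trans_lt hr
  · refine absurd ?_ ht
    simpa [weightedTranslate_of_notMem_range w _ hts] using hε

/-- Weighted translations as a representation of `S` on the bounded functions on `S`. -/
noncomputable def weightedShift (w : S → ℝ) (hw_pos : ∀ s, 0 < w s)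
    (hw_sub : ∀ s t, w (s * t) ≤ w s * w t) :
    S →* (lp (fun _ : S => ℂ) ∞ →L[ℂ] lp (fun _ : S => ℂ) ∞) where
  toFun s := LinearMap.mkContinuous
    { toFun := fun g => ⟨weightedTranslate w s g, memℓp_infty
        ⟨w s * ‖g‖, Set.forall_mem_range.2 <| norm_weightedTranslate_le hw_pos hw_sub s
          (norm_nonneg g) (lp.norm_apply_le_norm ENNReal.top_ne_zero g)⟩⟩
      map_add' := fun g h => Subtype.ext (weightedTranslate_add w s g h)
      map_smul' := fun c g => Subtype.ext (weightedTranslate_smul w s c g) }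
    (w s) fun g => by
      refine lp.norm_le_of_forall_le (mul_nonneg (hw_pos s).le (norm_nonneg g)) ?_
      exact norm_weightedTranslate_le hw_pos hw_sub s (norm_nonneg g)
        (lp.norm_apply_le_norm ENNReal.top_ne_zero g)
  map_one' := by
    ext1 g
    exact Subtype.ext (weightedTranslate_one hw_pos g)
  map_mul' s u := by
    ext1 g
    exact Subtype.ext (weightedTranslate_mul hw_pos s u g)

theorem norm_weightedShift_le (w : S → ℝ) (hw_pos : ∀ s, 0 < w s)
    (hw_sub : ∀ s t, w (s * t) ≤ w s * w t) (s : S) :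
    ‖weightedShift w hw_pos hw_sub s‖ ≤ w s :=
  ContinuousLinearMap.opNorm_le_bound _ (hw_pos s).le fun g =>
    lp.norm_le_of_forall_le (mul_nonneg (hw_pos s).le (norm_nonneg g)) <|
      norm_weightedTranslate_le hw_pos hw_sub s (norm_nonneg g)
        (lp.norm_apply_le_norm ENNReal.top_ne_zero g)

/-- On the function `f * w`, the weighted translations average to the convolution of `f` with `k`,
multiplied by `w`. -/
theorem tsum_mul_weightedTranslate {w : S → ℝ} (hw_pos : ∀ s, 0 < w s) (f k : S → ℂ) (t : S) :
    ∑' s, k s * weightedTranslate w s (fun r => f r * (w r : ℂ)) t =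
      (∑' q : {q : S × S // q.1 * q.2 = t}, f q.1.1 * k q.1.2) * (w t : ℂ) := by
  have hinj : Function.Injective fun q : {q : S × S // q.1 * q.2 = t} => q.1.2 := by
    rintro ⟨⟨a, b⟩, h⟩ ⟨⟨a', b'⟩, h'⟩ (rfl : b = b')
    obtain rfl : a = a' := mul_right_cancel (h.trans h'.symm)
    rfl
  rw [← hinj.tsum_eq, ← tsum_mul_right]
  · refine tsum_congr ?_
    rintro ⟨⟨r, s⟩, rfl⟩
    have : (w r : ℂ) ≠ 0 := Complex.ofReal_ne_zero.2 (hw_pos r).ne'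
    simp only [weightedTranslate_mul_right, Complex.ofReal_div]
    field_simp
  · intro s hs
    by_cases ht : t ∈ Set.range (· * s)
    · obtain ⟨r, hr⟩ := ht
      exact ⟨⟨(r, s), hr⟩, rfl⟩
    · simp [weightedTranslate_of_notMem_range w _ ht] at hs

end WeightedShift

/-- The bounded functions vanishing at infinity on a discrete space. -/
def lpInftyVanishing (S : Type*) : Submodule ℂ (lp (fun _ : S => ℂ) ∞) where
  carrier := {g | Tendsto g cofinite (𝓝 0)}
  add_mem' hg hh := (hg.add hh).trans_eq (congrArg 𝓝 (add_zero 0))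
  zero_mem' := tendsto_const_nhds
  smul_mem' c _ hg := (hg.const_smul c).trans_eq (congrArg 𝓝 (smul_zero c))

theorem isClosed_lpInftyVanishing (S : Type*) :
    IsClosed (lpInftyVanishing S : Set (lp (fun _ : S => ℂ) ∞)) := by
  refine isClosed_of_closure_subset fun g hg => ?_
  refine NormedAddGroup.tendsto_nhds_zero.2 fun ε hε => ?_
  obtain ⟨h, hh, hgh⟩ := Metric.mem_closure_iff.1 hg (ε / 2) (half_pos hε)
  filter_upwards [NormedAddGroup.tendsto_nhds_zero.1 hh (ε / 2) (half_pos hε)] with t ht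
  have h1 : ‖g t - h t‖ ≤ ‖g - h‖ := lp.norm_apply_le_norm ENNReal.top_ne_zero (g - h) t
  have h2 := norm_le_norm_add_norm_sub' (g t) (h t)
  rw [dist_eq_norm] at hgh
  linarith

/-- Tauberian theorem for a discrete cancellative commutative monoid `S` with
counting measure and weight `w`: if `Σ_s k(s)·conj(ψ(s)) ≠ 0` for every
semicharacter `ψ` with `|ψ| ≤ w`, and `(f∗k)(t)·w(t) → 0` along the cofinite
filter, then `f(t)·w(t) → 0` along the cofinite filter. -/
theorem tauberian_discrete (S : Type*) [CancelCommMonoid S] (w : S → ℝ) (f k : S → ℂ)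
    (hw_pos : ∀ s, 0 < w s)
    (hw_sub : ∀ s t, w (s * t) ≤ w s * w t)
    (hf : ∃ C, ∀ s, ‖f s‖ * w s ≤ C)
    (hk : Summable fun s => ‖k s‖ * w s)
    (hψ : ∀ ψ : S →* ℂ, (∀ s, ‖ψ s‖ ≤ w s) →
      (∑' s : S, k s * (starRingEnd ℂ) (ψ s)) ≠ 0)
    (h0 : Filter.Tendsto
      (fun t : S => (∑' q : {q : S × S // q.1 * q.2 = t}, f q.1.1 * k q.1.2) * (w t : ℂ))
      Filter.cofinite (nhds 0)) :
    Filter.Tendsto (fun t : S => f t * (w t : ℂ)) Filter.cofinite (nhds 0) := by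
  obtain ⟨C, hC⟩ := hf
  let T := weightedShift w hw_pos hw_sub
  let g : lp (fun _ : S => ℂ) ∞ := ⟨fun t => f t * (w t : ℂ), memℓp_infty ⟨C, by
    rintro _ ⟨t, rfl⟩
    simpa [abs_of_pos (hw_pos t)] using hC t⟩⟩
  have hT : ∀ s, ‖T s‖ ≤ w s := norm_weightedShift_le w hw_pos hw_sub
  obtain ⟨b, hb, hbK⟩ := exists_mul_tsum_smul_eq_one T hw_pos hT hk fun ψ hψw => by
    simpa using hψ ((starRingEnd ℂ : ℂ →* ℂ).comp ψ) (by simpa using hψw)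
  have hsum : Summable fun s => k s • T s := by
    refine Summable.of_norm_bounded hk fun s => ?_
    rw [norm_smul]
    exact mul_le_mul_of_nonneg_left (hT s) (norm_nonneg _)
  have hKg : (∑' s, k s • T s) g ∈ lpInftyVanishing S := by
    refine h0.congr fun t => ?_
    rw [← tsum_mul_weightedTranslate hw_pos]
    exact (hsum.hasSum.mapL ((lp.evalCLM ℂ (fun _ : S => ℂ) ∞ t).comp
      (ContinuousLinearMap.apply ℂ _ g))).tsum_eq
  have hg : b ((∑' s, k s • T s) g) = g := congrArg (fun L => L g) hbK
  have hmem : b ((∑' s, k s • T s) g) ∈ lpInftyVanishing S :=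
    apply_mem_of_mem_topologicalClosure_adjoin (isClosed_lpInftyVanishing S)
      (Set.forall_mem_range.2 fun s x hx => tendsto_weightedTranslate hw_pos hw_sub s hx) hb hKg
  rw [hg] at hmem
  exact hmem
end

section
/- Let w : ℕ → (0,∞) satisfy w(m+n) ≤ w(m)·w(n) for all m, n ∈ ℕ. Let F : ℕ → ℂ with sup_n |F(n)| w(n) < ∞, and let k : ℕ → ℂ with Σ_{n=0}^∞ |k(n)| w(n) < ∞. If F(n)·w(n) → 0 as n → ∞, then (Σ_{i=0}^{n} F(i) k(n−i))·w(n) → 0 as n → ∞. -/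
/-- The convolution of a null sequence with a summable sequence is a null sequence. -/
theorem tendsto_sum_mul_sub_zero {a b : ℕ → ℝ} (ha : Filter.Tendsto a Filter.atTop (nhds 0))
    (hb : Summable b) :
    Filter.Tendsto (fun n => ∑ j ∈ Finset.range (n + 1), a (n - j) * b j)
      Filter.atTop (nhds 0) := by
  obtain ⟨C, hC⟩ := (Metric.isBounded_range_of_tendsto a ha).exists_norm_le
  have haC : ∀ n, ‖a n‖ ≤ C := fun n => hC _ (Set.mem_range_self n)
  have hlim := tendsto_tsum_of_dominated_convergence (𝓕 := Filter.atTop)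
    (f := fun n j => if j ∈ Finset.range (n + 1) then a (n - j) * b j else 0)
    (g := fun _ => (0 : ℝ)) (bound := fun j => C * ‖b j‖) (hb.norm.mul_left C) ?_ ?_
  · rw [tsum_zero] at hlim
    refine hlim.congr fun n => ?_
    rw [tsum_eq_sum (s := Finset.range (n + 1)) fun j hj => if_neg hj]
    exact Finset.sum_congr rfl fun j hj => if_pos hj
  · intro j
    have hj : Filter.Tendsto (fun n => a (n - j) * b j) Filter.atTop (nhds 0) := by
      simpa using (ha.comp (Filter.tendsto_sub_atTop_nat j)).mul_const (b j)
    refine hj.congr' ?_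
    filter_upwards [Filter.eventually_ge_atTop j] with n hn
    rw [if_pos (Finset.mem_range.2 (Nat.lt_succ_of_le hn))]
  · refine Filter.Eventually.of_forall fun n j => ?_
    split_ifs
    · rw [norm_mul]
      exact mul_le_mul_of_nonneg_right (haC _) (norm_nonneg _)
    · rw [norm_zero]
      exact mul_nonneg ((norm_nonneg _).trans (haC 0)) (norm_nonneg _)


/-- Abelian theorem for the additive semigroup `ℕ` with a weight `w`:
if `F(n)·w(n) → 0` then `(F∗k)(n)·w(n) → 0`. -/
theorem abelian_nat (w : ℕ → ℝ) (F k : ℕ → ℂ)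
    (hw_pos : ∀ n, 0 < w n)
    (hw_sub : ∀ m n, w (m + n) ≤ w m * w n)
    (hF : ∃ C, ∀ n, ‖F n‖ * w n ≤ C)
    (hk : Summable fun n => ‖k n‖ * w n)
    (h0 : Filter.Tendsto (fun n : ℕ => F n * (w n : ℂ)) Filter.atTop (nhds 0)) :
    Filter.Tendsto
      (fun n : ℕ => (∑ i ∈ Finset.range (n + 1), F i * k (n - i)) * (w n : ℂ))
      Filter.atTop (nhds 0) := by
  have hnorm : ∀ n, ‖(w n : ℂ)‖ = w n := fun n => by
    rw [Complex.norm_real, Real.norm_of_nonneg (hw_pos n).le]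
  have ha : Filter.Tendsto (fun n => ‖F n‖ * w n) Filter.atTop (nhds 0) := by
    simpa only [norm_mul, hnorm, norm_zero] using h0.norm
  refine squeeze_zero_norm (fun n => ?_) (tendsto_sum_mul_sub_zero ha hk)
  rw [← Finset.sum_flip fun i => F i * k (n - i), norm_mul, hnorm]
  refine (mul_le_mul_of_nonneg_right (norm_sum_le _ _) (hw_pos n).le).trans ?_
  rw [Finset.sum_mul]
  refine Finset.sum_le_sum fun j hj => ?_
  have hjn : j ≤ n := Nat.lt_succ_iff.1 (Finset.mem_range.1 hj)
  have hw : w n ≤ w (n - j) * w j := by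
    simpa only [Nat.sub_add_cancel hjn] using hw_sub (n - j) j
  rw [Nat.sub_sub_self hjn, norm_mul]
  calc ‖F (n - j)‖ * ‖k j‖ * w n ≤ ‖F (n - j)‖ * ‖k j‖ * (w (n - j) * w j) := by gcongr
    _ = ‖F (n - j)‖ * w (n - j) * (‖k j‖ * w j) := by ring
end

section
/- Let ρ : ℕ₊ → (0,∞) be a positive completely multiplicative function on the multiplicative semigroup of positive integers (ρ(mn) = ρ(m)ρ(n) for all m, n ≥ 1, ρ(1) = 1). Let f : ℕ₊ → ℂ with sup_n |f(n)| ρ(n) < ∞, and let k : ℕ₊ → ℂ with Σ_{n=1}^∞ |k(n)| ρ(n) < ∞. Assume there is a constant C > 0 such that |Σ_{n=1}^∞ k(n) ρ(n) n^{−s}| ≥ C for every s ∈ ℂ with Re s ≥ 0. If (Σ_{d | n} f(d) k(n/d))·ρ(n) → 0 as n → ∞, then f(n)·ρ(n) → 0 as n → ∞. -/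
theorem norm_coeff_le_of_norm_sum_exp_le {ι : Type*} (s : Finset ι) (c : ι → ℂ) (ω : ι → ℝ)
    (hω : Set.InjOn ω s) {S : ℝ}
    (h : ∀ t : ℝ, ‖∑ i ∈ s, c i * Complex.exp (ω i * t * Complex.I)‖ ≤ S) {j : ι} (hj : j ∈ s) :
    ‖c j‖ ≤ S := by
  classical
  set K : ℝ := ∑ i ∈ s.erase j, ‖c i‖ * (2 / |ω i - ω j|) with hK
  have hK0 : 0 ≤ K := Finset.sum_nonneg fun i _ => by positivity
  have key : ∀ T : ℝ, 0 < T → ‖c j‖ * T ≤ S * T + K := by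
    intro T hT
    have hint : ∫ t in (0 : ℝ)..T, (∑ i ∈ s, c i * Complex.exp (ω i * t * Complex.I)) *
        Complex.exp (-(ω j * t * Complex.I)) =
        c j * T + ∑ i ∈ s.erase j,
          c i * ∫ t in (0 : ℝ)..T, Complex.exp ((ω i - ω j) * Complex.I * t) := by
      have : ∀ t : ℝ, (∑ i ∈ s, c i * Complex.exp (ω i * t * Complex.I)) *
          Complex.exp (-(ω j * t * Complex.I)) =
          ∑ i ∈ s, c i * Complex.exp ((ω i - ω j) * Complex.I * t) := by
        intro t
        rw [Finset.sum_mul]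
        refine Finset.sum_congr rfl fun i _ => ?_
        rw [mul_assoc, ← Complex.exp_add]
        ring_nf
      simp_rw [this]
      rw [intervalIntegral.integral_finsetSum
        fun i _ => (by fun_prop : Continuous _).intervalIntegrable _ _, ← Finset.add_sum_erase _ _ hj]
      simp [intervalIntegral.integral_const_mul, mul_comm]
    have hle : ‖∫ t in (0 : ℝ)..T, (∑ i ∈ s, c i * Complex.exp (ω i * t * Complex.I)) *
        Complex.exp (-(ω j * t * Complex.I))‖ ≤ S * T := by
      have := intervalIntegral.norm_integral_le_of_norm_le_const (a := (0 : ℝ)) (b := T) (C := S)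
        (f := fun t : ℝ => (∑ i ∈ s, c i * Complex.exp (ω i * t * Complex.I)) *
          Complex.exp (-(ω j * t * Complex.I))) fun t _ => by
          rw [norm_mul, ← neg_mul, ← Complex.ofReal_mul, ← Complex.ofReal_neg,
            Complex.norm_exp_ofReal_mul_I, mul_one]
          simpa using h t
      simpa [abs_of_pos hT] using this
    have hrest : ‖∑ i ∈ s.erase j,
        c i * ∫ t in (0 : ℝ)..T, Complex.exp ((ω i - ω j) * Complex.I * t)‖ ≤ K := by
      refine (norm_sum_le _ _).trans (Finset.sum_le_sum fun i hi => ?_)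
      have hne : ω i - ω j ≠ 0 := fun h0 => (Finset.ne_of_mem_erase hi)
        (hω (Finset.mem_of_mem_erase hi) hj (sub_eq_zero.1 h0))
      have hne' : ((ω i : ℂ) - ω j) * Complex.I ≠ 0 :=
        mul_ne_zero (by exact_mod_cast hne) Complex.I_ne_zero
      rw [norm_mul, integral_exp_mul_complex hne', norm_div]
      have h1 : ‖((ω i : ℂ) - ω j) * Complex.I‖ = |ω i - ω j| := by
        rw [norm_mul, Complex.norm_I, mul_one, ← Complex.ofReal_sub, Complex.norm_real,
          Real.norm_eq_abs]
      rw [h1]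
      gcongr
      refine (norm_sub_le _ _).trans ?_
      have : ∀ x : ℝ, ‖Complex.exp (((ω i : ℂ) - ω j) * Complex.I * x)‖ = 1 := fun x => by
        rw [← Complex.norm_exp_ofReal_mul_I ((ω i - ω j) * x)]
        push_cast
        ring_nf
      rw [this, this]
      norm_num
    calc ‖c j‖ * T = ‖c j * T‖ := by simp [abs_of_pos hT]
      _ ≤ S * T + K := by
        rw [eq_sub_of_add_eq hint.symm]
        exact (norm_sub_le _ _).trans (add_le_add hle hrest)
  by_contra! hlt
  have hd : 0 < ‖c j‖ - S := sub_pos.2 hlt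
  have := key (K / (‖c j‖ - S) + 1) (by positivity)
  have h2 : (‖c j‖ - S) * (K / (‖c j‖ - S) + 1) = K + (‖c j‖ - S) := by field_simp
  linarith [h2]

open scoped Pointwise in
theorem Finset.card_pow_le_succ_pow_card {G : Type*} [CommMonoid G] [DecidableEq G] (s : Finset G)
    (k : ℕ) : (s ^ k).card ≤ (k + 1) ^ s.card := by
  have hsub : s ^ k ⊆ (Finset.univ : Finset (s → Fin (k + 1))).image
      fun e => ∏ x : s, (x : G) ^ (e x : ℕ) := by
    induction k with
    | zero =>
      intro x hx
      simp only [pow_zero, Finset.mem_one] at hx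
      exact Finset.mem_image.2 ⟨fun _ => 0, Finset.mem_univ _, by simp [hx]⟩
    | succ k ih =>
      intro x hx
      rw [pow_succ] at hx
      obtain ⟨y, hy, z, hz, rfl⟩ := Finset.mem_mul.1 hx
      obtain ⟨e, -, rfl⟩ := Finset.mem_image.1 (ih hy)
      refine Finset.mem_image.2
        ⟨fun x => ⟨e x + (if x = ⟨z, hz⟩ then 1 else 0), ?_⟩, Finset.mem_univ _, ?_⟩
      · have := (e x).2
        split_ifs <;> omega
      · simp only [pow_add, Finset.prod_mul_distrib]
        congr 1
        simp [pow_ite]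
  refine (Finset.card_le_card hsub).trans (Finset.card_image_le.trans ?_)
  simp

theorem le_of_forall_pow_le_succ_pow_mul_pow {x S : ℝ} (hS : 0 ≤ S) (N : ℕ)
    (h : ∀ k : ℕ, x ^ k ≤ ((k : ℝ) + 1) ^ N * S ^ k) : x ≤ S := by
  by_contra! hlt
  have hx : 0 < x := hS.trans_lt hlt
  have hr : |S / x| < 1 := by
    rw [abs_of_nonneg (by positivity)]
    exact (div_lt_one hx).2 hlt
  have hlim := (tendsto_pow_const_mul_const_pow_of_abs_lt_one N hr).const_mul (2 ^ N)
  rw [mul_zero] at hlim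
  obtain ⟨k, hk, hk1⟩ := ((hlim.eventually_lt_const one_pos).and
    (Filter.eventually_ge_atTop 1)).exists
  have hk1' : (1 : ℝ) ≤ k := by exact_mod_cast hk1
  have h1 : ((k : ℝ) + 1) ^ N ≤ 2 ^ N * (k : ℝ) ^ N := by
    rw [← mul_pow]
    gcongr
    linarith
  have h2 := (h k).trans (mul_le_mul_of_nonneg_right h1 (pow_nonneg hS k))
  rw [div_pow, ← mul_assoc, mul_div_assoc', div_lt_one (by positivity)] at hk
  linarith
open scoped Pointwise in
theorem MonoidAlgebra.support_coeff_pow_subset {R G : Type*} [Semiring R] [Monoid G]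
    [DecidableEq G] (D : MonoidAlgebra R G) (k : ℕ) :
    (D ^ k).coeff.support ⊆ D.coeff.support ^ k := by
  induction k with
  | zero =>
    intro x hx
    rw [pow_zero, Finsupp.mem_support_iff, MonoidAlgebra.one_def, MonoidAlgebra.coeff_single, Finsupp.single_apply] at hx
    simp only [pow_zero, Finset.mem_one]
    by_contra hne
    exact hx (if_neg fun h => hne h.symm)
  | succ k ih =>
    intro x hx
    rw [pow_succ] at hx ⊢
    rw [Finsupp.mem_support_iff, MonoidAlgebra.coeff_mul] at hx
    obtain ⟨y, hy, hxy⟩ := Finset.exists_ne_zero_of_sum_ne_zero hx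
    obtain ⟨z, hz, hxz⟩ := Finset.exists_ne_zero_of_sum_ne_zero hxy
    refine Finset.mem_mul.2 ⟨y, ih hy, z, hz, ?_⟩
    by_contra hne
    exact hxz (if_neg hne)

/-- A contractive character of a commutative monoid is bounded, on the monoid algebra, by the
supremum over the imaginary characters `g ↦ exp (i ω(g) t)`. -/
theorem MonoidAlgebra.norm_lift_le_of_forall_norm_lift_exp_le {G : Type*} [CommMonoid G]
    {ω : G → ℝ} (hω : Function.Injective ω) (ψ : ℝ → G →* ℂ)
    (hψ : ∀ t g, ψ t g = Complex.exp (ω g * t * Complex.I)) (χ : G →* ℂ) (hχ : ∀ g, ‖χ g‖ ≤ 1)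
    (D : MonoidAlgebra ℂ G) {S : ℝ} (h : ∀ t, ‖MonoidAlgebra.lift ℂ ℂ G (ψ t) D‖ ≤ S) :
    ‖MonoidAlgebra.lift ℂ ℂ G χ D‖ ≤ S := by
  classical
  have hS : 0 ≤ S := (norm_nonneg _).trans (h 0)
  refine le_of_forall_pow_le_succ_pow_mul_pow hS D.coeff.support.card fun k => ?_
  have hcoeff : ∀ g ∈ (D ^ k).coeff.support, ‖(D ^ k).coeff g‖ ≤ S ^ k := by
    intro g hg
    refine norm_coeff_le_of_norm_sum_exp_le _ _ ω hω.injOn (fun t => ?_) hg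
    have := pow_le_pow_left₀ (norm_nonneg _) (h t) k
    rw [← norm_pow, ← map_pow, MonoidAlgebra.lift_apply, Finsupp.sum] at this
    simpa [hψ] using this
  rw [← norm_pow, ← map_pow, MonoidAlgebra.lift_apply, Finsupp.sum]
  calc _ ≤ ∑ g ∈ (D ^ k).coeff.support, ‖(D ^ k).coeff g • χ g‖ := norm_sum_le _ _
    _ ≤ ∑ g ∈ (D ^ k).coeff.support, S ^ k := by
      refine Finset.sum_le_sum fun g hg => ?_
      rw [norm_smul]
      exact (mul_le_of_le_one_right (norm_nonneg _) (hχ g)).trans (hcoeff g hg)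
    _ ≤ _ := by
      rw [Finset.sum_const, nsmul_eq_mul]
      gcongr
      exact_mod_cast (Finset.card_le_card (support_coeff_pow_subset D k)).trans
        (Finset.card_pow_le_succ_pow_card _ k)

theorem norm_algHom_le_of_forall_norm_exp_le {G A : Type*} [CommMonoid G] [NormedCommRing A]
    [NormOneClass A] [NormedAlgebra ℂ A] [CompleteSpace A] (u : G →* A) (hu : ∀ g, ‖u g‖ ≤ 1)
    (hd : DenseRange (MonoidAlgebra.lift ℂ A G u)) {ω : G → ℝ} (hω : Function.Injective ω)
    (ev : ℝ → A →ₐ[ℂ] ℂ) (hev : ∀ t g, ev t (u g) = Complex.exp (ω g * t * Complex.I))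
    (φ : A →ₐ[ℂ] ℂ) (x : A) {S : ℝ} (h : ∀ t, ‖ev t x‖ ≤ S) : ‖φ x‖ ≤ S := by
  refine le_of_forall_pos_le_add fun ε hε => ?_
  obtain ⟨D, hD⟩ := Metric.denseRange_iff.1 hd x (ε / 2) (half_pos hε)
  rw [dist_eq_norm] at hD
  have hlift : ∀ θ : A →ₐ[ℂ] ℂ, θ (MonoidAlgebra.lift ℂ A G u D) =
      MonoidAlgebra.lift ℂ ℂ G ((θ : A →* ℂ).comp u) D := fun θ => by
    simp [MonoidAlgebra.lift_apply, Finsupp.sum]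
  have hclose : ∀ θ : A →ₐ[ℂ] ℂ, ‖θ x - θ (MonoidAlgebra.lift ℂ A G u D)‖ ≤ ε / 2 := fun θ => by
    rw [← map_sub]
    exact (AlgHom.norm_apply_le_self θ _).trans hD.le
  have hφ : ‖φ (MonoidAlgebra.lift ℂ A G u D)‖ ≤ S + ε / 2 := by
    rw [hlift]
    refine MonoidAlgebra.norm_lift_le_of_forall_norm_lift_exp_le hω
      (fun t => (ev t : A →* ℂ).comp u) (fun t g => hev t g) _
      (fun g => (AlgHom.norm_apply_le_self φ _).trans (hu g)) D fun t => ?_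
    rw [← hlift]
    have := norm_le_norm_add_norm_sub (ev t x) (ev t (MonoidAlgebra.lift ℂ A G u D))
    linarith [h t, hclose (ev t)]
  have := norm_le_norm_add_norm_sub' (φ x) (φ (MonoidAlgebra.lift ℂ A G u D))
  linarith [hclose φ]

theorem exp_neg_log_mul_I_eq_cpow {r : ℝ} (hr : 0 < r) (n : ℕ+) (t : ℝ) :
    ((r ^ Real.log (n : ℕ) : ℝ) : ℂ) * Complex.exp (((-Real.log (n : ℕ) : ℝ) : ℂ) * t * Complex.I) =
      ((n : ℕ) : ℂ) ^ (-((-Real.log r : ℝ) + t * Complex.I : ℂ)) := by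
  rw [Real.rpow_def_of_pos hr, Complex.cpow_def_of_ne_zero (by simp), Complex.ofReal_exp,
    ← Complex.exp_add, ← Complex.natCast_log]
  push_cast
  ring_nf

theorem norm_rpow_log_smul_le {A : Type*} [SeminormedAddCommGroup A] [NormedSpace ℂ A] {x : A}
    (hx : ‖x‖ ≤ 1) (z : ℂ) {r : ℝ} (hr : r ∈ Set.Icc (0 : ℝ) 1) {m : ℕ} :
    ‖(z * ((r ^ Real.log m : ℝ) : ℂ)) • x‖ ≤ ‖z‖ := by
  rw [norm_smul, norm_mul, Complex.norm_real, Real.norm_eq_abs,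
    abs_of_nonneg (Real.rpow_nonneg hr.1 _), mul_assoc]
  exact mul_le_of_le_one_right (norm_nonneg _) (mul_le_one₀
    (Real.rpow_le_one hr.1 hr.2 (Real.log_natCast_nonneg m)) (norm_nonneg _) hx)

theorem continuous_tsum_rpow_log_smul {A : Type*} [NormedRing A] [NormedAlgebra ℂ A]
    [CompleteSpace A] (u : ℕ+ → A) (hu : ∀ m, ‖u m‖ ≤ 1) (a : ℕ+ → ℂ)
    (ha : Summable fun n => ‖a n‖) :
    Continuous fun r : unitInterval =>
      ∑' m : ℕ+, (a m * (((r : ℝ) ^ Real.log (m : ℕ) : ℝ) : ℂ)) • u m := by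
  refine continuous_tsum (fun m => ?_) ha fun m r => norm_rpow_log_smul_le (hu m) _ r.2
  refine Continuous.smul (continuous_const.mul (Complex.continuous_ofReal.comp ?_))
    continuous_const
  exact (Real.continuous_rpow_const (Real.log_natCast_nonneg _)).comp continuous_subtype_val

theorem isUnit_tsum_of_dirichlet_bounded_below {A : Type*} [NormedCommRing A] [NormOneClass A]
    [NormedAlgebra ℂ A] [CompleteSpace A] (u : ℕ+ →* A) (hu : ∀ m, ‖u m‖ ≤ 1)
    (hd : DenseRange (MonoidAlgebra.lift ℂ A ℕ+ u)) (ev : ℝ → A →ₐ[ℂ] ℂ)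
    (hev : ∀ t m, ev t (u m) =
      Complex.exp (((-Real.log (m : ℕ) : ℝ) : ℂ) * t * Complex.I))
    (a : ℕ+ → ℂ) (ha : Summable fun n => ‖a n‖) {C : ℝ} (hC0 : 0 < C)
    (hC : ∀ s : ℂ, 0 ≤ s.re → C ≤ ‖∑' n : ℕ+, a n * ((n : ℕ) : ℂ) ^ (-s)‖) :
    IsUnit (∑' m, a m • u m) := by
  set X : unitInterval → A := fun r =>
    ∑' m : ℕ+, (a m * (((r : ℝ) ^ Real.log (m : ℕ) : ℝ) : ℂ)) • u m with hX
  have hXc : Continuous X := continuous_tsum_rpow_log_smul u hu a ha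
  have hlog : Function.Injective fun m : ℕ+ => -Real.log (m : ℕ) := by
    intro m n hmn
    have := Real.log_injOn_pos (Set.mem_Ioi.2 (Nat.cast_pos.2 m.pos))
      (Set.mem_Ioi.2 (Nat.cast_pos.2 n.pos)) (neg_injective hmn)
    exact_mod_cast this
  have hcont : ∀ θ : A →ₐ[ℂ] ℂ, Continuous θ := fun θ => θ.toContinuousLinearMap.continuous
  have hsum : ∀ r : unitInterval, Summable fun m : ℕ+ =>
      (a m * (((r : ℝ) ^ Real.log (m : ℕ) : ℝ) : ℂ)) • u m := fun r =>
    Summable.of_norm_bounded ha fun m => norm_rpow_log_smul_le (hu m) _ r.2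
  have hlow_pos : ∀ r : unitInterval, 0 < (r : ℝ) → ∀ t, C ≤ ‖ev t (X r)‖ := by
    intro r hr t
    have h1 : ev t (X r) =
        ∑' n : ℕ+, a n * ((n : ℕ) : ℂ) ^ (-((-Real.log r : ℝ) + t * Complex.I : ℂ)) := by
      rw [hX]
      simp only
      rw [(hsum r).map_tsum (ev t) (hcont _)]
      refine tsum_congr fun m => ?_
      rw [map_smul, hev, smul_eq_mul, mul_assoc, exp_neg_log_mul_I_eq_cpow hr]
    rw [h1]
    refine hC _ ?_
    simpa using Real.log_nonpos r.2.1 r.2.2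
  have hlow : ∀ r : unitInterval, ∀ t, C ≤ ‖ev t (X r)‖ := by
    intro r t
    have hden : Dense (Set.Ioi (0 : unitInterval)) := fun x => by
      rw [closure_Ioi' ⟨1, zero_lt_one⟩]
      exact unitInterval.nonneg'
    have hcl : IsClosed {r : unitInterval | C ≤ ‖ev t (X r)‖} :=
      isClosed_le continuous_const ((hcont (ev t)).comp hXc).norm
    exact (hcl.closure_subset_iff.2 fun r hr => hlow_pos r hr t) (hden r)
  have hunit : ∀ r, IsUnit (X r) → ∀ φ : WeakDual.characterSpace ℂ A, C ≤ ‖φ (X r)‖ := by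
    rintro r ⟨v, hv⟩ φ
    have hinv : ∀ θ : A →ₐ[ℂ] ℂ, ‖θ (X r)‖ * ‖θ (v⁻¹ : Aˣ)‖ = 1 := fun θ => by
      rw [← norm_mul, ← map_mul, ← hv, v.mul_inv, map_one, norm_one]
    have hb := norm_algHom_le_of_forall_norm_exp_le u hu hd hlog ev hev
      (WeakDual.CharacterSpace.toAlgHom φ) (v⁻¹ : Aˣ) (S := 1 / C) fun t => by
        rw [le_div_iff₀ hC0, ← hinv (ev t), mul_comm]
        exact mul_le_mul_of_nonneg_right (hlow r t) (norm_nonneg _)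
    have h1 := hinv (WeakDual.CharacterSpace.toAlgHom φ)
    rw [le_div_iff₀ hC0, ← h1, mul_comm] at hb
    refine le_of_mul_le_mul_right hb (lt_of_le_of_ne (norm_nonneg _) fun h0 => ?_)
    rw [← h0, mul_zero] at h1
    exact zero_ne_one h1
  have hset : {r | IsUnit (X r)} =
      {r | ∀ φ : WeakDual.characterSpace ℂ A, C ≤ ‖φ (X r)‖} := by
    ext r
    refine ⟨hunit r, fun h => ?_⟩
    by_contra hn
    obtain ⟨φ, hφ⟩ := WeakDual.CharacterSpace.exists_apply_eq_zero hn
    have := h φ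
    rw [hφ, norm_zero] at this
    linarith
  have hclopen : IsClopen {r | IsUnit (X r)} := by
    refine ⟨?_, Units.isOpen.preimage hXc⟩
    rw [hset, Set.ofPred_forall]
    exact isClosed_iInter fun φ =>
      isClosed_le continuous_const ((map_continuous φ).comp hXc).norm
  have hX0 : X 0 = a 1 • (1 : A) := by
    rw [hX]
    simp only
    rw [tsum_eq_single 1]
    · simp
    · intro m hm
      have : Real.log (m : ℕ) ≠ 0 := by
        refine (Real.log_pos ?_).ne'
        exact_mod_cast lt_of_le_of_ne one_le hm.symm
      simp [Real.zero_rpow this]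
  have ha1 : a 1 ≠ 0 := by
    intro h0
    have := hlow 0 0
    rw [hX0, h0, zero_smul, map_zero, norm_zero] at this
    linarith
  have huniv := hclopen.eq_univ ⟨0, by
    rw [Set.mem_ofPred_eq, hX0, ← Algebra.algebraMap_eq_smul_one]
    exact (IsUnit.mk0 _ ha1).map (algebraMap ℂ A)⟩
  have h1 : IsUnit (X 1) := Set.eq_univ_iff_forall.1 huniv 1
  simpa [hX] using h1

open scoped BoundedContinuousFunction

/-- The shift `F ↦ (n ↦ F (n / m))`, extended by zero off the multiples of `m`, on bounded
arithmetic functions. -/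
noncomputable def dirichletShiftFun (m : ℕ+) (F : ℕ+ →ᵇ ℂ) : ℕ+ →ᵇ ℂ :=
  F.extend (mulLeftEmbedding m) 0

theorem dirichletShiftFun_apply_mul (m : ℕ+) (F : ℕ+ →ᵇ ℂ) (k : ℕ+) :
    dirichletShiftFun m F (m * k) = F k :=
  F.extend_apply (mulLeftEmbedding m) 0 k

theorem dirichletShiftFun_apply_of_not_dvd {m n : ℕ+} (h : ¬ m ∣ n) (F : ℕ+ →ᵇ ℂ) :
    dirichletShiftFun m F n = 0 :=
  BoundedContinuousFunction.extend_apply' (fun ⟨k, hk⟩ => h ⟨k, hk.symm⟩) F 0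

theorem dirichletShiftFun_mul (m n : ℕ+) (F : ℕ+ →ᵇ ℂ) :
    dirichletShiftFun (m * n) F = dirichletShiftFun m (dirichletShiftFun n F) := by
  ext x
  by_cases hx : m ∣ x
  · obtain ⟨y, rfl⟩ := hx
    rw [dirichletShiftFun_apply_mul]
    by_cases hy : n ∣ y
    · obtain ⟨z, rfl⟩ := hy
      rw [dirichletShiftFun_apply_mul, ← mul_assoc, dirichletShiftFun_apply_mul]
    · rw [dirichletShiftFun_apply_of_not_dvd hy, dirichletShiftFun_apply_of_not_dvd]
      rintro ⟨z, hz⟩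
      exact hy ⟨z, mul_left_cancel (hz.trans (mul_assoc m n z))⟩
  · rw [dirichletShiftFun_apply_of_not_dvd hx,
      dirichletShiftFun_apply_of_not_dvd fun h => hx ((dvd_mul_right m n).trans h)]

theorem norm_dirichletShiftFun_le (m : ℕ+) (F : ℕ+ →ᵇ ℂ) : ‖dirichletShiftFun m F‖ ≤ ‖F‖ := by
  rw [BoundedContinuousFunction.norm_le (norm_nonneg F)]
  intro x
  by_cases hx : m ∣ x
  · obtain ⟨y, rfl⟩ := hx
    rw [dirichletShiftFun_apply_mul]
    exact F.norm_coe_le_norm y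
  · simp [dirichletShiftFun_apply_of_not_dvd hx]

/-- The shifts `F ↦ (n ↦ F (n / m))` as contractions of the space of bounded arithmetic
functions. -/
noncomputable def dirichletShift : ℕ+ →* ((ℕ+ →ᵇ ℂ) →L[ℂ] (ℕ+ →ᵇ ℂ)) where
  toFun m := LinearMap.mkContinuous
    { toFun := dirichletShiftFun m
      map_add' := fun F G => by
        ext x
        by_cases hx : m ∣ x
        · obtain ⟨y, rfl⟩ := hx
          simp only [BoundedContinuousFunction.add_apply, dirichletShiftFun_apply_mul]
        · simp [dirichletShiftFun_apply_of_not_dvd hx]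
      map_smul' := fun c F => by
        ext x
        by_cases hx : m ∣ x
        · obtain ⟨y, rfl⟩ := hx
          simp only [BoundedContinuousFunction.smul_apply, dirichletShiftFun_apply_mul,
            RingHom.id_apply]
        · simp [dirichletShiftFun_apply_of_not_dvd hx] } 1 fun F => (norm_dirichletShiftFun_le m F).trans_eq (one_mul _).symm
  map_one' := by
    ext F x
    simpa using dirichletShiftFun_apply_mul 1 F x
  map_mul' m n := by
    ext F x
    simp [dirichletShiftFun_mul]

theorem dirichletShift_apply (m : ℕ+) (F : ℕ+ →ᵇ ℂ) :
    dirichletShift m F = dirichletShiftFun m F := rfl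

theorem norm_dirichletShift_le (m : ℕ+) : ‖dirichletShift m‖ ≤ 1 :=
  ContinuousLinearMap.opNorm_le_bound _ zero_le_one fun F =>
    (norm_dirichletShiftFun_le m F).trans_eq (one_mul _).symm

/-- The bounded function `t ↦ n ^ (-it)`. -/
noncomputable def imaginaryPower : ℕ+ →* (ℝ →ᵇ ℂ) where
  toFun n := BoundedContinuousFunction.ofNormedAddCommGroup
    (fun t : ℝ => Complex.exp (((-Real.log (n : ℕ) : ℝ) : ℂ) * t * Complex.I)) (by fun_prop) 1
    fun t => by rw [← Complex.ofReal_mul, Complex.norm_exp_ofReal_mul_I]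
  map_one' := by ext t; simp
  map_mul' m n := by
    ext t
    simp only [BoundedContinuousFunction.coe_ofNormedAddCommGroup,
      BoundedContinuousFunction.mul_apply]
    rw [← Complex.exp_add, PNat.mul_coe, Nat.cast_mul, Real.log_mul (by simp) (by simp)]
    push_cast
    ring_nf

theorem imaginaryPower_apply (n : ℕ+) (t : ℝ) : imaginaryPower n t =
    Complex.exp (((-Real.log (n : ℕ) : ℝ) : ℂ) * t * Complex.I) := rfl

theorem norm_imaginaryPower_le (n : ℕ+) : ‖imaginaryPower n‖ ≤ 1 :=
  (BoundedContinuousFunction.norm_le zero_le_one).2 fun t => by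
    rw [imaginaryPower_apply, ← Complex.ofReal_mul, Complex.norm_exp_ofReal_mul_I]

/-- The bounded operators that map null sequences to null sequences. -/
def nullPreserving : Subalgebra ℂ ((ℕ+ →ᵇ ℂ) →L[ℂ] (ℕ+ →ᵇ ℂ)) where
  carrier := {R | ∀ F : ℕ+ →ᵇ ℂ, Filter.Tendsto F Filter.cofinite (nhds 0) →
    Filter.Tendsto (R F) Filter.cofinite (nhds 0)}
  mul_mem' hR hQ F hF := hR _ (hQ F hF)
  add_mem' hR hQ F hF := by
    simpa [Pi.add_def] using (hR F hF).add (hQ F hF)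
  algebraMap_mem' c F hF := by
    simpa [Algebra.algebraMap_eq_smul_one] using hF.const_mul c

theorem isClosed_setOf_tendsto_zero :
    IsClosed {F : ℕ+ →ᵇ ℂ | Filter.Tendsto F Filter.cofinite (nhds 0)} := by
  refine isClosed_of_closure_subset fun F hF => ?_
  rw [Set.mem_ofPred_eq, Metric.tendsto_nhds]
  intro ε hε
  obtain ⟨G, hG, hFG⟩ := Metric.mem_closure_iff.1 hF (ε / 2) (half_pos hε)
  filter_upwards [Metric.tendsto_nhds.1 hG (ε / 2) (half_pos hε)] with n hn
  have h1 := (BoundedContinuousFunction.dist_coe_le_dist n).trans_lt hFG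
  linarith [dist_triangle (F n) (G n) 0]

theorem isClosed_nullPreserving : IsClosed (nullPreserving : Set ((ℕ+ →ᵇ ℂ) →L[ℂ] (ℕ+ →ᵇ ℂ))) := by
  have : (nullPreserving : Set ((ℕ+ →ᵇ ℂ) →L[ℂ] (ℕ+ →ᵇ ℂ))) =
      ⋂ (F : ℕ+ →ᵇ ℂ) (_ : Filter.Tendsto F Filter.cofinite (nhds 0)),
        (fun R => R F) ⁻¹' {F : ℕ+ →ᵇ ℂ | Filter.Tendsto F Filter.cofinite (nhds 0)} := by
    ext R
    simp only [Set.mem_iInter]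
    exact Iff.rfl
  rw [this]
  exact isClosed_biInter fun F _ => isClosed_setOf_tendsto_zero.preimage
    (ContinuousLinearMap.apply ℂ (ℕ+ →ᵇ ℂ) F).continuous

theorem dirichletShift_mem_nullPreserving (m : ℕ+) : dirichletShift m ∈ nullPreserving := by
  intro F hF
  rw [Metric.tendsto_nhds] at hF ⊢
  intro ε hε
  have h := (hF ε hε)
  rw [Filter.eventually_cofinite] at h ⊢
  refine (h.image fun k => m * k).subset fun n hn => ?_
  by_cases hmn : m ∣ n
  · obtain ⟨k, rfl⟩ := hmn
    rw [Set.mem_ofPred_eq, dirichletShift_apply, dirichletShiftFun_apply_mul] at hn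
    exact ⟨k, hn, rfl⟩
  · rw [Set.mem_ofPred_eq, dirichletShift_apply, dirichletShiftFun_apply_of_not_dvd hmn, dist_self] at hn
    exact (hn hε).elim

theorem exists_mem_topologicalClosure_mul_tsum_eq_one {B : Type*} [NormedRing B] [NormOneClass B]
    [NormedAlgebra ℂ B] [CompleteSpace B] (u : ℕ+ →* B) (hu : ∀ m, ‖u m‖ ≤ 1)
    (ev : ℝ → B →ₐ[ℂ] ℂ)
    (hev : ∀ t m, ev t (u m) =
      Complex.exp (((-Real.log (m : ℕ) : ℝ) : ℂ) * t * Complex.I))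
    (a : ℕ+ → ℂ) (ha : Summable fun n => ‖a n‖) {C : ℝ} (hC0 : 0 < C)
    (hC : ∀ s : ℂ, 0 ≤ s.re → C ≤ ‖∑' n : ℕ+, a n * ((n : ℕ) : ℂ) ^ (-s)‖) :
    ∃ w ∈ (MonoidAlgebra.lift ℂ B ℕ+ u).range.topologicalClosure, w * ∑' m, a m • u m = 1 := by
  let P := (MonoidAlgebra.lift ℂ B ℕ+ u).range
  have hPcomm : ∀ x y : P, x * y = y * x := by
    rintro ⟨_, x, rfl⟩ ⟨_, y, rfl⟩
    ext1
    change MonoidAlgebra.lift ℂ B ℕ+ u x * MonoidAlgebra.lift ℂ B ℕ+ u y =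
      MonoidAlgebra.lift ℂ B ℕ+ u y * MonoidAlgebra.lift ℂ B ℕ+ u x
    rw [← map_mul, mul_comm, map_mul]
  let _ : NormedCommRing P.topologicalClosure :=
    { (inferInstance : NormedRing P.topologicalClosure) with
      mul_comm := (P.commRingTopologicalClosure hPcomm).mul_comm }
  have _ : NormOneClass P.topologicalClosure := ⟨(norm_one : ‖(1 : B)‖ = 1)⟩
  have _ : CompleteSpace P.topologicalClosure :=
    P.isClosed_topologicalClosure.completeSpace_coe
  let v : ℕ+ →* P.topologicalClosure :=
    u.codRestrict P.topologicalClosure fun m =>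
      P.le_topologicalClosure ⟨MonoidAlgebra.of ℂ ℕ+ m, by simp⟩
  have hvlift : ∀ x, ((MonoidAlgebra.lift ℂ P.topologicalClosure ℕ+ v x : P.topologicalClosure) :
      B) = MonoidAlgebra.lift ℂ B ℕ+ u x := fun x => by
    change P.topologicalClosure.val _ = _
    simp [MonoidAlgebra.lift_apply, Finsupp.sum, v]
  have hdense : DenseRange (MonoidAlgebra.lift ℂ P.topologicalClosure ℕ+ v) := by
    rw [Metric.denseRange_iff]
    rintro ⟨x, hx⟩ ε hε
    obtain ⟨_, ⟨y, rfl⟩, hxy⟩ := Metric.mem_closure_iff.1 hx ε hε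
    refine ⟨y, ?_⟩
    rw [Subtype.dist_eq, hvlift]
    exact hxy
  obtain ⟨w, hw⟩ := isUnit_tsum_of_dirichlet_bounded_below v hu hdense
    (fun t => (ev t).comp P.topologicalClosure.val) hev a ha hC0 hC
  have hsum : Summable fun m => a m • v m := Summable.of_norm_bounded ha fun m => by
    rw [norm_smul]
    exact mul_le_of_le_one_right (norm_nonneg _) (hu m)
  refine ⟨((w⁻¹ : _ˣ) : P.topologicalClosure), Subtype.prop _, ?_⟩
  have h1 : P.topologicalClosure.val (∑' m, a m • v m) = ∑' m, a m • u m :=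
    hsum.map_tsum P.topologicalClosure.val continuous_subtype_val
  rw [← h1, ← hw]
  exact congrArg Subtype.val w.inv_mul

theorem exists_nullPreserving_leftInverse (a : ℕ+ → ℂ) (ha : Summable fun n => ‖a n‖) {C : ℝ}
    (hC0 : 0 < C)
    (hC : ∀ s : ℂ, 0 ≤ s.re → C ≤ ‖∑' n : ℕ+, a n * ((n : ℕ) : ℂ) ^ (-s)‖) :
    ∃ R ∈ nullPreserving, R * ∑' m, a m • dirichletShift m = 1 := by
  have _ : Nontrivial (ℕ+ →ᵇ ℂ) := ⟨0, 1, fun h => zero_ne_one (DFunLike.congr_fun h 1)⟩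
  have hu : ∀ m, ‖dirichletShift.prod imaginaryPower m‖ ≤ 1 := fun m =>
    max_le (norm_dirichletShift_le m) (norm_imaginaryPower_le m)
  let ev : ℝ → ((ℕ+ →ᵇ ℂ) →L[ℂ] (ℕ+ →ᵇ ℂ)) × (ℝ →ᵇ ℂ) →ₐ[ℂ] ℂ := fun t =>
    { toFun := fun x => x.2 t
      map_one' := rfl
      map_mul' := fun _ _ => rfl
      map_zero' := rfl
      map_add' := fun _ _ => rfl
      commutes' := fun c => by simp [Algebra.algebraMap_eq_smul_one] }
  have hev : ∀ t m, ev t (dirichletShift.prod imaginaryPower m) =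
      Complex.exp (((-Real.log (m : ℕ) : ℝ) : ℂ) * t * Complex.I) :=
    fun t m => imaginaryPower_apply m t
  obtain ⟨w, hw, hw1⟩ := exists_mem_topologicalClosure_mul_tsum_eq_one
    (B := ((ℕ+ →ᵇ ℂ) →L[ℂ] (ℕ+ →ᵇ ℂ)) × (ℝ →ᵇ ℂ))
    (dirichletShift.prod imaginaryPower) hu ev hev a ha hC0 hC
  have hsum : Summable fun m => a m • dirichletShift.prod imaginaryPower m :=
    Summable.of_norm_bounded ha fun m => by
      rw [norm_smul]
      exact mul_le_of_le_one_right (norm_nonneg _) (hu m)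
  have hle : (MonoidAlgebra.lift ℂ _ ℕ+ (dirichletShift.prod imaginaryPower)).range ≤
      nullPreserving.comap (AlgHom.fst ℂ _ (ℝ →ᵇ ℂ)) := by
    rintro _ ⟨D, rfl⟩
    change MonoidAlgebra.lift ℂ _ ℕ+ (dirichletShift.prod imaginaryPower) D ∈ _
    rw [MonoidAlgebra.lift_apply, Finsupp.sum]
    exact sum_mem fun m _ => Subalgebra.smul_mem _ (dirichletShift_mem_nullPreserving m) _
  refine ⟨w.1, Subalgebra.topologicalClosure_minimal hle
    (isClosed_nullPreserving.preimage continuous_fst) hw, ?_⟩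
  have h1 := (hsum.map_tsum (AlgHom.fst ℂ ((ℕ+ →ᵇ ℂ) →L[ℂ] (ℕ+ →ᵇ ℂ)) (ℝ →ᵇ ℂ)) continuous_fst)
  exact (congrArg (w.1 * ·) h1).symm.trans (congrArg Prod.fst hw1)

theorem tsum_smul_dirichletShift_apply (a : ℕ+ → ℂ) (ha : Summable fun n => ‖a n‖)
    (F : ℕ+ →ᵇ ℂ) (n : ℕ+) :
    (∑' m, a m • dirichletShift m) F n = ∑' m, a m * dirichletShiftFun m F n := by
  have hsum : Summable fun m => a m • dirichletShift m := Summable.of_norm_bounded ha fun m => by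
    rw [norm_smul]
    exact mul_le_of_le_one_right (norm_nonneg _) (norm_dirichletShift_le m)
  let L : ((ℕ+ →ᵇ ℂ) →L[ℂ] (ℕ+ →ᵇ ℂ)) →L[ℂ] ℂ :=
    (BoundedContinuousFunction.evalCLM ℂ n).comp (ContinuousLinearMap.apply ℂ (ℕ+ →ᵇ ℂ) F)
  exact L.map_tsum hsum

theorem tsum_mul_dirichletShiftFun_eq_sum_divisors (a F : ℕ → ℂ) (Fb : ℕ+ →ᵇ ℂ)
    (hF : ∀ n : ℕ+, Fb n = F n) (n : ℕ+) :
    ∑' m : ℕ+, a m * dirichletShiftFun m Fb n = ∑ d ∈ (n : ℕ).divisors, F d * a (n / d) := by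
  rw [← Nat.sum_div_divisors]
  let s : Finset ℕ+ := (n : ℕ).divisors.subtype (0 < ·)
  have hs : ∀ m : ℕ+, m ∈ s ↔ m ∣ n := fun m => by
    rw [PNat.dvd_iff]
    exact Finset.mem_subtype.trans (Nat.mem_divisors.trans (and_iff_left n.ne_zero))
  rw [tsum_eq_sum (s := s) fun m hm => by
    rw [dirichletShiftFun_apply_of_not_dvd fun h => hm ((hs m).2 h), mul_zero]]
  refine Eq.trans (Finset.sum_congr rfl fun m hm => ?_)
    (Finset.sum_subtype_of_mem _ fun x hx => Nat.pos_of_mem_divisors hx)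
  obtain ⟨j, rfl⟩ := (hs m).1 hm
  change _ = F ((m * j : ℕ+) / (m : ℕ)) * a ((m * j : ℕ+) / ((m * j : ℕ+) / (m : ℕ)))
  rw [dirichletShiftFun_apply_mul, hF, PNat.mul_coe, Nat.mul_div_cancel_left _ m.pos,
    Nat.mul_div_cancel _ j.pos, mul_comm]

/-- Tauberian theorem for the Dirichlet convolution: if the Dirichlet series
`Σ k(n)ρ(n)n^{−s}` is bounded below in modulus on the closed right half-plane and
`(Σ_{d∣n} f(d)k(n/d))·ρ(n) → 0`, then `f(n)·ρ(n) → 0`. -/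
theorem tauberian_dirichlet (ρ : ℕ → ℝ) (f k : ℕ → ℂ)
    (hρ_pos : ∀ n, 1 ≤ n → 0 < ρ n) (hρ1 : ρ 1 = 1)
    (hρ_mul : ∀ m n, 1 ≤ m → 1 ≤ n → ρ (m * n) = ρ m * ρ n)
    (hf : ∃ C, ∀ n, 1 ≤ n → ‖f n‖ * ρ n ≤ C)
    (hk : Summable fun n : ℕ+ => ‖k (n : ℕ)‖ * ρ (n : ℕ))
    (hC : ∃ C > 0, ∀ s : ℂ, 0 ≤ s.re →
      C ≤ ‖∑' n : ℕ+, k (n : ℕ) * (ρ (n : ℕ) : ℂ) * ((n : ℕ) : ℂ) ^ (-s)‖)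
    (h0 : Filter.Tendsto
      (fun n : ℕ => (∑ d ∈ n.divisors, f d * k (n / d)) * (ρ n : ℂ))
      Filter.atTop (nhds 0)) :
    Filter.Tendsto (fun n : ℕ => f n * (ρ n : ℂ)) Filter.atTop (nhds 0) := by
  obtain ⟨M, hM⟩ := hf
  obtain ⟨C, hC0, hC⟩ := hC
  have hnorm : ∀ (z : ℂ) (n : ℕ+), ‖z * (ρ n : ℂ)‖ = ‖z‖ * ρ n := fun z n => by
    rw [norm_mul, Complex.norm_real, Real.norm_of_nonneg (hρ_pos n n.pos).le]
  have ha : Summable fun n : ℕ+ => ‖k n * (ρ n : ℂ)‖ := by simpa only [hnorm] using hk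
  obtain ⟨R, hR, hR1⟩ :=
    exists_nullPreserving_leftInverse (fun n : ℕ+ => k n * (ρ n : ℂ)) ha hC0 hC
  let F : ℕ+ →ᵇ ℂ := BoundedContinuousFunction.ofNormedAddCommGroupDiscrete
    (fun n => f n * (ρ n : ℂ)) M fun n => (hnorm _ n).trans_le (hM n n.pos)
  have hconv : ∀ n : ℕ+, (∑' m : ℕ+, (k m * (ρ m : ℂ)) • dirichletShift m) F n =
      (∑ d ∈ (n : ℕ).divisors, f d * k (n / d)) * (ρ n : ℂ) := by
    intro n
    rw [tsum_smul_dirichletShift_apply (fun m : ℕ+ => k m * (ρ m : ℂ)) ha,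
      tsum_mul_dirichletShiftFun_eq_sum_divisors (fun m => k m * (ρ m : ℂ))
        (fun m => f m * (ρ m : ℂ)) F fun _ => rfl, Finset.sum_mul]
    refine Finset.sum_congr rfl fun d hd => ?_
    have hdvd := Nat.dvd_of_mem_divisors hd
    have hd0 := Nat.pos_of_mem_divisors hd
    have h1 : ρ n = ρ d * ρ (n / d) := by
      rw [← hρ_mul d _ hd0 (Nat.div_pos (Nat.le_of_dvd n.pos hdvd) hd0), Nat.mul_div_cancel' hdvd]
    rw [h1]
    push_cast
    ring
  have hcof : Filter.Tendsto ((↑) : ℕ+ → ℕ) Filter.cofinite Filter.atTop := by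
    rw [← Nat.cofinite_eq_atTop]
    exact PNat.coe_injective.tendsto_cofinite
  have hnull := hR ((∑' m : ℕ+, (k m * (ρ m : ℂ)) • dirichletShift m) F)
    ((h0.comp hcof).congr fun n => (hconv n).symm)
  have hRF : R ((∑' m : ℕ+, (k m * (ρ m : ℂ)) • dirichletShift m) F) = F :=
    DFunLike.congr_fun hR1 F
  rw [hRF] at hnull
  rw [← PNat.tendsto_comp_val_iff]
  exact hnull.mono_left Filter.atTop_le_cofinite
end

section
/- Let ρ : ℕ₊ → (0,∞) be a positive completely multiplicative function on the positive integers (ρ(mn) = ρ(m)ρ(n), ρ(1) = 1), and let k : ℕ₊ → ℂ with Σ_{n=1}^∞ |k(n)| ρ(n) < ∞. Assume there is a constant C > 0 such that |Σ_{n=1}^∞ k(n) ρ(n) n^{−s}| ≥ C for every s ∈ ℂ with Re s ≥ 0. Then for every completely multiplicative function ψ : ℕ₊ → ℂ (ψ(mn) = ψ(m)ψ(n), ψ(1) = 1) satisfying |ψ(n)| ≤ ρ(n) for all n, one has Σ_{n=1}^∞ k(n)·conj(ψ(n)) ≠ 0. -/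
open Filter Topology Finset

theorem norm_exp_ofReal_mul_I_mul_ofReal (x t : ℝ) :
    ‖Complex.exp (x * Complex.I * t)‖ = 1 := by
  rw [mul_right_comm, ← Complex.ofReal_mul, Complex.norm_exp_ofReal_mul_I]

/-- A zero-frequency coefficient of a trigonometric sum is bounded by the sup norm of the sum. -/
theorem norm_sum_zeroFreq_le {α : Type*} (s : Finset α) (d : α → ℂ) (l : α → ℝ) {B : ℝ}
    (hB : ∀ t : ℝ, ‖∑ a ∈ s, d a * Complex.exp (l a * Complex.I * t)‖ ≤ B) :
    ‖∑ a ∈ s with l a = 0, d a‖ ≤ B := by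
  have key : ∀ a, Tendsto (fun T : ℝ => (T : ℂ)⁻¹ *
      ∫ t in (0 : ℝ)..T, Complex.exp (l a * Complex.I * t)) atTop
      (𝓝 (if l a = 0 then 1 else 0)) := by
    intro a
    split_ifs with h
    · refine tendsto_const_nhds.congr' ?_
      filter_upwards [eventually_gt_atTop 0] with T hT
      have : (T : ℂ) ≠ 0 := by exact_mod_cast hT.ne'
      simp [h, this]
    · have hl : (l a : ℂ) * Complex.I ≠ 0 := by simp [h]
      have hb : ∀ T : ℝ, ‖∫ t in (0 : ℝ)..T, Complex.exp (l a * Complex.I * t)‖ ≤ 2 / |l a| := by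
        intro T
        rw [integral_exp_mul_complex hl, norm_div]
        have h1 := norm_exp_ofReal_mul_I_mul_ofReal (l a) T
        have h2 : ‖(l a : ℂ) * Complex.I‖ = |l a| := by simp
        rw [h2]
        gcongr
        refine (norm_sub_le _ _).trans ?_
        rw [h1]
        norm_num
      refine squeeze_zero_norm (a := fun T : ℝ => |T⁻¹| * (2 / |l a|)) ?_ ?_
      · intro T
        rw [norm_mul, norm_inv, Complex.norm_real, Real.norm_eq_abs, abs_inv]
        exact mul_le_mul_of_nonneg_left (hb T) (by positivity)
      · simpa using (tendsto_inv_atTop_zero.abs).mul_const (2 / |l a|)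
  have hlim : Tendsto (fun T : ℝ => (T : ℂ)⁻¹ *
      ∫ t in (0 : ℝ)..T, ∑ a ∈ s, d a * Complex.exp (l a * Complex.I * t)) atTop
      (𝓝 (∑ a ∈ s with l a = 0, d a)) := by
    have h1 : Tendsto (fun T : ℝ => ∑ a ∈ s, d a * ((T : ℂ)⁻¹ *
        ∫ t in (0 : ℝ)..T, Complex.exp (l a * Complex.I * t))) atTop
        (𝓝 (∑ a ∈ s, d a * (if l a = 0 then 1 else 0))) :=
      tendsto_finsetSum _ fun a _ => (key a).const_mul _
    have h2 : ∑ a ∈ s, d a * (if l a = 0 then 1 else 0) = ∑ a ∈ s with l a = 0, d a := by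
      simp [Finset.sum_filter]
    rw [← h2]
    refine h1.congr fun T => ?_
    rw [intervalIntegral.integral_finsetSum, Finset.mul_sum]
    · refine Finset.sum_congr rfl fun a _ => ?_
      rw [intervalIntegral.integral_const_mul]
      ring
    · intro a _
      exact Continuous.intervalIntegrable (by fun_prop) _ _
  refine le_of_tendsto hlim.norm ?_
  filter_upwards [eventually_gt_atTop 0] with T hT
  rw [norm_mul, norm_inv, Complex.norm_real, Real.norm_eq_abs, abs_of_pos hT]
  have := intervalIntegral.norm_integral_le_of_norm_le_const (a := 0) (b := T) (C := B)
    (f := fun t : ℝ => ∑ a ∈ s, d a * Complex.exp (l a * Complex.I * t)) (fun t _ => hB t)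
  rw [sub_zero, abs_of_pos hT] at this
  rw [inv_mul_le_iff₀ hT]
  linarith

/-- The sums of `K` frequencies take at most polynomially many values in `K`. -/
theorem card_image_sum_comp_le {ι : Type*} [Fintype ι] (θ : ι → ℝ) (K : ℕ) :
    #(univ.image fun f : Fin K → ι => ∑ k, θ (f k)) ≤ (K + 1) ^ Fintype.card ι := by
  classical
  calc #(univ.image fun f : Fin K → ι => ∑ k, θ (f k))
      ≤ #(univ.image fun e : ι → Fin (K + 1) => ∑ i, (e i : ℕ) • θ i) := by
        refine card_le_card fun v hv => ?_
        obtain ⟨f, -, rfl⟩ := mem_image.1 hv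
        refine mem_image.2 ⟨fun i => ⟨#{k | f k = i}, ?_⟩, mem_univ _, ?_⟩
        · exact Nat.lt_succ_of_le ((card_filter_le _ _).trans (by simp))
        · rw [← Finset.sum_fiberwise univ f]
          refine Finset.sum_congr rfl fun i _ => ?_
          rw [Finset.sum_congr rfl (g := fun _ => θ i)]
          · simp
          · intro k hk
            rw [(mem_filter.1 hk).2]
    _ ≤ Fintype.card (ι → Fin (K + 1)) := card_image_le
    _ = (K + 1) ^ Fintype.card ι := by simp

/-- If the phases `u` respect the additive relations among the frequencies `θ`, the sup norm of
`∑ conj (u i) exp (i θ t)` is the trivial bound. -/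
theorem card_le_of_norm_trigSum_le {ι : Type*} [Fintype ι] (θ : ι → ℝ) (u : ι → ℂ)
    (hu : ∀ i, ‖u i‖ = 1)
    (hrel : ∀ (K : ℕ) (f g : Fin K → ι), ∑ k, θ (f k) = ∑ k, θ (g k) →
      ∏ k, u (f k) = ∏ k, u (g k)) {M : ℝ} (hM0 : 0 ≤ M)
    (hM : ∀ t : ℝ, ‖∑ i, (starRingEnd ℂ) (u i) * Complex.exp (θ i * Complex.I * t)‖ ≤ M) :
    (Fintype.card ι : ℝ) ≤ M := by
  classical
  set N := Fintype.card ι with hN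
  have key : ∀ K : ℕ, (N : ℝ) ^ K ≤ ((K : ℝ) + 1) ^ N * M ^ K := by
    intro K
    have hfib : ∀ f₀ : Fin K → ι,
        (#{f : Fin K → ι | ∑ k, θ (f k) = ∑ k, θ (f₀ k)} : ℝ) ≤ M ^ K := by
      intro f₀
      have h := norm_sum_zeroFreq_le (univ : Finset (Fin K → ι))
        (fun f => ∏ k, (starRingEnd ℂ) (u (f k)))
        (fun f => ∑ k, θ (f k) - ∑ k, θ (f₀ k)) (B := M ^ K) (fun t => by
          have : ∑ f : Fin K → ι, (∏ k, (starRingEnd ℂ) (u (f k))) *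
              Complex.exp (((∑ k, θ (f k) - ∑ k, θ (f₀ k) : ℝ) : ℂ) * Complex.I * t) =
              (∑ i, (starRingEnd ℂ) (u i) * Complex.exp (θ i * Complex.I * t)) ^ K *
              Complex.exp ((-(∑ k, θ (f₀ k)) * t : ℝ) * Complex.I) := by
            rw [Fintype.sum_pow, Finset.sum_mul]
            refine Finset.sum_congr rfl fun f _ => ?_
            rw [Finset.prod_mul_distrib, ← Complex.exp_sum,
              mul_assoc (∏ k, (starRingEnd ℂ) (u (f k))),
              ← Complex.exp_add]
            congr 2
            push_cast
            rw [← Finset.sum_mul, ← Finset.sum_mul]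
            ring
          rw [this, norm_mul, Complex.norm_exp_ofReal_mul_I, mul_one, norm_pow]
          exact pow_le_pow_left₀ (norm_nonneg _) (hM t) K)
      have hsum : ∑ f : Fin K → ι with ∑ k, θ (f k) - ∑ k, θ (f₀ k) = 0,
          ∏ k, (starRingEnd ℂ) (u (f k)) =
          #{f : Fin K → ι | ∑ k, θ (f k) = ∑ k, θ (f₀ k)} *
            ∏ k, (starRingEnd ℂ) (u (f₀ k)) := by
        simp_rw [sub_eq_zero]
        rw [Finset.sum_congr rfl (g := fun _ => ∏ k, (starRingEnd ℂ) (u (f₀ k)))]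
        · simp
        · intro f hf
          rw [← map_prod, ← map_prod, hrel K f f₀ (mem_filter.1 hf).2]
      rw [hsum, norm_mul, norm_prod] at h
      simpa [hu] using h
    have hcard : N ^ K = ∑ v ∈ univ.image (fun f : Fin K → ι => ∑ k, θ (f k)),
        #{f : Fin K → ι | ∑ k, θ (f k) = v} := by
      rw [← Finset.card_eq_sum_card_image]
      simp [hN]
    calc (N : ℝ) ^ K = ∑ v ∈ univ.image (fun f : Fin K → ι => ∑ k, θ (f k)),
          (#{f : Fin K → ι | ∑ k, θ (f k) = v} : ℝ) := by exact_mod_cast hcard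
      _ ≤ ∑ v ∈ univ.image (fun f : Fin K → ι => ∑ k, θ (f k)), M ^ K := by
          refine Finset.sum_le_sum fun v hv => ?_
          obtain ⟨f₀, -, rfl⟩ := mem_image.1 hv
          exact hfib f₀
      _ = (#(univ.image fun f : Fin K → ι => ∑ k, θ (f k)) : ℝ) * M ^ K := by simp
      _ ≤ ((K : ℝ) + 1) ^ N * M ^ K := by
          gcongr
          exact_mod_cast card_image_sum_comp_le θ K
  by_contra! hlt
  have hNpos : (0 : ℝ) < N := hM0.trans_lt hlt
  have hr : |M / N| < 1 := by
    rw [abs_of_nonneg (by positivity), div_lt_one hNpos]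
    exact hlt
  have hlim : Tendsto (fun K : ℕ => (2 : ℝ) ^ N * ((K : ℝ) ^ N * (M / N) ^ K)) atTop (𝓝 0) := by
    simpa using (tendsto_pow_const_mul_const_pow_of_abs_lt_one N hr).const_mul ((2 : ℝ) ^ N)
  obtain ⟨K, hK, hK1⟩ := ((hlim.eventually_lt_const one_pos).and (eventually_ge_atTop 1)).exists
  have h1 := key K
  have hK1' : (1 : ℝ) ≤ K := by exact_mod_cast hK1
  have h2 : ((K : ℝ) + 1) ^ N ≤ 2 ^ N * (K : ℝ) ^ N := by
    rw [← mul_pow]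
    gcongr
    linarith
  rw [div_pow, ← mul_assoc, ← mul_div_assoc, div_lt_one (by positivity)] at hK
  have h3 : ((K : ℝ) + 1) ^ N * M ^ K ≤ 2 ^ N * (K : ℝ) ^ N * M ^ K := by gcongr
  linarith

/-- **Kronecker's approximation theorem**: phases respecting the additive relations among the
frequencies are simultaneously approximated by `exp (i θ t)`. -/
theorem exists_forall_norm_exp_sub_lt {ι : Type*} [Fintype ι] (θ : ι → ℝ) (u : ι → ℂ)
    (hu : ∀ i, ‖u i‖ = 1)
    (hrel : ∀ (K : ℕ) (f g : Fin K → ι), ∑ k, θ (f k) = ∑ k, θ (g k) →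
      ∏ k, u (f k) = ∏ k, u (g k)) (i₀ : ι) (hθ₀ : θ i₀ = 0) (hu₀ : u i₀ = 1)
    {ε : ℝ} (hε : 0 < ε) :
    ∃ t : ℝ, ∀ i, ‖Complex.exp (θ i * Complex.I * t) - u i‖ < ε := by
  classical
  by_contra! hfar
  set c : ℝ := Real.sqrt (4 - ε ^ 2) with hc
  have hc2 : c < 2 := by
    rw [hc, Real.sqrt_lt' two_pos]
    nlinarith
  have hne : ∀ t : ℝ, ∀ i, ε ≤ ‖Complex.exp (θ i * Complex.I * t) - u i‖ → i ≠ i₀ := by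
    rintro t i hi rfl
    simp [hθ₀, hu₀] at hi
    linarith
  have hcard : (2 : ℝ) ≤ Fintype.card ι := by
    obtain ⟨i, hi⟩ := hfar 0
    have : Nontrivial ι := ⟨i, i₀, hne 0 i hi⟩
    exact_mod_cast Fintype.one_lt_card (α := ι)
  have hbound : ∀ t : ℝ, ‖∑ i, (starRingEnd ℂ) (u i) * Complex.exp (θ i * Complex.I * t)‖ ≤
      Fintype.card ι - 2 + c := by
    intro t
    obtain ⟨i, hi⟩ := hfar t
    have hii := hne t i hi
    set w : ι → ℂ := fun i => (starRingEnd ℂ) (u i) * Complex.exp (θ i * Complex.I * t) with hw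
    have hexp := fun j => norm_exp_ofReal_mul_I_mul_ofReal (θ j) t
    have hw1 : ∀ j, ‖w j‖ = 1 := fun j => by simp [hw, hu, hexp]
    have hw0 : w i₀ = 1 := by simp [hw, hθ₀, hu₀]
    have hwi : ‖w i - 1‖ = ‖Complex.exp (θ i * Complex.I * t) - u i‖ := by
      have : w i - 1 = (starRingEnd ℂ) (u i) * (Complex.exp (θ i * Complex.I * t) - u i) := by
        rw [mul_sub, Complex.conj_mul', hu]
        simp [hw]
      rw [this, norm_mul, Complex.norm_conj, hu, one_mul]
    have hpair : ‖w i + w i₀‖ ≤ c := by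
      rw [hw0]
      refine Real.le_sqrt_of_sq_le ?_
      have := parallelogram_law_with_norm ℝ (w i) 1
      rw [hw1 i, norm_one] at this
      have h2 : ε ^ 2 ≤ ‖w i - 1‖ ^ 2 := by
        rw [hwi]
        gcongr
      nlinarith
    have hsplit : ∑ j, w j = (w i + w i₀) + ∑ j ∈ univ \ {i, i₀}, w j := by
      rw [← Finset.sum_sdiff (Finset.subset_univ {i, i₀}), Finset.sum_pair hii, add_comm]
    rw [hsplit]
    refine (norm_add_le _ _).trans ?_
    have hrest : ‖∑ j ∈ univ \ {i, i₀}, w j‖ ≤ Fintype.card ι - 2 := by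
      refine (norm_sum_le _ _).trans ?_
      have h3 := Finset.card_sdiff_add_card_eq_card (Finset.subset_univ {i, i₀})
      rw [Finset.card_pair hii, Finset.card_univ] at h3
      have h4 : (#(univ \ {i, i₀}) : ℝ) + 2 = Fintype.card ι := by exact_mod_cast h3
      simp only [hw1, Finset.sum_const, nsmul_eq_mul, mul_one]
      linarith
    linarith
  have := card_le_of_norm_trigSum_le θ u hu hrel
    (add_nonneg (by linarith) (Real.sqrt_nonneg _)) hbound
  linarith

/-- The completely multiplicative function agreeing with `χ` away from `p` and with value `z`
at the prime `p`. -/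
noncomputable def replaceAt (χ : ℕ →*₀ ℂ) (p : ℕ) (z : ℂ) : ℕ →*₀ ℂ where
  toFun n := χ (n / p ^ n.factorization p) * z ^ n.factorization p
  map_zero' := by simp
  map_one' := by simp
  map_mul' m n := by
    rcases eq_or_ne m 0 with rfl | hm
    · simp
    rcases eq_or_ne n 0 with rfl | hn
    · simp
    rw [Nat.ordCompl_mul, map_mul, Nat.factorization_mul hm hn, Finsupp.add_apply, pow_add]
    ring

theorem replaceAt_apply (χ : ℕ →*₀ ℂ) (p : ℕ) (z : ℂ) (n : ℕ) :
    replaceAt χ p z n = χ (n / p ^ n.factorization p) * z ^ n.factorization p := rfl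

theorem replaceAt_self (χ : ℕ →*₀ ℂ) (p : ℕ) : replaceAt χ p (χ p) = χ := by
  ext n
  rw [replaceAt_apply, ← map_pow, ← map_mul, mul_comm, Nat.ordProj_mul_ordCompl_eq_self]

theorem replaceAt_prime (χ : ℕ →*₀ ℂ) {p : ℕ} (hp : p.Prime) (z : ℂ) :
    replaceAt χ p z p = z := by
  simp [replaceAt_apply, hp.factorization_self, Nat.div_self hp.pos]

theorem replaceAt_prime_of_ne (χ : ℕ →*₀ ℂ) {p q : ℕ} (hq : q.Prime) (h : q ≠ p) (z : ℂ) :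
    replaceAt χ p z q = χ q := by
  have : q.factorization p = 0 := by
    rw [hq.factorization, Finsupp.single_eq_of_ne h.symm]
  simp [replaceAt_apply, this]

theorem norm_replaceAt_le {χ : ℕ →*₀ ℂ} (hχ : ∀ n, ‖χ n‖ ≤ 1) (p : ℕ) {z : ℂ} (hz : ‖z‖ ≤ 1)
    (n : ℕ) : ‖replaceAt χ p z n‖ ≤ 1 := by
  rw [replaceAt_apply, norm_mul, norm_pow]
  exact mul_le_one₀ (hχ _) (by positivity) (pow_le_one₀ (norm_nonneg _) hz)

theorem norm_mul_le_of_norm_le_one (a : ℕ → ℂ) {n : ℕ} {w : ℂ} (hw : ‖w‖ ≤ 1) :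
    ‖a n * w‖ ≤ ‖a n‖ := by
  rw [norm_mul]
  exact mul_le_of_le_one_right (norm_nonneg _) hw

theorem diffContOnCl_tsum_replaceAt {a : ℕ → ℂ} (ha : Summable fun n => ‖a n‖)
    {χ : ℕ →*₀ ℂ} (hχ : ∀ n, ‖χ n‖ ≤ 1) (p : ℕ) :
    DiffContOnCl ℂ (fun z => ∑' n, a n * replaceAt χ p z n) (Metric.ball 0 1) := by
  have hbound : ∀ n, ∀ z ∈ Metric.closedBall (0 : ℂ) 1, ‖a n * replaceAt χ p z n‖ ≤ ‖a n‖ :=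
    fun n z hz => norm_mul_le_of_norm_le_one a
      (norm_replaceAt_le hχ p (mem_closedBall_zero_iff.1 hz) n)
  constructor
  · refine Complex.differentiableOn_tsum_of_summable_norm ha (fun n => ?_) Metric.isOpen_ball
      (fun n z hz => hbound n z (Metric.ball_subset_closedBall hz))
    simp only [replaceAt_apply]
    fun_prop
  · rw [closure_ball _ one_ne_zero]
    refine continuousOn_tsum (fun n => ?_) ha hbound
    simp only [replaceAt_apply]
    fun_prop

/-- Maximum modulus in one prime variable. -/
theorem exists_norm_prime_eq_one {a : ℕ → ℂ} (ha : Summable fun n => ‖a n‖)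
    (hne : ∀ χ : ℕ →*₀ ℂ, (∀ n, ‖χ n‖ ≤ 1) → ∑' n, a n * χ n ≠ 0)
    {χ : ℕ →*₀ ℂ} (hχ : ∀ n, ‖χ n‖ ≤ 1) {p : ℕ} (hp : p.Prime) :
    ∃ χ' : ℕ →*₀ ℂ, (∀ n, ‖χ' n‖ ≤ 1) ∧ ‖χ' p‖ = 1 ∧
      (∀ q, q.Prime → q ≠ p → χ' q = χ q) ∧ ‖∑' n, a n * χ' n‖ ≤ ‖∑' n, a n * χ n‖ := by
  have hcl : closure (Metric.ball (0 : ℂ) 1) = Metric.closedBall 0 1 :=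
    closure_ball _ one_ne_zero
  have hne' : ∀ z ∈ closure (Metric.ball (0 : ℂ) 1), ∑' n, a n * replaceAt χ p z n ≠ 0 := by
    intro z hz
    rw [hcl, mem_closedBall_zero_iff] at hz
    exact hne _ (norm_replaceAt_le hχ p hz)
  obtain ⟨z, hz, hmax⟩ := Complex.exists_mem_frontier_isMaxOn_norm Metric.isBounded_ball
    ⟨0, Metric.mem_ball_self one_pos⟩ ((diffContOnCl_tsum_replaceAt ha hχ p).inv hne')
  rw [frontier_ball _ one_ne_zero, mem_sphere_zero_iff_norm] at hz
  refine ⟨replaceAt χ p z, norm_replaceAt_le hχ p hz.le, ?_,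
    fun q hq hqp => replaceAt_prime_of_ne χ hq hqp z, ?_⟩
  · rw [replaceAt_prime χ hp, hz]
  · have hχp : χ p ∈ closure (Metric.ball (0 : ℂ) 1) := by
      rw [hcl, mem_closedBall_zero_iff]
      exact hχ p
    have h := hmax hχp
    simp only [Set.mem_ofPred_eq, Function.comp_apply, Pi.inv_apply, norm_inv,
      replaceAt_self] at h
    exact (inv_le_inv₀ (norm_pos_iff.2 (hne χ hχ)) (norm_pos_iff.2
      (hne _ (norm_replaceAt_le hχ p hz.le)))).1 h

theorem exists_norm_primes_eq_one {a : ℕ → ℂ} (ha : Summable fun n => ‖a n‖)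
    (hne : ∀ χ : ℕ →*₀ ℂ, (∀ n, ‖χ n‖ ≤ 1) → ∑' n, a n * χ n ≠ 0)
    {χ : ℕ →*₀ ℂ} (hχ : ∀ n, ‖χ n‖ ≤ 1) (S : Finset ℕ) (hS : ∀ p ∈ S, p.Prime) :
    ∃ χ' : ℕ →*₀ ℂ, (∀ n, ‖χ' n‖ ≤ 1) ∧ (∀ p ∈ S, ‖χ' p‖ = 1) ∧
      ‖∑' n, a n * χ' n‖ ≤ ‖∑' n, a n * χ n‖ := by
  induction S using Finset.induction_on with
  | empty => exact ⟨χ, hχ, by simp, le_rfl⟩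
  | insert p S hpS ih =>
    obtain ⟨χ₁, h₁, h₁S, h₁le⟩ := ih fun q hq => hS q (mem_insert_of_mem hq)
    obtain ⟨χ₂, h₂, h₂p, h₂q, h₂le⟩ :=
      exists_norm_prime_eq_one ha hne h₁ (hS p (mem_insert_self p S))
    refine ⟨χ₂, h₂, fun q hq => ?_, h₂le.trans h₁le⟩
    rcases eq_or_ne q p with rfl | hqp
    · exact h₂p
    · have hqS := mem_of_mem_insert_of_ne hq hqp
      rw [h₂q q (hS q hq) hqp, h₁S q hqS]

theorem norm_eq_one_of_norm_primes_eq_one {χ : ℕ →*₀ ℂ} {N : ℕ}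
    (h : ∀ p, p.Prime → p ≤ N → ‖χ p‖ = 1) {n : ℕ} (hn : n ≠ 0) (hnN : n ≤ N) : ‖χ n‖ = 1 := by
  induction n using Nat.recOnMul with
  | zero => exact absurd rfl hn
  | one => simp
  | prime p hp => exact h p hp hnN
  | mul a b iha ihb =>
    have ha : a ≠ 0 := left_ne_zero_of_mul hn
    have hb : b ≠ 0 := right_ne_zero_of_mul hn
    rw [map_mul, norm_mul,
      iha ha ((Nat.le_mul_of_pos_right a (Nat.pos_of_ne_zero hb)).trans hnN),
      ihb hb ((Nat.le_mul_of_pos_left b (Nat.pos_of_ne_zero ha)).trans hnN), one_mul]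

/-- A completely multiplicative function unimodular up to `N` is approximated there by
`n ^ (it)`. -/
theorem exists_forall_norm_exp_log_sub_lt {χ : ℕ →*₀ ℂ} {N : ℕ}
    (h : ∀ n, n ≠ 0 → n ≤ N → ‖χ n‖ = 1) {ε : ℝ} (hε : 0 < ε) :
    ∃ t : ℝ, ∀ n, n ≠ 0 → n ≤ N →
      ‖Complex.exp (Real.log n * Complex.I * t) - χ n‖ < ε := by
  rcases Nat.eq_zero_or_pos N with rfl | hN
  · exact ⟨0, fun n hn hn0 => absurd (Nat.le_zero.1 hn0) hn⟩
  obtain ⟨t, ht⟩ := exists_forall_norm_exp_sub_lt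
    (fun i : Fin N => Real.log ((i + 1 : ℕ) : ℝ)) (fun i => χ (i + 1))
    (fun i => h _ (Nat.succ_ne_zero _) i.2)
    (fun K f g hfg => by
      have hpos : ∀ f : Fin K → Fin N, (0 : ℝ) < ∏ k, ((f k + 1 : ℕ) : ℝ) := fun f =>
        Finset.prod_pos fun k _ => by positivity
      rw [← Real.log_prod (fun k _ => by positivity),
        ← Real.log_prod (fun k _ => by positivity)] at hfg
      have h1 := Real.log_injOn_pos (hpos f) (hpos g) hfg
      have h2 : ∏ k, ((f k : ℕ) + 1) = ∏ k, ((g k : ℕ) + 1) := by exact_mod_cast h1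
      rw [← map_prod, ← map_prod, h2])
    ⟨0, hN⟩ (by simp) (by simp) hε
  refine ⟨t, fun n hn hnN => ?_⟩
  have := ht ⟨n - 1, by omega⟩
  simpa [Nat.sub_add_cancel (Nat.one_le_iff_ne_zero.2 hn)] using this

/-- If the sums over bounded completely multiplicative functions do not vanish, they inherit the
lower bound on the imaginary axis. -/
theorem le_norm_tsum_of_forall_ne_zero {a : ℕ → ℂ} (ha : Summable fun n => ‖a n‖) (ha0 : a 0 = 0)
    {C : ℝ} (hC : ∀ t : ℝ, C ≤ ‖∑' n : ℕ, a n * Complex.exp (Real.log n * Complex.I * t)‖)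
    (hne : ∀ χ : ℕ →*₀ ℂ, (∀ n, ‖χ n‖ ≤ 1) → ∑' n, a n * χ n ≠ 0)
    {χ : ℕ →*₀ ℂ} (hχ : ∀ n, ‖χ n‖ ≤ 1) : C ≤ ‖∑' n, a n * χ n‖ := by
  have hex : ∀ N : ℕ, ∃ (χ' : ℕ →*₀ ℂ) (t : ℝ), (∀ n, ‖χ' n‖ ≤ 1) ∧
      ‖∑' n, a n * χ' n‖ ≤ ‖∑' n, a n * χ n‖ ∧ ∀ n, n ≠ 0 → n ≤ N →
        ‖Complex.exp (Real.log n * Complex.I * t) - χ' n‖ < 1 / ((N : ℝ) + 1) := by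
    intro N
    obtain ⟨χ', h1, h2, h3⟩ := exists_norm_primes_eq_one ha hne hχ
      ((Finset.range (N + 1)).filter Nat.Prime) (fun p hp => (mem_filter.1 hp).2)
    obtain ⟨t, ht⟩ := exists_forall_norm_exp_log_sub_lt (χ := χ') (N := N)
      (fun n hn hnN => norm_eq_one_of_norm_primes_eq_one (fun p hp hpN =>
        h2 p (mem_filter.2 ⟨Finset.mem_range.2 (Nat.lt_succ_of_le hpN), hp⟩)) hn hnN)
      (Nat.one_div_pos_of_nat (α := ℝ) (n := N))
    exact ⟨χ', t, h1, h3, ht⟩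
  choose χ' t h1 h2 h3 using hex
  have hexp : ∀ (n : ℕ) (t : ℝ), ‖Complex.exp (Real.log n * Complex.I * t)‖ ≤ 1 :=
    fun n t => (norm_exp_ofReal_mul_I_mul_ofReal (Real.log n) t).le
  have hlim : Tendsto (fun N => ∑' n : ℕ, a n *
      (Complex.exp (Real.log n * Complex.I * t N) - χ' N n)) atTop (𝓝 (∑' _ : ℕ, 0)) := by
    refine tendsto_tsum_of_dominated_convergence (bound := fun n => ‖a n‖ * 2)
      (ha.mul_right 2) (fun n => ?_) (Eventually.of_forall fun N n => ?_)
    · rcases eq_or_ne n 0 with rfl | hn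
      · simp [ha0]
      rw [← mul_zero (a n)]
      refine Tendsto.const_mul _ (squeeze_zero_norm' ?_ tendsto_one_div_add_atTop_nhds_zero_nat)
      filter_upwards [eventually_ge_atTop n] with N hN
      exact (h3 N n hn hN).le
    · rw [norm_mul]
      gcongr
      refine (norm_sub_le _ _).trans ?_
      linarith [hexp n (t N), h1 N n]
  rw [tsum_zero] at hlim
  have hlim' := hlim.norm.add_const ‖∑' n, a n * χ n‖
  rw [norm_zero, zero_add] at hlim'
  refine ge_of_tendsto' hlim' fun N => ?_
  have s1 : Summable fun n : ℕ => a n * Complex.exp (Real.log n * Complex.I * t N) :=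
    Summable.of_norm_bounded ha fun n => norm_mul_le_of_norm_le_one a (hexp n _)
  have s2 : Summable fun n : ℕ => a n * χ' N n :=
    Summable.of_norm_bounded ha fun n => norm_mul_le_of_norm_le_one a (h1 N n)
  simp_rw [mul_sub]
  rw [s1.tsum_sub s2]
  have := norm_le_norm_sub_add (∑' n : ℕ, a n * Complex.exp (Real.log n * Complex.I * t N))
    (∑' n : ℕ, a n * χ' N n)
  linarith [hC (t N), h2 N]

theorem natCast_rpow_neg_le_one (n : ℕ) {σ : ℝ} (hσ : 0 ≤ σ) : (n : ℝ) ^ (-σ) ≤ 1 := by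
  rcases Nat.eq_zero_or_pos n with rfl | hn
  · simpa using Real.zero_rpow_le_one (-σ)
  · exact Real.rpow_le_one_of_one_le_of_nonpos (by exact_mod_cast hn) (by linarith)

theorem norm_natCast_rpow_neg_le_one (n : ℕ) {σ : ℝ} (hσ : 0 ≤ σ) :
    ‖(((n : ℝ) ^ (-σ) : ℝ) : ℂ)‖ ≤ 1 := by
  rw [Complex.norm_real, Real.norm_of_nonneg (by positivity)]
  exact natCast_rpow_neg_le_one n hσ

theorem tsum_ne_zero_of_norm_sub_le {f g : ℕ → ℂ} {b : ℕ → ℝ} {C : ℝ} (hf : Summable f)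
    (hg : Summable g) (hb : Summable b) (hfg : ∀ n, ‖f n - g n‖ ≤ b n) (hbC : ∑' n, b n < C)
    (hC : C ≤ ‖∑' n, g n‖) : ∑' n, f n ≠ 0 := by
  intro h0
  have h1 : ‖∑' n, (f n - g n)‖ ≤ ∑' n, b n := tsum_of_norm_bounded hb.hasSum hfg
  rw [hf.tsum_sub hg, h0, zero_sub, norm_neg] at h1
  linarith

/-- A lower bound for a Dirichlet series on the closed right half-plane forces nonvanishing at every
bounded completely multiplicative function. The proof descends in uniform steps from large abscissae
to `0`. -/
theorem tsum_mul_ne_zero_of_le_norm {a : ℕ → ℂ} (ha : Summable fun n => ‖a n‖) (ha0 : a 0 = 0)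
    {C : ℝ} (hC0 : 0 < C)
    (hC : ∀ σ : ℝ, 0 ≤ σ → ∀ t : ℝ, C ≤ ‖∑' n : ℕ, a n * (((n : ℝ) ^ (-σ) : ℝ) : ℂ) *
      Complex.exp (Real.log n * Complex.I * t)‖)
    {χ : ℕ →*₀ ℂ} (hχ : ∀ n, ‖χ n‖ ≤ 1) : ∑' n, a n * χ n ≠ 0 := by
  set A : ℝ → ℕ → ℂ := fun σ n => a n * (((n : ℝ) ^ (-σ) : ℝ) : ℂ) with hA
  have hAle : ∀ {σ : ℝ}, 0 ≤ σ → ∀ n, ‖A σ n‖ ≤ ‖a n‖ := fun hσ n =>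
    norm_mul_le_of_norm_le_one a (norm_natCast_rpow_neg_le_one n hσ)
  have hAsum : ∀ {σ : ℝ}, 0 ≤ σ → Summable fun n => ‖A σ n‖ := fun hσ =>
    Summable.of_nonneg_of_le (fun _ => norm_nonneg _) (hAle hσ) ha
  have hAχ : ∀ {σ : ℝ}, 0 ≤ σ → ∀ {χ : ℕ →*₀ ℂ}, (∀ n, ‖χ n‖ ≤ 1) →
      Summable fun n => A σ n * χ n := fun hσ χ hχ =>
    Summable.of_norm_bounded (hAsum hσ) fun n => norm_mul_le_of_norm_le_one _ (hχ n)
  have hlarge : ∃ σ₀ : ℝ, ∀ σ ≥ σ₀, ∀ χ : ℕ →*₀ ℂ, (∀ n, ‖χ n‖ ≤ 1) →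
      ∑' n, A σ n * χ n ≠ 0 := by
    have hlim : Tendsto (fun σ : ℝ => ∑' n : ℕ, ‖a n‖ * (if n = 1 then 0 else
        (n : ℝ) ^ (-σ) * 2)) atTop (𝓝 (∑' _ : ℕ, 0)) := by
      refine tendsto_tsum_of_dominated_convergence (bound := fun n => ‖a n‖ * 2)
        (ha.mul_right 2) (fun n => ?_) ?_
      · rcases eq_or_ne n 0 with rfl | hn
        · simp [ha0]
        rcases eq_or_ne n 1 with rfl | hn1
        · simp
        · have hn2 : (1 : ℝ) < n := by
            have : 1 < n := by omega
            exact_mod_cast this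
          have := (((tendsto_rpow_atBot_of_base_gt_one _ hn2).comp
            tendsto_neg_atTop_atBot).mul_const 2).const_mul ‖a n‖
          simpa [hn1] using this
      · filter_upwards [eventually_ge_atTop 0] with σ hσ n
        rw [Real.norm_of_nonneg (by positivity)]
        gcongr
        split_ifs
        · norm_num
        · linarith [natCast_rpow_neg_le_one n hσ]
    rw [tsum_zero] at hlim
    obtain ⟨σ₀, hσ₀⟩ := eventually_atTop.1
      ((hlim.eventually_lt_const hC0).and (eventually_ge_atTop 0))
    refine ⟨σ₀, fun σ hσ χ hχ => ?_⟩
    obtain ⟨hlt, hσ0⟩ := hσ₀ σ hσ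
    refine tsum_ne_zero_of_norm_sub_le (g := fun n => A σ n) (hAχ hσ0 hχ)
      (hAsum hσ0).of_norm ?_ (fun n => ?_) hlt (by simpa using hC σ hσ0 0)
    · refine Summable.of_nonneg_of_le (fun n => by positivity) (fun n => ?_) (ha.mul_right 2)
      gcongr
      split_ifs
      · norm_num
      · linarith [natCast_rpow_neg_le_one n hσ0]
    · rcases eq_or_ne n 1 with rfl | hn1
      · simp
      · have : A σ n * χ n - A σ n = a n * ((((n : ℝ) ^ (-σ) : ℝ) : ℂ) * (χ n - 1)) := by
          simp only [hA]
          ring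
        rw [this, norm_mul, norm_mul, if_neg hn1, Complex.norm_real,
          Real.norm_of_nonneg (by positivity)]
        gcongr
        refine (norm_sub_le _ _).trans ?_
        rw [norm_one]
        linarith [hχ n]
  have hstep : ∃ δ > 0, ∀ σ : ℝ, 0 ≤ σ →
      (∀ χ : ℕ →*₀ ℂ, (∀ n, ‖χ n‖ ≤ 1) → ∑' n, A (σ + δ) n * χ n ≠ 0) →
      ∀ χ : ℕ →*₀ ℂ, (∀ n, ‖χ n‖ ≤ 1) → ∑' n, A σ n * χ n ≠ 0 := by
    have hlim : Tendsto (fun δ : ℝ => ∑' n : ℕ, ‖a n‖ * (1 - (n : ℝ) ^ (-δ))) (𝓝[>] 0)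
        (𝓝 (∑' _ : ℕ, 0)) := by
      refine tendsto_tsum_of_dominated_convergence (bound := fun n => ‖a n‖) ha
        (fun n => ?_) ?_
      · rcases eq_or_ne n 0 with rfl | hn
        · simp [ha0]
        have hn' : (n : ℝ) ≠ 0 := by exact_mod_cast hn
        have hcont : Continuous fun δ : ℝ => ‖a n‖ * (1 - (n : ℝ) ^ (-δ)) :=
          continuous_const.mul (continuous_const.sub
            (Real.continuous_const_rpow hn' |>.comp continuous_neg))
        have := (hcont.tendsto 0).mono_left (nhdsWithin_le_nhds (s := Set.Ioi 0))
        simpa using this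
      · filter_upwards [self_mem_nhdsWithin] with δ hδ n
        have h1 := natCast_rpow_neg_le_one n (le_of_lt hδ)
        have h2 : 0 ≤ (n : ℝ) ^ (-δ) := by positivity
        rw [norm_mul, norm_norm, Real.norm_of_nonneg (by linarith)]
        exact mul_le_of_le_one_right (norm_nonneg _) (by linarith)
    rw [tsum_zero] at hlim
    obtain ⟨δ, hlt, hδ⟩ :=
      ((hlim.eventually_lt_const hC0).and self_mem_nhdsWithin).exists
    have hδ : 0 < δ := hδ
    refine ⟨δ, hδ, fun σ hσ hne χ hχ => ?_⟩
    have hσδ : 0 ≤ σ + δ := by linarith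
    refine tsum_ne_zero_of_norm_sub_le (hAχ hσ hχ) (hAχ hσδ hχ) ?_ (fun n => ?_) hlt
      (le_norm_tsum_of_forall_ne_zero (hAsum hσδ) (by simp [hA, ha0]) (hC (σ + δ) hσδ) hne hχ)
    · refine Summable.of_nonneg_of_le (fun n => ?_) (fun n => ?_) ha
      · exact mul_nonneg (norm_nonneg _) (by linarith [natCast_rpow_neg_le_one n hδ.le])
      · have h2 : 0 ≤ (n : ℝ) ^ (-δ) := by positivity
        exact mul_le_of_le_one_right (norm_nonneg _) (by linarith)
    · rcases Nat.eq_zero_or_pos n with rfl | hn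
      · simp [hA, ha0]
      · have hnpos : (0 : ℝ) < n := by exact_mod_cast hn
        have h1 := natCast_rpow_neg_le_one n hδ.le
        have : A σ n * χ n - A (σ + δ) n * χ n =
            A σ n * χ n * ((1 - (n : ℝ) ^ (-δ) : ℝ) : ℂ) := by
          simp only [hA]
          rw [neg_add, Real.rpow_add hnpos]
          push_cast
          ring
        rw [this, norm_mul, Complex.norm_real, Real.norm_of_nonneg (by linarith)]
        exact mul_le_mul_of_nonneg_right
          ((norm_mul_le_of_norm_le_one _ (hχ n)).trans (hAle hσ n)) (by linarith)
  obtain ⟨σ₀, hσ₀⟩ := hlarge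
  obtain ⟨δ, hδ, hstep⟩ := hstep
  obtain ⟨m, hm⟩ := exists_nat_ge (σ₀ / δ)
  have hm' : (m : ℝ) * δ ≥ σ₀ := (div_le_iff₀ hδ).1 hm
  have hzero : ∀ χ : ℕ →*₀ ℂ, (∀ n, ‖χ n‖ ≤ 1) → ∑' n, A ((0 : ℕ) * δ) n * χ n ≠ 0 := by
    refine Nat.decreasingInduction (motive := fun j _ => ∀ χ : ℕ →*₀ ℂ, (∀ n, ‖χ n‖ ≤ 1) →
      ∑' n, A ((j : ℝ) * δ) n * χ n ≠ 0) (fun j _ hj => ?_) (hσ₀ _ hm') (Nat.zero_le m)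
    refine hstep _ (by positivity) ?_
    convert hj using 7
    push_cast
    ring
  simpa [hA] using hzero χ hχ

theorem tsum_pnat_eq_tsum_of_zero {f : ℕ → ℂ} (hf : f 0 = 0) :
    ∑' n : ℕ+, f n = ∑' n, f n :=
  PNat.coe_injective.tsum_eq fun n hn =>
    ⟨⟨n, Nat.pos_of_ne_zero fun h => hn (h ▸ hf)⟩, rfl⟩

/-- If the Dirichlet series `Σ k(n)ρ(n)n^{−s}` is bounded below in modulus by `C > 0`
on the closed right half-plane, then `Σ k(n)·conj(ψ(n)) ≠ 0` for every completely
multiplicative `ψ` with `|ψ| ≤ ρ`. -/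
theorem dirichlet_laplace_ne_zero (ρ : ℕ → ℝ) (k : ℕ → ℂ)
    (hρ_pos : ∀ n, 1 ≤ n → 0 < ρ n) (hρ1 : ρ 1 = 1)
    (hρ_mul : ∀ m n, 1 ≤ m → 1 ≤ n → ρ (m * n) = ρ m * ρ n)
    (hk : Summable fun n : ℕ+ => ‖k (n : ℕ)‖ * ρ (n : ℕ))
    (hC : ∃ C > 0, ∀ s : ℂ, 0 ≤ s.re →
      C ≤ ‖∑' n : ℕ+, k (n : ℕ) * (ρ (n : ℕ) : ℂ) * ((n : ℕ) : ℂ) ^ (-s)‖) :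
    ∀ ψ : ℕ → ℂ, ψ 1 = 1 → (∀ m n, 1 ≤ m → 1 ≤ n → ψ (m * n) = ψ m * ψ n) →
      (∀ n, 1 ≤ n → ‖ψ n‖ ≤ ρ n) →
      (∑' n : ℕ+, k (n : ℕ) * (starRingEnd ℂ) (ψ (n : ℕ))) ≠ 0 := by
  intro ψ hψ1 hψ_mul hψ_le
  obtain ⟨C, hC0, hC⟩ := hC
  have hρ : ∀ n, n ≠ 0 → (ρ n : ℂ) ≠ 0 := fun n hn => by
    exact_mod_cast (hρ_pos n (Nat.one_le_iff_ne_zero.2 hn)).ne'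
  let χ : ℕ →*₀ ℂ :=
    { toFun := fun n => if n = 0 then 0 else (starRingEnd ℂ) (ψ n) / ρ n
      map_zero' := if_pos rfl
      map_one' := by simp [hψ1, hρ1]
      map_mul' := fun m n => by
        rcases eq_or_ne m 0 with rfl | hm
        · simp
        rcases eq_or_ne n 0 with rfl | hn
        · simp
        have hm1 := Nat.one_le_iff_ne_zero.2 hm
        have hn1 := Nat.one_le_iff_ne_zero.2 hn
        rw [if_neg hm, if_neg hn, if_neg (mul_ne_zero hm hn), hψ_mul m n hm1 hn1,
          hρ_mul m n hm1 hn1, map_mul, Complex.ofReal_mul, mul_div_mul_comm] }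
  have hχ_apply : ∀ n, n ≠ 0 → χ n = (starRingEnd ℂ) (ψ n) / ρ n := fun n hn => if_neg hn
  have hχ : ∀ n, ‖χ n‖ ≤ 1 := by
    intro n
    rcases eq_or_ne n 0 with rfl | hn
    · simp
    have hn1 := Nat.one_le_iff_ne_zero.2 hn
    rw [hχ_apply n hn, norm_div, Complex.norm_conj, Complex.norm_real,
      Real.norm_of_nonneg (hρ_pos n hn1).le]
    exact div_le_one_of_le₀ (hψ_le n hn1) (hρ_pos n hn1).le
  set a : ℕ → ℂ := fun n => if n = 0 then 0 else k n * ρ n with ha_def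
  have ha_apply : ∀ n : ℕ+, a n = k n * ρ n := fun n => if_neg n.ne_zero
  have ha0 : a 0 = 0 := if_pos rfl
  have ha : Summable fun n => ‖a n‖ := by
    rw [← PNat.coe_injective.summable_iff]
    · refine hk.congr fun n => ?_
      rw [Function.comp_apply, ha_apply, norm_mul, Complex.norm_real,
        Real.norm_of_nonneg (hρ_pos n n.2).le]
    · intro n hn
      have : n = 0 := by
        by_contra h
        exact hn ⟨⟨n, Nat.pos_of_ne_zero h⟩, rfl⟩
      rw [this, ha0, norm_zero]
  have hmain := tsum_mul_ne_zero_of_le_norm ha ha0 hC0 (fun σ hσ t => by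
    refine (hC (σ - t * Complex.I) (by simpa using hσ)).trans_eq ?_
    rw [← tsum_pnat_eq_tsum_of_zero (by simp [ha0])]
    congr 1
    refine tsum_congr fun n => ?_
    have hn : ((n : ℕ) : ℂ) ≠ 0 := by exact_mod_cast n.ne_zero
    rw [ha_apply, mul_assoc _ (Complex.ofReal _) (Complex.exp _), neg_sub, sub_eq_neg_add,
      Complex.cpow_add _ _ hn, Complex.ofReal_cpow (by positivity), Complex.cpow_def_of_ne_zero hn
      (t * Complex.I), Complex.natCast_log]
    push_cast
    ring_nf) hχ
  rw [← tsum_pnat_eq_tsum_of_zero (by simp [ha0])] at hmain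
  convert hmain using 3 with n
  rw [ha_apply, hχ_apply n n.ne_zero, mul_assoc, mul_div_cancel₀ _ (hρ n n.ne_zero)]
end
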